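/- arXiv:1305.4238 — 2 statements merged into one kernel-verified Lean document; each statement's English description precedes it below -/
import Mathlib

section
/- Let R be a one-dimensional Cohen–Macaulay local ring with maximal ideal m whose integral closure R̄ in the total ring of fractions Q(R) is a finitely generated R-module and satisfies mR̄ ⊆ R (so m = mR̄). Then R possesses a canonical module K_R, and for every faithful fractional ideal I of R: if I ⊗_R Hom_R(I, K_R) is torsionfree, then I ≅ R or I ≅ K_R as an R-module. -/
open CategoryTheory TensorProduct

noncomputable section

/-- Minimal number of generators of a submodule. -/
def minGen (R : Type*) {M : Type*} [Semiring R] [AddCommMonoid M] [Module R M]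
    (p : Submodule R M) : ℕ :=
  sInf {n | ∃ s : Finset M, s.card = n ∧ Submodule.span R (s : Set M) = p}

/-- Length of a module, as the height of `⊤` in its lattice of submodules. -/
def moduleLength (R M : Type*) [Ring R] [AddCommGroup M] [Module R M] : ℕ∞ :=
  Order.height (⊤ : Submodule R M)

/-- `e` is the (Hilbert–Samuel) multiplicity of the one-dimensional local ring `(R, m)`:
the first difference of the Hilbert–Samuel function `n ↦ ℓ_R(R/mⁿ)` is eventually
equal to `e`. -/
def IsMultiplicityAt (R : Type*) [CommRing R] (m : Ideal R) (e : ℕ) : Prop :=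
  ∃ N : ℕ, ∀ n ≥ N,
    moduleLength R (R ⧸ (m ^ (n + 1))) = moduleLength R (R ⧸ (m ^ n)) + e

/-- The `i`-th Ext module `Ext_R^i(M, N)`. -/
def extMod (R : Type u) [CommRing R] (M N : ModuleCat.{u} R) (i : ℕ) : ModuleCat R :=
  ((Ext R (ModuleCat.{u} R) i).obj (Opposite.op M)).obj N

/-- `K` is a canonical module of the one-dimensional Cohen–Macaulay local ring `R` with
maximal ideal `m`, via the Bass-number characterization:
`Ext^i(R/m, K) = 0` for `i ≠ 1` and `Ext^1(R/m, K) ≅ R/m`. -/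
def IsCanonicalModuleAt (R : Type u) [CommRing R] (m : Ideal R)
    (K : Type u) [AddCommGroup K] [Module R K] : Prop :=
  Module.Finite R K ∧
  (∀ i : ℕ, i ≠ 1 →
    Subsingleton (extMod R (ModuleCat.of R (R ⧸ m)) (ModuleCat.of R K) i)) ∧
  Nonempty ((extMod R (ModuleCat.of R (R ⧸ m)) (ModuleCat.of R K) 1) ≅
    ModuleCat.of R (R ⧸ m))

/-- The evaluation map `I ⊗_R Hom_R(I, K) → K`, `x ⊗ f ↦ f x`. -/
def evalMap (R : Type*) [CommRing R] {M : Type*} [AddCommGroup M] [Module R M]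
    (I : Submodule R M) (K : Type*) [AddCommGroup K] [Module R K] :
    (I ⊗[R] (I →ₗ[R] K)) →ₗ[R] K :=
  TensorProduct.lift LinearMap.applyₗ

/-- A fractional ideal `I` of `R` with `FI = F`: a finitely generated `R`-submodule of the
total ring of fractions `F = Q(R)` containing a unit of `F`. -/
def IsFracIdealUnit (R : Type*) [CommRing R] (I : Submodule R (FractionRing R)) : Prop :=
  I.FG ∧ ∃ x ∈ I, IsUnit x

/-- A one-dimensional Cohen–Macaulay local ring: Noetherian, local, Krull dimension one,
and the maximal ideal contains a nonzerodivisor. -/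
def IsOneDimCMLocal (R : Type*) [CommRing R] [IsLocalRing R] : Prop :=
  IsNoetherianRing R ∧ ringKrullDim R = 1 ∧
    ∃ x ∈ IsLocalRing.maximalIdeal R, x ∈ nonZeroDivisors R

/-- The colon `M : N = {x ∈ A | x N ⊆ M}` of two `R`-submodules of an `R`-algebra `A`,
as an `R`-submodule of `A`. -/
def colonSub {R A : Type*} [CommRing R] [CommRing A] [Algebra R A]
    (M N : Submodule R A) : Submodule R A where
  carrier := {x : A | ∀ y ∈ N, x * y ∈ M}
  add_mem' := fun {a b} ha hb y hy => by
    rw [add_mul]; exact M.add_mem (ha y hy) (hb y hy)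
  zero_mem' := fun y hy => by rw [zero_mul]; exact M.zero_mem
  smul_mem' := fun c {x} hx y hy => by
    rw [smul_mul_assoc]; exact M.smul_mem c (hx y hy)


section Ext

universe w

variable {R : Type w} [CommRing R] {X : ℕ → Type w} [∀ n, AddCommGroup (X n)] [∀ n, Module R (X n)]
  {M K : Type w} [AddCommGroup M] [Module R M] [AddCommGroup K] [Module R K]

/-- The chain complex of `R`-modules attached to a sequence of composable linear maps. -/
abbrev linearComplex (d : ∀ n, X (n + 1) →ₗ[R] X n) (hd : ∀ n, Function.Exact (d (n + 1)) (d n)) :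
    ChainComplex (ModuleCat.{w} R) ℕ :=
  ChainComplex.of (fun n => ModuleCat.of R (X n)) (fun n => ModuleCat.ofHom (d n))
    (fun n => by
      ext x
      exact (hd n).apply_apply_eq_zero x)

variable (d : ∀ n, X (n + 1) →ₗ[R] X n) (hd : ∀ n, Function.Exact (d (n + 1)) (d n))

lemma linearComplex_d (n : ℕ) : (linearComplex d hd).d (n + 1) n = ModuleCat.ofHom (d n) :=
  ChainComplex.of_d (fun n => ModuleCat.of R (X n)) (fun n => ModuleCat.ofHom (d n)) n

lemma linearComplex_exactAt_succ (n : ℕ) : (linearComplex d hd).ExactAt (n + 1) := by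
  rw [HomologicalComplex.exactAt_iff' _ (n + 1 + 1) (n + 1) n (by simp) (by simp),
    ShortComplex.moduleCat_exact_iff]
  simp only [HomologicalComplex.sc', HomologicalComplex.shortComplexFunctor', ChainComplex.of_d]
  exact fun x hx => (hd n x).1 hx

/-- The projective resolution of `M` attached to an exact sequence of projective modules. -/
def linearResolution [∀ n, Module.Projective R (X n)] (ε : X 0 →ₗ[R] M)
    (hε : Function.Surjective ε) (hdε : Function.Exact (d 0) ε) :
    ProjectiveResolution (ModuleCat.of R M) where
  complex := linearComplex d hd
  projective n := (IsProjective.iff_projective (X n)).1 inferInstance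
  π := (ChainComplex.toSingle₀Equiv _ _).symm ⟨ModuleCat.ofHom ε, by
    rw [linearComplex_d]
    ext x
    exact hdε.apply_apply_eq_zero x⟩
  quasiIso := ⟨fun n => by
    cases n
    · rw [ChainComplex.quasiIsoAt₀_iff, ShortComplex.quasiIso_iff_of_zeros']
      · refine (ShortComplex.exact_and_epi_g_iff_of_iso (S₂ := ShortComplex.mk
          (ModuleCat.ofHom (d 0)) (ModuleCat.ofHom ε) ?_) ?_).2 ⟨?_, ?_⟩
        · ext x
          exact hdε.apply_apply_eq_zero x
        · exact ShortComplex.isoMk (Iso.refl _) (Iso.refl _) (Iso.refl _)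
            ((Category.id_comp _).trans
              ((linearComplex_d d hd 0).symm.trans (Category.comp_id _).symm))
            ((Category.id_comp _).trans (Category.comp_id _).symm)
        · rw [ShortComplex.moduleCat_exact_iff]
          exact fun x hx => (hdε x).1 hx
        · exact (ModuleCat.epi_iff_surjective _).2 hε
      all_goals rfl
    · rw [quasiIsoAt_iff_exactAt']
      · apply linearComplex_exactAt_succ
      · apply ChainComplex.exactAt_succ_single_obj⟩

include hd in
lemma linearYonedaObj_d_apply (n : ℕ) (f : X n →ₗ[R] K) :
    ((linearComplex d hd).linearYonedaObj R (ModuleCat.of R K)).d n (n + 1) (ModuleCat.ofHom f) =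
      ModuleCat.ofHom (f ∘ₗ d n) :=
  congrArg (fun a => a ≫ ModuleCat.ofHom f) (linearComplex_d d hd n)

variable [∀ n, Module.Projective R (X n)] (ε : X 0 →ₗ[R] M)
    (hε : Function.Surjective ε) (hdε : Function.Exact (d 0) ε)

include hd hε hdε in
lemma subsingleton_extMod_succ (n : ℕ)
    (h : ∀ f : X (n + 1) →ₗ[R] K, f ∘ₗ d (n + 1) = 0 → ∃ g : X n →ₗ[R] K, g ∘ₗ d n = f) :
    Subsingleton (extMod R (ModuleCat.of R M) (ModuleCat.of R K) (n + 1)) := by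
  refine ModuleCat.subsingleton_of_isZero
    (.of_iso ?_ ((linearResolution d hd ε hε hdε).isoExt (n + 1) _))
  rw [← HomologicalComplex.exactAt_iff_isZero_homology,
    HomologicalComplex.exactAt_iff' _ n (n + 1) (n + 2) (by simp) (by simp),
    ShortComplex.moduleCat_exact_iff]
  intro f hf
  obtain ⟨g, hg⟩ := h f.hom
    (congrArg ModuleCat.Hom.hom ((linearYonedaObj_d_apply d hd (n + 1) f.hom).symm.trans hf))
  exact ⟨ModuleCat.ofHom g,
    (linearYonedaObj_d_apply d hd n g).trans (congrArg ModuleCat.ofHom hg)⟩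

include hd hε hdε in
lemma subsingleton_extMod_zero (h : ∀ f : X 0 →ₗ[R] K, f ∘ₗ d 0 = 0 → f = 0) :
    Subsingleton (extMod R (ModuleCat.of R M) (ModuleCat.of R K) 0) := by
  refine ModuleCat.subsingleton_of_isZero
    (.of_iso ?_ ((linearResolution d hd ε hε hdε).isoExt 0 _))
  rw [← HomologicalComplex.exactAt_iff_isZero_homology,
    HomologicalComplex.exactAt_iff' _ 0 0 1 (by simp) (by simp),
    ShortComplex.moduleCat_exact_iff]
  intro f hf
  have := h f.hom
    (congrArg ModuleCat.Hom.hom ((linearYonedaObj_d_apply d hd 0 f.hom).symm.trans hf))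
  exact ⟨0, (map_zero _).trans (congrArg ModuleCat.ofHom this).symm⟩

include hd hε hdε in
lemma nonempty_extMod_one_iso {N : Type w} [AddCommGroup N] [Module R N]
    (L : LinearMap.ker (LinearMap.lcomp R K (d 1)) →ₗ[R] N) (hL : Function.Surjective L)
    (hker : ∀ f, L f = 0 ↔ ∃ g : X 0 →ₗ[R] K, g ∘ₗ d 0 = f) :
    Nonempty (extMod R (ModuleCat.of R M) (ModuleCat.of R K) 1 ≅ ModuleCat.of R N) := by
  let C := (linearComplex d hd).linearYonedaObj R (ModuleCat.of R K)
  let S := C.sc' 0 1 2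
  have hg (f : X 1 →ₗ[R] K) : S.g.hom (ModuleCat.ofHom f) = 0 ↔ LinearMap.lcomp R K (d 1) f = 0 :=
    ⟨fun h => congrArg ModuleCat.Hom.hom ((linearYonedaObj_d_apply d hd 1 f).symm.trans h),
     fun h => (linearYonedaObj_d_apply d hd 1 f).trans (congrArg ModuleCat.ofHom h)⟩
  let L' : LinearMap.ker S.g.hom →ₗ[R] N :=
    { toFun f := L ⟨f.1.hom, (hg f.1.hom).1 f.2⟩
      map_add' f g := L.map_add ⟨f.1.hom, (hg f.1.hom).1 f.2⟩ ⟨g.1.hom, (hg g.1.hom).1 g.2⟩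
      map_smul' r f := L.map_smul r ⟨f.1.hom, (hg f.1.hom).1 f.2⟩ }
  have hL' : Function.Surjective L' := fun y => by
    obtain ⟨f, rfl⟩ := hL y
    exact ⟨⟨ModuleCat.ofHom f.1, (hg f.1).2 f.2⟩, rfl⟩
  have hrange : LinearMap.range S.moduleCatToCycles = LinearMap.ker L' := by
    ext f
    refine Iff.trans ?_ (hker ⟨f.1.hom, (hg f.1.hom).1 f.2⟩).symm
    constructor
    · rintro ⟨g, rfl⟩
      exact ⟨g.hom, congrArg ModuleCat.Hom.hom (linearYonedaObj_d_apply d hd 0 g.hom).symm⟩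
    · rintro ⟨g, hg⟩
      exact ⟨ModuleCat.ofHom g, Subtype.ext
        ((linearYonedaObj_d_apply d hd 0 g).trans (congrArg ModuleCat.ofHom hg))⟩
  exact ⟨(linearResolution d hd ε hε hdε).isoExt 1 _ ≪≫
    ShortComplex.homologyMapIso (C.isoSc' 0 1 2 (by simp) (by simp)) ≪≫
    S.moduleCatHomologyIso ≪≫
    ((Submodule.quotEquivOfEq _ _ hrange).trans (L'.quotKerEquivOfSurjective hL')).toModuleIso⟩

end Ext

section Resolution

/-- Words of length `n` in the alphabet `J`. -/
inductive Word (J : Type) : ℕ → Type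
  | nil : Word J 0
  | snoc {n : ℕ} (w : Word J n) (j : J) : Word J (n + 1)

/-- The index set of the standard basis of the `n`-th module of the resolution. -/
inductive ResIndex (J : Type) : ℕ → Type
  | root : ResIndex J 0
  | node {n : ℕ} (w : Word J n) (o : Option J) : ResIndex J (n + 1)

open Word ResIndex

instance Word.finite (J : Type) [Finite J] : ∀ n, Finite (Word J n)
  | 0 => Finite.of_surjective (fun _ : Unit => nil) fun | nil => ⟨(), rfl⟩
  | n + 1 =>
    have := Word.finite J n
    Finite.of_surjective (fun p : Word J n × J => snoc p.1 p.2) fun | snoc w j => ⟨(w, j), rfl⟩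

instance ResIndex.finite (J : Type) [Finite J] : ∀ n, Finite (ResIndex J n)
  | 0 => Finite.of_surjective (fun _ : Unit => root) fun | root => ⟨(), rfl⟩
  | n + 1 => Finite.of_surjective (fun p : Word J n × Option J => node p.1 p.2)
      fun | node w o => ⟨(w, o), rfl⟩

universe w

variable {R : Type w} [CommRing R] {J : Type} [Fintype J] (c : Option J → R) (β : J → Option J → R)

/-- The differentials of the resolution of the residue field. -/
def resDiff : ∀ n, (ResIndex J (n + 1) → R) →ₗ[R] (ResIndex J n → R)
  | 0 => LinearMap.pi fun _ => ∑ i, c i • LinearMap.proj (node nil i)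
  | _ + 1 => LinearMap.pi fun
    | node w none => -∑ j, ∑ i, β j i • LinearMap.proj (node (snoc w j) i)
    | node w (some j) => ∑ i, c i • LinearMap.proj (node (snoc w j) i)

lemma resDiff_zero_apply (x : ResIndex J 1 → R) :
    resDiff c β 0 x root = ∑ i, c i * x (node nil i) := by
  simp only [resDiff, LinearMap.pi_apply, LinearMap.sum_apply,
    LinearMap.smul_apply, LinearMap.proj_apply, smul_eq_mul]

lemma resDiff_succ_apply_none (n : ℕ) (x : ResIndex J (n + 2) → R) (w : Word J n) :
    resDiff c β (n + 1) x (node w none) = -∑ j, ∑ i, β j i * x (node (snoc w j) i) := by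
  simp only [resDiff, LinearMap.pi_apply, LinearMap.neg_apply, LinearMap.sum_apply,
    LinearMap.smul_apply, LinearMap.proj_apply, smul_eq_mul]

lemma resDiff_succ_apply_some (n : ℕ) (x : ResIndex J (n + 2) → R) (w : Word J n) (j : J) :
    resDiff c β (n + 1) x (node w (some j)) = ∑ i, c i * x (node (snoc w j) i) := by
  simp only [resDiff, LinearMap.pi_apply, LinearMap.sum_apply,
    LinearMap.smul_apply, LinearMap.proj_apply, smul_eq_mul]

open Classical in
lemma resDiff_zero_single (i : Option J) :
    resDiff c β 0 (Pi.single (node nil i) 1) = c i • Pi.single root 1 := by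
  ext ⟨⟩
  simp [resDiff_zero_apply, Pi.single_apply]

open Classical in
lemma resDiff_succ_single (n : ℕ) (w : Word J n) (j : J) (i : Option J) :
    resDiff c β (n + 1) (Pi.single (node (snoc w j) i) 1) =
      c i • Pi.single (node w (some j)) 1 - β j i • Pi.single (node w none) 1 := by
  ext (_ | ⟨p, _ | k⟩)
  · by_cases hp : p = w <;>
      simp [resDiff_succ_apply_none, Pi.single_apply, hp, ite_and]
  · by_cases hp : p = w <;> by_cases hk : k = j <;>
      simp [resDiff_succ_apply_some, Pi.single_apply, hp, hk]

variable {Q : Type w} [CommRing Q] [Algebra R Q] {c β} {a : Q} {v : Option J → Q}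

lemma resDiff_eq_zero_iff (hinj : Function.Injective (algebraMap R Q)) (ha : IsUnit a)
    (hc : ∀ i, algebraMap R Q (c i) = a * v i)
    (hβ : ∀ j i, algebraMap R Q (β j i) = a * (v (some j) * v i)) (n : ℕ)
    (x : ResIndex J (n + 1) → R) :
    resDiff c β n x = 0 ↔ ∀ w : Word J n, ∑ i, x (node w i) • v i = 0 := by
  have key (w : Word J n) : ∑ i, c i * x (node w i) = 0 ↔ ∑ i, x (node w i) • v i = 0 := by
    rw [← map_eq_zero_iff _ hinj, ← ha.mul_right_eq_zero (b := ∑ i, x (node w i) • v i), map_sum,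
      Finset.mul_sum]
    simp only [map_mul, hc, Algebra.smul_def]
    exact Eq.congr_left (Finset.sum_congr rfl fun _ _ => by ring)
  cases n with
  | zero =>
    simp_rw [← key]
    constructor
    · rintro h ⟨⟩
      rw [← resDiff_zero_apply, h, Pi.zero_apply]
    · intro h
      ext ⟨⟩
      rw [resDiff_zero_apply, h, Pi.zero_apply]
  | succ n =>
    simp_rw [← key]
    constructor
    · rintro h (_ | ⟨w, j⟩)
      exact (resDiff_succ_apply_some c β n x w j).symm.trans (congrFun h _)
    · intro h
      ext (_ | ⟨w, o⟩)
      cases o with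
      | none =>
        rw [resDiff_succ_apply_none, Pi.zero_apply, neg_eq_zero]
        refine Finset.sum_eq_zero fun j _ => hinj ?_
        have := congrArg (fun r => v (some j) * algebraMap R Q r) (h (snoc w j))
        simp only [map_sum, map_mul, hc, map_zero, mul_zero, hβ, Finset.mul_sum] at this ⊢
        rw [← this]
        exact Finset.sum_congr rfl fun _ _ => by ring
      | some j => exact (resDiff_succ_apply_some c β n x w j).trans (h (snoc w j))

lemma resDiff_exact (hinj : Function.Injective (algebraMap R Q)) (ha : IsUnit a)
    (hc : ∀ i, algebraMap R Q (c i) = a * v i)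
    (hβ : ∀ j i, algebraMap R Q (β j i) = a * (v (some j) * v i)) (hv : v none = 1)
    (hind : ∀ x : Option J → R, ∑ i, x i • v i = 0 → ∀ i, ∃ y : Option J → R, ∑ k, c k * y k = x i)
    (n : ℕ) : Function.Exact (resDiff c β (n + 1)) (resDiff c β n) := by
  intro x
  rw [resDiff_eq_zero_iff hinj ha hc hβ]
  constructor
  · intro h
    choose y hy using fun w => hind (fun i => x (node w i)) (h w)
    let z : ResIndex J (n + 2) → R := fun | node (snoc w j) i => y w (some j) i
    refine ⟨z, ?_⟩
    have hsome (w : Word J n) (j : J) :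
        resDiff c β (n + 1) z (node w (some j)) = x (node w (some j)) :=
      (resDiff_succ_apply_some c β n _ w j).trans (hy w (some j))
    ext (_ | ⟨w, o⟩)
    cases o with
    | some j => exact hsome w j
    | none =>
      refine hinj ?_
      have h1 := h w
      rw [Fintype.sum_option, hv, Algebra.smul_def, mul_one, add_eq_zero_iff_eq_neg] at h1
      rw [h1, resDiff_succ_apply_none, map_neg, map_sum]
      congr 1
      refine Finset.sum_congr rfl fun j _ => ?_
      rw [← hy w (some j), Algebra.smul_def, map_sum, map_sum, Finset.sum_mul]
      refine Finset.sum_congr rfl fun i _ => ?_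
      rw [map_mul, map_mul, hβ, hc, show z (node (snoc w j) i) = y w (some j) i from rfl]
      ring
  · rintro ⟨y, rfl⟩ w
    rw [Fintype.sum_option, hv, resDiff_succ_apply_none, Algebra.smul_def, mul_one, map_neg,
      neg_add_eq_zero, map_sum]
    refine Finset.sum_congr rfl fun j _ => ?_
    rw [resDiff_succ_apply_some, Algebra.smul_def, map_sum, map_sum, Finset.sum_mul]
    refine Finset.sum_congr rfl fun i _ => ?_
    rw [map_mul, map_mul, hβ, hc]
    ring

open Classical in
/-- A cocycle condition for linear maps out of the resolution into a submodule of `Q`. -/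
lemma comp_resDiff_succ_eq_zero_iff (ha : IsUnit a)
    (hc : ∀ i, algebraMap R Q (c i) = a * v i)
    (hβ : ∀ j i, algebraMap R Q (β j i) = a * (v (some j) * v i)) (hv : v none = 1)
    {K : Submodule R Q} (n : ℕ) (f : (ResIndex J (n + 1) → R) →ₗ[R] K) :
    f ∘ₗ resDiff c β (n + 1) = 0 ↔ ∀ w j, (f (Pi.single (node w (some j)) 1) : Q) =
      v (some j) * f (Pi.single (node w none) 1) := by
  have key (w : Word J n) (j : J) (i : Option J) :
      (f (resDiff c β (n + 1) (Pi.single (node (snoc w j) i) 1)) : Q) =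
        a * v i * (f (Pi.single (node w (some j)) 1) -
          v (some j) * f (Pi.single (node w none) 1)) := by
    rw [resDiff_succ_single, map_sub, map_smul, map_smul, Submodule.coe_sub, Submodule.coe_smul,
      Submodule.coe_smul, Algebra.smul_def, Algebra.smul_def, hc, hβ]
    ring
  constructor
  · intro h w j
    have := key w j none
    rw [← LinearMap.comp_apply, h, LinearMap.zero_apply, Submodule.coe_zero, hv, mul_one, eq_comm,
      ha.mul_right_eq_zero] at this
    exact sub_eq_zero.1 this
  · intro h
    refine LinearMap.pi_ext' fun p => LinearMap.ext_ring ?_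
    rcases p with _ | ⟨_ | ⟨w, j⟩, i⟩
    refine Subtype.ext ((key w j i).trans ?_)
    rw [h, sub_self, mul_zero]
    rfl

/-- If `m = a V` where `V` is generated over `R` by `v`, and `φ` is a nondegenerate functional
on `V` with values in `R/m`, then its kernel is a canonical module. -/
theorem isCanonicalModuleAt_of_functional {m : Ideal R} (hinj : Function.Injective (algebraMap R Q))
    (ha : IsUnit a) (hc : ∀ i, algebraMap R Q (c i) = a * v i)
    (hβ : ∀ j i, algebraMap R Q (β j i) = a * (v (some j) * v i)) (hv : v none = 1)
    (hm : ∀ r, r ∈ m ↔ ∃ y : Option J → R, ∑ k, c k * y k = r)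
    (hind : ∀ x : Option J → R, ∑ i, x i • v i = 0 → ∀ i, x i ∈ m)
    {V : Submodule R Q} (φ : V →ₗ[R] R ⧸ m) (hφ : Function.Surjective φ) {K : Submodule R Q}
    (hK : K = (LinearMap.ker φ).map V.subtype) [Module.Finite R K]
    (hcolon : ∀ q, q ∈ V ↔ ∀ i, a * v i * q ∈ K)
    (hsolve : ∀ q : J → Q, (∀ j, q j ∈ V) → ∃ h ∈ K, ∀ j, v (some j) * h + q j ∈ K) :
    IsCanonicalModuleAt R m K := by
  have hKmem (q : V) : (q : Q) ∈ K ↔ φ q = 0 := by simp [hK]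
  have hexact := resDiff_exact hinj ha hc hβ hv fun x hx i => (hm _).1 (hind x hx i)
  let ε : (ResIndex J 0 → R) →ₗ[R] R ⧸ m := m.mkQ ∘ₗ LinearMap.proj root
  have hε : Function.Surjective ε := fun y => by
    obtain ⟨r, rfl⟩ := m.mkQ_surjective y
    exact ⟨fun _ => r, rfl⟩
  have hdε : Function.Exact (resDiff c β 0) ε := fun x => by
    have : ε x = 0 ↔ x root ∈ m := Ideal.Quotient.eq_zero_iff_mem
    rw [this, hm]
    constructor
    · rintro ⟨y, hy⟩
      refine ⟨fun | node _ i => y i, ?_⟩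
      ext ⟨⟩
      rw [resDiff_zero_apply, ← hy]
      rfl
    · rintro ⟨y, rfl⟩
      exact ⟨fun i => y (node nil i), (resDiff_zero_apply c β y).symm⟩
  classical
  have hdiv {n : ℕ} {f : (ResIndex J (n + 1) → R) →ₗ[R] K} (hf : f ∘ₗ resDiff c β (n + 1) = 0)
      (w : Word J n) : ∃ q ∈ V, ∀ i, (f (Pi.single (node w i) 1) : Q) = a * v i * q := by
    rw [comp_resDiff_succ_eq_zero_iff ha hc hβ hv] at hf
    obtain ⟨q, hq⟩ : ∃ q, (f (Pi.single (node w none) 1) : Q) = a * q :=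
      ⟨ha.unit⁻¹ * f (Pi.single (node w none) 1), by simp [← mul_assoc]⟩
    have hi : ∀ i, (f (Pi.single (node w i) 1) : Q) = a * v i * q := by
      rintro (_ | j)
      · rw [hq, hv, mul_one]
      · rw [hf, hq]
        ring
    exact ⟨q, (hcolon q).2 fun i => hi i ▸ Subtype.prop _, hi⟩
  refine ⟨inferInstance, ?_, ?_⟩
  · rintro (_ | _ | n) hn
    · refine subsingleton_extMod_zero (X := fun n => ResIndex J n → R) (resDiff c β) hexact ε hε hdε
        fun f hf => ?_
      refine LinearMap.pi_ext' fun p => LinearMap.ext_ring ?_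
      rcases p
      have := congrArg Subtype.val (LinearMap.congr_fun hf (Pi.single (node nil none) 1))
      rw [LinearMap.comp_apply, resDiff_zero_single, map_smul, Submodule.coe_smul,
        Algebra.smul_def, hc, hv, mul_one] at this
      exact Subtype.ext (ha.mul_right_eq_zero.1 this)
    · exact absurd rfl hn
    · refine subsingleton_extMod_succ (X := fun n => ResIndex J n → R) (resDiff c β) hexact ε hε
        hdε (n + 1) fun f hf => ?_
      choose q hq hfq using hdiv hf
      choose h hh hsol using fun w : Word J n => hsolve (fun j => q (snoc w j)) fun j => hq _
      let g₀ : ResIndex J (n + 1) → K := fun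
        | node w none => ⟨h w, hh w⟩
        | node w (some j) => ⟨_, hsol w j⟩
      let g : (ResIndex J (n + 1) → R) →ₗ[R] K := (Pi.basisFun R _).constr R g₀
      have hg (p) : g (Pi.single p 1) = g₀ p := by
        rw [← Pi.basisFun_apply, Module.Basis.constr_basis]
      refine ⟨g, LinearMap.pi_ext' fun p => LinearMap.ext_ring (Subtype.ext ?_)⟩
      rcases p with _ | ⟨_ | ⟨w, j⟩, i⟩
      change (g (resDiff c β (n + 1) (Pi.single (node (snoc w j) i) 1)) : Q) =
        f (Pi.single (node (snoc w j) i) 1)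
      rw [resDiff_succ_single, map_sub, map_smul, map_smul, hg, hg, hfq, Submodule.coe_sub,
        Submodule.coe_smul, Submodule.coe_smul, Algebra.smul_def, Algebra.smul_def, hc, hβ]
      change a * v i * (v (some j) * h w + q (snoc w j)) - _ * h w = _
      ring
  · have hdiv' (f : LinearMap.ker (LinearMap.lcomp R K (resDiff c β 1))) :
        ∃ q ∈ V, ∀ i, (f.1 (Pi.single (node nil i) 1) : Q) = a * v i * q :=
      hdiv (n := 0) f.2 nil
    choose q hq hfq using hdiv'
    have hqu {f q'} (h : (f.1 (Pi.single (node nil none) 1) : Q) = a * q') : q f = q' := by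
      rw [hfq, hv, mul_one] at h
      exact ha.mul_left_cancel h
    let L : LinearMap.ker (LinearMap.lcomp R K (resDiff c β 1)) →ₗ[R] R ⧸ m :=
      φ ∘ₗ
      { toFun f := ⟨q f, hq f⟩
        map_add' f g := Subtype.ext <| hqu <| by
          change ((f.1 _ + g.1 _ : K) : Q) = a * (q f + q g)
          rw [Submodule.coe_add, hfq, hfq, hv]
          ring
        map_smul' r f := Subtype.ext <| hqu <| by
          change ((r • f.1 _ : K) : Q) = a * (r • q f)
          rw [Submodule.coe_smul, hfq, hv, mul_smul_comm, mul_one] }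
    have hL (f) : L f = 0 ↔ q f ∈ K := (hKmem ⟨q f, hq f⟩).symm
    refine nonempty_extMod_one_iso (X := fun n => ResIndex J n → R) (resDiff c β) hexact ε hε
      hdε L ?_ fun f => ?_
    · intro y
      obtain ⟨x, rfl⟩ := hφ y
      let g : (ResIndex J 1 → R) →ₗ[R] K :=
        (Pi.basisFun R _).constr R fun | node _ i => ⟨_, (hcolon x).1 x.2 i⟩
      have hg (w i) : (g (Pi.single (node w i) 1) : Q) = a * v i * x := by
        rw [← Pi.basisFun_apply, Module.Basis.constr_basis]
        rfl
      refine ⟨⟨g, (comp_resDiff_succ_eq_zero_iff ha hc hβ hv 0 g).2 fun w j => ?_⟩, ?_⟩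
      · rw [hg, hg, hv]
        ring
      · refine congrArg φ (Subtype.ext (hqu ?_))
        rw [hg, hv, mul_one]
    · rw [hL]
      constructor
      · intro h
        let g : (ResIndex J 0 → R) →ₗ[R] K := (Pi.basisFun R _).constr R fun _ => ⟨_, h⟩
        have hg : (g (Pi.single root 1) : Q) = q f := by
          rw [← Pi.basisFun_apply, Module.Basis.constr_basis]
        refine ⟨g, LinearMap.pi_ext' fun p => LinearMap.ext_ring (Subtype.ext ?_)⟩
        rcases p with _ | ⟨⟨⟩, i⟩
        change (g (resDiff c β 0 (Pi.single (node nil i) 1)) : Q) = f.1 (Pi.single (node nil i) 1)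
        rw [resDiff_zero_single, map_smul, Submodule.coe_smul, hg, hfq, Algebra.smul_def, hc]
      · rintro ⟨g, hg⟩
        have : q f = g (Pi.single root 1) := hqu <| by
          rw [← hg, LinearMap.comp_apply, resDiff_zero_single, map_smul, Submodule.coe_smul,
            Algebra.smul_def, hc, hv, mul_one]
        exact this ▸ Subtype.prop _

end Resolution

section SemilocalPrincipal

universe w w'

open nonZeroDivisors

/-- Multiplication by `x` preserving a finitely generated submodule that contains a unit forces `x`
to be integral. -/
lemma isIntegral_of_mul_mem {R A : Type*} [CommRing R] [CommRing A] [Algebra R A]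
    {N : Submodule R A} (hN : N.FG) {u : A} (huN : u ∈ N) (hu : IsUnit u) {x : A}
    (hx : ∀ n ∈ N, x * n ∈ N) : IsIntegral R x := by
  have : Module.Finite R N := Module.Finite.iff_fg.2 hN
  let g : Module.End R N := (LinearMap.mulLeft R x).restrict hx
  obtain ⟨p, hp, hpg⟩ := Module.End.isIntegral.isIntegral (R := R) g
  refine ⟨p, hp, ?_⟩
  have key (p : Polynomial R) (n : N) :
      (Polynomial.aeval g p n : A) = Polynomial.aeval x p * n := by
    induction p using Polynomial.induction_on' with
    | add p q hp hq => simp [hp, hq, add_mul]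
    | monomial k r =>
      have hk (k : ℕ) : ((g ^ k) n : A) = x ^ k * n := by
        induction k with
        | zero => simp
        | succ k ih =>
          rw [pow_succ', Module.End.mul_apply, pow_succ', mul_assoc, ← ih]
          rfl
      simp [Polynomial.aeval_monomial, hk, Algebra.smul_def, mul_assoc]
  have h := key p ⟨u, huN⟩
  rw [Polynomial.aeval_def, hpg] at h
  exact hu.mul_left_eq_zero.1 h.symm

variable {V : Type w} [CommRing V] [IsNoetherianRing V] {Q : Type w'} [CommRing Q] [Algebra V Q]
  [IsFractionRing V Q]

/-- In a ring whose regular primes are maximal, every regular maximal ideal has a nontrivial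
inverse. -/
lemma exists_notMem_range_mul_mem_range
    (hmax : ∀ p : Ideal V, p.IsPrime → (∃ b ∈ p, b ∈ V⁰) → p.IsMaximal) {n : Ideal V}
    [hn : n.IsMaximal] (hb : ∃ b ∈ n, b ∈ V⁰) :
    ∃ q : Q, q ∉ Set.range (algebraMap V Q) ∧
      ∀ x ∈ n, q * algebraMap V Q x ∈ Set.range (algebraMap V Q) := by
  obtain ⟨b, hbn, hb⟩ := hb
  have hmin : n ∈ (Module.annihilator V (V ⧸ Ideal.span {b})).minimalPrimes := by
    rw [Ideal.annihilator_quotient]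
    refine ⟨⟨hn.isPrime, (Ideal.span_singleton_le_iff_mem _).2 hbn⟩, fun p hp hpn => ?_⟩
    exact ((hmax p hp.1 ⟨b, hp.2 (Ideal.mem_span_singleton_self b), hb⟩).eq_of_le hn.ne_top hpn).ge
  have has := Module.associatedPrimes.minimalPrimes_annihilator_subset_associatedPrimes V _ hmin
  obtain ⟨-, y, hy⟩ := isAssociatedPrime_iff.1 (AssociatedPrimes.mem_iff.1 has)
  obtain ⟨c, rfl⟩ := Ideal.Quotient.mk_surjective y
  have hmem (x : V) : x ∈ n ↔ b ∣ x * c := by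
    rw [hy, Submodule.mem_colon_singleton, Submodule.mem_bot, ← Ideal.mem_span_singleton,
      ← Ideal.Quotient.eq_zero_iff_mem, map_mul]
    rfl
  refine ⟨IsLocalization.mk' Q c ⟨b, hb⟩, ?_, fun x hx => ?_⟩
  · rintro ⟨z, hz⟩
    refine hn.ne_top ((Ideal.eq_top_iff_one n).2 ((hmem 1).2 ⟨z, ?_⟩))
    rw [eq_comm, IsLocalization.mk'_eq_iff_eq_mul, ← map_mul] at hz
    rw [one_mul, IsFractionRing.injective V Q hz, mul_comm]
  · obtain ⟨z, hz⟩ := (hmem x).1 hx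
    refine ⟨z, ?_⟩
    rw [mul_comm, IsLocalization.mul_mk'_eq_mk'_of_mul, eq_comm, IsLocalization.mk'_eq_iff_eq_mul,
      ← map_mul, hz, mul_comm]

/-- In an integrally closed Noetherian ring whose regular primes are maximal, regular ideals are
invertible. -/
lemma exists_mul_eq_one_of_regular
    (hmax : ∀ p : Ideal V, p.IsPrime → (∃ b ∈ p, b ∈ V⁰) → p.IsMaximal)
    (hint : ∀ x : Q, IsIntegral V x → x ∈ Set.range (algebraMap V Q)) (I : Ideal V)
    (hb : ∃ b ∈ I, b ∈ V⁰) : ∃ J : FractionalIdeal V⁰ Q, (I : FractionalIdeal V⁰ Q) * J = 1 := by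
  induction I using IsNoetherian.induction with | _ I ih
  obtain ⟨b, hbI, hb⟩ := hb
  by_cases hI : I = ⊤
  · exact ⟨1, by simp [hI]⟩
  obtain ⟨n, hn, hIn⟩ := Ideal.exists_le_maximal I hI
  obtain ⟨q, hq, hqn⟩ := exists_notMem_range_mul_mem_range (Q := Q) hmax ⟨b, hIn hbI, hb⟩
  have hle : (I : FractionalIdeal V⁰ Q) * (1 + FractionalIdeal.spanSingleton V⁰ q) ≤ 1 := by
    rw [mul_add, mul_one, ← FractionalIdeal.sup_eq_add, sup_le_iff]
    refine ⟨FractionalIdeal.coeIdeal_le_one, FractionalIdeal.mul_le.2 ?_⟩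
    intro x hx y hy
    obtain ⟨x, hxI, rfl⟩ := (FractionalIdeal.mem_coeIdeal _).1 hx
    obtain ⟨z, rfl⟩ := (FractionalIdeal.mem_spanSingleton _).1 hy
    obtain ⟨t, ht⟩ := hqn x (hIn hxI)
    rw [Algebra.smul_def, mul_left_comm, mul_comm _ q, ← ht, ← map_mul]
    exact (FractionalIdeal.mem_one_iff _).2 ⟨_, rfl⟩
  obtain ⟨I', hI'⟩ := FractionalIdeal.le_one_iff_exists_coeIdeal.1 hle
  rw [mul_add, mul_one, ← FractionalIdeal.sup_eq_add] at hI'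
  have hle₁ : (I : FractionalIdeal V⁰ Q) ≤ I' := hI' ▸ le_sup_left
  have hle₂ : (I : FractionalIdeal V⁰ Q) * FractionalIdeal.spanSingleton V⁰ q ≤ I' :=
    hI' ▸ le_sup_right
  have hII' : I ≤ I' := (FractionalIdeal.coeIdeal_le_coeIdeal Q).1 hle₁
  have hne : I ≠ I' := by
    rintro rfl
    refine hq (hint q (isIntegral_of_mul_mem (N := ((I : FractionalIdeal V⁰ Q) : Submodule V Q))
      ?_ (FractionalIdeal.mem_coeIdeal_of_mem _ hbI) (IsLocalization.map_units Q ⟨b, hb⟩) ?_))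
    · exact (FractionalIdeal.coeIdeal_fg _ (IsFractionRing.injective V Q) I).2
          (IsNoetherian.noetherian I)
    · intro x hx
      rw [mul_comm]
      exact hle₂ (FractionalIdeal.mul_mem_mul hx (FractionalIdeal.mem_spanSingleton_self _ q))
  obtain ⟨J, hJ⟩ := ih I' (lt_of_le_of_ne hII' hne) ⟨b, hII' hbI, hb⟩
  refine ⟨(1 + FractionalIdeal.spanSingleton V⁰ q) * J, ?_⟩
  rw [← mul_assoc, mul_add, mul_one, ← FractionalIdeal.sup_eq_add, ← hI', hJ]

/-- In a semilocal integrally closed Noetherian ring whose regular primes are maximal, every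
regular finitely generated submodule of the total ring of fractions is free of rank one. -/
lemma exists_isUnit_span_singleton_eq
    (hmax : ∀ p : Ideal V, p.IsPrime → (∃ b ∈ p, b ∈ V⁰) → p.IsMaximal)
    (hint : ∀ x : Q, IsIntegral V x → x ∈ Set.range (algebraMap V Q))
    (hfin : {p : Ideal V | p.IsMaximal}.Finite) (N : Submodule V Q) (hN : N.FG)
    (hu : ∃ u ∈ N, IsUnit u) : ∃ b, IsUnit b ∧ N = Submodule.span V {b} := by
  obtain ⟨u, huN, hu⟩ := hu
  obtain ⟨s, hs, hsN⟩ := FractionalIdeal.isFractional_of_fg (S := V⁰) hN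
  have hsu : IsUnit (algebraMap V Q s) := IsLocalization.map_units Q ⟨s, hs⟩
  let I : Ideal V := (N.map (LinearMap.mulLeft V (algebraMap V Q s))).comap (Algebra.linearMap V Q)
  have hI (x : V) : x ∈ I ↔ ∃ y ∈ N, algebraMap V Q s * y = algebraMap V Q x := Iff.rfl
  obtain ⟨t, ht⟩ := hsN u huN
  rw [Algebra.smul_def] at ht
  have htI : t ∈ I := (hI t).2 ⟨u, huN, ht.symm⟩
  have ht' : t ∈ V⁰ := mem_nonZeroDivisors_of_injective (IsFractionRing.injective V Q)
    (ht ▸ hsu.mul hu).mem_nonZeroDivisors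
  obtain ⟨J, hJ⟩ := exists_mul_eq_one_of_regular (Q := Q) hmax hint I ⟨t, htI, ht'⟩
  obtain ⟨⟨c, hc⟩⟩ := FractionalIdeal.isPrincipal.of_finite_maximals_of_inv le_rfl hfin _ _ hJ
  have hmem (x : Q) : x ∈ Submodule.span V {c} ↔ ∃ y ∈ N, algebraMap V Q s * y = x := by
    rw [← hc, FractionalIdeal.mem_coe, FractionalIdeal.mem_coeIdeal]
    constructor
    · rintro ⟨x, hx, rfl⟩
      exact (hI x).1 hx
    · rintro ⟨y, hy, rfl⟩
      obtain ⟨x, hx⟩ := hsN y hy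
      rw [Algebra.smul_def] at hx
      exact ⟨x, (hI x).2 ⟨y, hy, hx.symm⟩, hx⟩
  obtain ⟨b, hbN, hb⟩ := (hmem c).1 (Submodule.mem_span_singleton_self c)
  have hN' : N = Submodule.span V {b} := by
    refine le_antisymm (fun x hx => ?_) ((Submodule.span_singleton_le_iff_mem _ _).2 hbN)
    obtain ⟨r, hr⟩ := Submodule.mem_span_singleton.1 ((hmem _).2 ⟨x, hx, rfl⟩)
    refine Submodule.mem_span_singleton.2 ⟨r, hsu.mul_left_cancel ?_⟩
    rw [mul_smul_comm, hb, hr]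
  refine ⟨b, ?_, hN'⟩
  rw [hN'] at huN
  obtain ⟨r, hr⟩ := Submodule.mem_span_singleton.1 huN
  rw [Algebra.smul_def] at hr
  exact isUnit_of_mul_isUnit_right (hr ▸ hu)

end SemilocalPrincipal

section IntegralClosure

open nonZeroDivisors IsLocalRing

variable {R : Type*} [CommRing R] {Q : Type*} [CommRing Q] [Algebra R Q]

lemma algebraMap_mem_of_isMaximal [IsLocalRing R] (p : Ideal (integralClosure R Q))
    [hp : p.IsMaximal] {r : R}
    (hr : r ∈ maximalIdeal R) : algebraMap R (integralClosure R Q) r ∈ p := by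
  have := eq_maximalIdeal (Ideal.isMaximal_comap_of_isIntegral_of_isMaximal (R := R) p)
  rw [← this] at hr
  exact hr

variable [IsFractionRing R Q]

instance integralClosure.isFractionRing : IsFractionRing (integralClosure R Q) Q where
  map_units := by
    rintro ⟨y, hy⟩
    obtain ⟨⟨r, s⟩, hrs⟩ := IsLocalization.surj R⁰ (y : Q)
    have hs : IsUnit (algebraMap R Q s) := IsLocalization.map_units Q s
    refine isUnit_of_mul_isUnit_left (hrs ▸ IsLocalization.map_units Q (⟨r, ?_⟩ : R⁰) :
      IsUnit ((y : Q) * algebraMap R Q s))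
    refine mem_nonZeroDivisors_iff_right.2 fun t ht => ?_
    have hty : (algebraMap R Q t) * y = 0 := hs.mul_left_eq_zero.1 <| by
      rw [mul_assoc, hrs, ← map_mul, ht, map_zero]
    have h0 : algebraMap R (integralClosure R Q) t = 0 :=
      mem_nonZeroDivisors_iff_right.1 hy _ (Subtype.ext hty)
    exact (IsFractionRing.injective R Q) ((congrArg Subtype.val h0).trans (map_zero _).symm)
  surj z := by
    obtain ⟨⟨r, s⟩, h⟩ := IsLocalization.surj R⁰ z
    refine ⟨⟨algebraMap R _ r, algebraMap R _ s, ?_⟩, h⟩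
    exact mem_nonZeroDivisors_of_injective (f := (integralClosure R Q).subtype)
      Subtype.val_injective (IsLocalization.map_units Q s).mem_nonZeroDivisors
  exists_of_eq h := ⟨1, by rw [Subtype.val_injective h]⟩

/-- A regular element of the integral closure divides a regular element of the base ring. -/
lemma exists_mul_eq_algebraMap_of_isUnit {y : Q} (hy : IsUnit y) :
    ∃ r s : R, s ∈ R⁰ ∧ y * algebraMap R Q r = algebraMap R Q s := by
  obtain ⟨u, hu⟩ := hy.exists_right_inv
  obtain ⟨⟨r, s⟩, h⟩ := IsLocalization.surj R⁰ u
  exact ⟨r, s, s.2, by rw [← h, ← mul_assoc, hu, one_mul]⟩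

lemma isMaximal_of_regular [Ring.KrullDimLE 1 R] (p : Ideal (integralClosure R Q)) (hp : p.IsPrime)
    (hb : ∃ b ∈ p, b ∈ (integralClosure R Q)⁰) : p.IsMaximal := by
  obtain ⟨b, hbp, hb⟩ := hb
  obtain ⟨r, s, hs, hrs⟩ := exists_mul_eq_algebraMap_of_isUnit (R := R)
    (IsLocalization.map_units Q ⟨b, hb⟩)
  have hsp : s ∈ p.comap (algebraMap R _) := by
    have : b * algebraMap R _ r = algebraMap R _ s := Subtype.ext hrs
    rw [Ideal.mem_comap, ← this]
    exact p.mul_mem_right _ hbp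
  have := Ideal.IsPrime.under R p
  rcases Ring.krullDimLE_one_iff.1 ‹_› (p.comap (algebraMap R _)) inferInstance with h | h
  · exact absurd hs
      (Set.disjoint_left.1 (Ideal.disjoint_nonZeroDivisors_of_mem_minimalPrimes h) hsp)
  · exact Ideal.isMaximal_of_isIntegral_of_isMaximal_comap p h

variable [IsLocalRing R]

variable [Module.Finite R (integralClosure R Q)] [IsNoetherianRing R]

lemma finite_setOf_isMaximal_integralClosure [Ring.KrullDimLE 1 R]
    (hreg : ∃ x ∈ maximalIdeal R, x ∈ R⁰) :
    {p : Ideal (integralClosure R Q) | p.IsMaximal}.Finite := by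
  obtain ⟨x, hx, hxR⟩ := hreg
  have := isNoetherian_of_isNoetherianRing_of_finite R (integralClosure R Q)
  have : IsNoetherianRing (integralClosure R Q) := isNoetherian_of_tower R this
  refine (Ideal.finite_minimalPrimes_of_isNoetherianRing _
    (Ideal.span {algebraMap R (integralClosure R Q) x})).subset fun p (hp : p.IsMaximal) => ?_
  refine ⟨⟨hp.isPrime, (Ideal.span_singleton_le_iff_mem _).2 (algebraMap_mem_of_isMaximal p hx)⟩,
    fun q hq hqp => ?_⟩
  have := isMaximal_of_regular q hq.1 ⟨_, hq.2 (Ideal.mem_span_singleton_self _),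
    mem_nonZeroDivisors_of_injective (f := (integralClosure R Q).subtype)
      Subtype.val_injective (IsLocalization.map_units Q ⟨x, hxR⟩).mem_nonZeroDivisors⟩
  exact (this.eq_of_le hp.ne_top hqp).ge

/-- Regular finitely generated submodules of `Q(R)` stable under the integral closure `R̄` are
of the form `b R̄`. -/
lemma exists_isUnit_mem_iff_of_mul_mem [Ring.KrullDimLE 1 R]
    (hreg : ∃ x ∈ maximalIdeal R, x ∈ R⁰) (N : Submodule R Q) (hN : N.FG) (hu : ∃ u ∈ N, IsUnit u)
    (hV : ∀ v ∈ integralClosure R Q, ∀ x ∈ N, v * x ∈ N) :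
    ∃ b, IsUnit b ∧ ∀ x, x ∈ N ↔ ∃ v ∈ integralClosure R Q, b * v = x := by
  have := isNoetherian_of_isNoetherianRing_of_finite R (integralClosure R Q)
  have : IsNoetherianRing (integralClosure R Q) := isNoetherian_of_tower R this
  let N' : Submodule (integralClosure R Q) Q :=
    { carrier := N
      add_mem' := N.add_mem
      zero_mem' := N.zero_mem
      smul_mem' v x hx := hV v v.2 x hx }
  have hN' : N'.FG := by
    obtain ⟨s, hs⟩ := hN
    refine ⟨s, le_antisymm (Submodule.span_le.2 fun x hx => ?_) fun x hx => ?_⟩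
    · exact (hs ▸ Submodule.subset_span hx : x ∈ N)
    · have hx : x ∈ Submodule.span R (s : Set Q) := hs ▸ hx
      exact Submodule.span_subset_span R _ _ hx
  have hint (x : Q) (hx : IsIntegral (integralClosure R Q) x) :
      x ∈ Set.range (algebraMap (integralClosure R Q) Q) := ⟨⟨x, isIntegral_trans x hx⟩, rfl⟩
  obtain ⟨b, hb, h⟩ := exists_isUnit_span_singleton_eq (V := integralClosure R Q) (Q := Q)
    (fun p hp hb => isMaximal_of_regular p hp hb) hint
    (finite_setOf_isMaximal_integralClosure hreg) N' hN' hu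
  have hb' (x : Q) : x ∈ N ↔ ∃ v : integralClosure R Q, v • b = x := by
    rw [← Submodule.mem_span_singleton, ← h]
    rfl
  refine ⟨b, hb, fun x => (hb' x).trans ⟨?_, ?_⟩⟩
  · rintro ⟨v, rfl⟩
    exact ⟨v, v.2, mul_comm _ _⟩
  · rintro ⟨v, hv, rfl⟩
    exact ⟨⟨v, hv⟩, mul_comm _ _⟩

end IntegralClosure

section Functional

open IsLocalRing

variable {R : Type*} [CommRing R] [IsLocalRing R]

/-- A finite module over a local ring maps onto a finite power of the residue field, with kernel
`m M`. -/
lemma exists_surjective_ker_eq_smul_top (M : Type*) [AddCommGroup M] [Module R M]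
    [Module.Finite R M] : ∃ (n : ℕ) (f : M →ₗ[R] Fin n → R ⧸ maximalIdeal R),
      Function.Surjective f ∧ LinearMap.ker f = maximalIdeal R • ⊤ := by
  let _ := Ideal.Quotient.field (maximalIdeal R)
  have : Module.Finite (R ⧸ maximalIdeal R) (M ⧸ (maximalIdeal R • ⊤ : Submodule R M)) :=
    Module.Finite.of_restrictScalars_finite R _ _
  let b := Module.finBasis (R ⧸ maximalIdeal R) (M ⧸ (maximalIdeal R • ⊤ : Submodule R M))
  refine ⟨_, (b.equivFun.toLinearMap.restrictScalars R) ∘ₗ Submodule.mkQ _, ?_, ?_⟩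
  · exact b.equivFun.surjective.comp (Submodule.mkQ_surjective _)
  · rw [LinearMap.ker_comp_of_ker_eq_bot, Submodule.ker_mkQ]
    exact LinearMap.ker_eq_bot.2 b.equivFun.injective

variable {V : Type*} [CommRing V] [Algebra R V]

/-- An element outside `m V` is detected by some `R`-linear functional with values in `R/m`. -/
lemma exists_functional_eq_one [Module.Finite R V] {s : V}
    (hs : s ∉ (maximalIdeal R).map (algebraMap R V)) : ∃ f : V →ₗ[R] R ⧸ maximalIdeal R,
      f s = 1 := by
  obtain ⟨n, f, -, hf⟩ := exists_surjective_ker_eq_smul_top (R := R) V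
  have hfs : f s ≠ 0 := fun h => hs <| by
    rw [← LinearMap.mem_ker, hf, Ideal.smul_top_eq_map] at h
    exact h
  obtain ⟨i, hi⟩ := Function.ne_iff.1 hfs
  let _ := Ideal.Quotient.field (maximalIdeal R)
  obtain ⟨c, hc⟩ := Ideal.Quotient.mk_surjective (f s i)⁻¹
  refine ⟨c • (LinearMap.proj i ∘ₗ f), ?_⟩
  rw [LinearMap.smul_apply, Algebra.smul_def]
  change Ideal.Quotient.mk _ c * f s i = 1
  rw [hc]
  exact inv_mul_cancel₀ hi

lemma map_eq_zero_of_mem_map_maximalIdeal (f : V →ₗ[R] R ⧸ maximalIdeal R) {x : V}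
    (hx : x ∈ (maximalIdeal R).map (algebraMap R V)) : f x = 0 := by
  have hx : x ∈ (maximalIdeal R • ⊤ : Submodule R V) := by
    rw [Ideal.smul_top_eq_map]
    exact hx
  refine Submodule.smul_induction_on hx (fun r hr n _ => ?_) fun x y hx hy => ?_
  · rw [map_smul, Algebra.smul_def]
    exact (congrArg (· * _) (Ideal.Quotient.eq_zero_iff_mem.2 hr)).trans (zero_mul _)
  · rw [map_add, hx, hy, add_zero]

/-- A nondegenerate functional on `V / m V` exists as soon as each maximal ideal has a principal
socle. -/
theorem exists_nondegenerate_functional [Module.Finite R V] [IsNoetherianRing V]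
    (hfin : {p : Ideal V | p.IsMaximal}.Finite)
    (hmax : ∀ p : Ideal V, p.IsPrime → (maximalIdeal R).map (algebraMap R V) ≤ p → p.IsMaximal)
    (hsoc : ∀ p : Ideal V, p.IsMaximal → ∃ s,
      (∀ y, y ∈ p ↔ s * y ∈ (maximalIdeal R).map (algebraMap R V)) ∧
      ∀ y, (∀ x ∈ p, y * x ∈ (maximalIdeal R).map (algebraMap R V)) → s ∣ y) :
    ∃ φ : V →ₗ[R] R ⧸ maximalIdeal R,
      ∀ x, (∀ v, φ (x * v) = 0) → x ∈ (maximalIdeal R).map (algebraMap R V) := by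
  set A := (maximalIdeal R).map (algebraMap R V) with hA
  have := hfin.fintype
  choose s hs hs' using fun p : {p : Ideal V | p.IsMaximal} => hsoc p p.2
  have hsA (p) : s p ∉ A := fun h =>
    p.2.ne_top ((Ideal.eq_top_iff_one _).2 ((hs p 1).2 (by rwa [mul_one])))
  choose f hf using fun p => exists_functional_eq_one (hsA p)
  have hcrt (p : {p : Ideal V | p.IsMaximal}) : ∃ e : V, e - 1 ∈ p.1 ∧ ∀ q ≠ p, e ∈ q.1 := by
    classical
    have hco : Pairwise (Function.onFun IsCoprime fun q : {p : Ideal V | p.IsMaximal} => q.1) :=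
      fun q q' h => by
        have : q.1.IsMaximal := q.2
        have : q'.1.IsMaximal := q'.2
        exact Ideal.isCoprime_of_isMaximal fun h' => h (Subtype.ext h')
    obtain ⟨e, he⟩ := Ideal.exists_forall_sub_mem_ideal hco (Pi.single p 1)
    refine ⟨e, by simpa using he p, fun q hq => by simpa [hq] using he q⟩
  choose e he he' using hcrt
  let φ : V →ₗ[R] R ⧸ maximalIdeal R := ∑ p, f p ∘ₗ LinearMap.mulLeft R (e p)
  have hφ (p) : φ (s p) = 1 := by
    rw [LinearMap.sum_apply, Finset.sum_eq_single p]
    · rw [← hf p, LinearMap.comp_apply, LinearMap.mulLeft_apply, ← sub_eq_zero, ← map_sub]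
      refine map_eq_zero_of_mem_map_maximalIdeal _ ?_
      rw [show e p * s p - s p = s p * (e p - 1) by ring]
      exact (hs p _).1 (he p)
    · intro q _ hq
      rw [LinearMap.comp_apply, LinearMap.mulLeft_apply, mul_comm]
      refine map_eq_zero_of_mem_map_maximalIdeal _ ?_
      exact (hs p _).1 (he' q p hq.symm)
    · simp
  refine ⟨φ, fun x hx => by_contra fun hxA => ?_⟩
  have : Nontrivial (V ⧸ Submodule.colon A {x}) := by
    refine Ideal.Quotient.nontrivial_iff.2 fun h => hxA ?_
    simpa using Submodule.mem_colon_singleton.1 ((Ideal.eq_top_iff_one _).1 h)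
  obtain ⟨P, hP⟩ := associatedPrimes.nonempty V (V ⧸ Submodule.colon A {x})
  obtain ⟨hPp, y, hy⟩ := isAssociatedPrime_iff.1 (AssociatedPrimes.mem_iff.1 hP)
  obtain ⟨c, rfl⟩ := Ideal.Quotient.mk_surjective y
  have hmem (z : V) : z ∈ P ↔ z * (c * x) ∈ A := by
    rw [hy, Submodule.mem_colon_singleton, Submodule.mem_bot, ← mul_assoc, ← smul_eq_mul (z * c) x,
      ← Submodule.mem_colon_singleton, ← Ideal.Quotient.eq_zero_iff_mem, map_mul]
    rfl
  have hPm : P.IsMaximal := hmax P hPp fun z hz => (hmem z).2 (A.mul_mem_right _ hz)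
  obtain ⟨u, hu⟩ := hs' ⟨P, hPm⟩ (c * x) fun z hz => mul_comm z _ ▸ (hmem z).1 hz
  have huP : u ∉ P := fun h => hPp.ne_top <| (Ideal.eq_top_iff_one _).2 <| (hmem 1).2 <| by
    rw [one_mul, hu]
    exact (hs ⟨P, hPm⟩ u).1 h
  obtain ⟨u', i, hi, hu'⟩ := hPm.exists_inv huP
  have h1 : φ (s ⟨P, hPm⟩ * (1 - u' * u)) = 0 :=
    map_eq_zero_of_mem_map_maximalIdeal _ ((hs ⟨P, hPm⟩ _).1 ((sub_eq_of_eq_add' hu'.symm) ▸ hi))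
  have h2 : s ⟨P, hPm⟩ * (1 - u' * u) = s ⟨P, hPm⟩ - x * (c * u') := by
    linear_combination u' * hu
  rw [h2, map_sub, hx, sub_zero, hφ] at h1
  let _ := Ideal.Quotient.field (maximalIdeal R)
  exact one_ne_zero h1

end Functional

section Length

open IsLocalRing

variable {R : Type*} [CommRing R] {M N P : Type*} [AddCommGroup M] [Module R M] [AddCommGroup N]
  [Module R N] [AddCommGroup P] [Module R P]

lemma Module.length_le_add_of_exact {j : N →ₗ[R] M} {g : M →ₗ[R] P} (h : Function.Exact j g) :
    Module.length R M ≤ Module.length R N + Module.length R P := by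
  rw [Module.length_eq_add_of_exact (LinearMap.ker g).subtype g.rangeRestrict
    (Submodule.injective_subtype _) g.surjective_rangeRestrict
    (fun x => by simp [LinearMap.rangeRestrict, Subtype.ext_iff])]
  refine add_le_add ?_ (Module.length_le_of_injective _ (Submodule.injective_subtype _))
  rw [h.linearMap_ker_eq]
  exact Module.length_le_of_surjective _ j.surjective_rangeRestrict

lemma LinearMap.surjective_of_length_le {j : N →ₗ[R] M} (hj : Function.Injective j)
    (h : Module.length R M ≤ Module.length R N) (hM : Module.length R M ≠ ⊤) :
    Function.Surjective j := by
  have hadd := Module.length_eq_add_of_exact j (LinearMap.range j).mkQ hj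
    (Submodule.mkQ_surjective _) (LinearMap.exact_map_mkQ_range j)
  have hN : Module.length R N ≠ ⊤ := ne_top_of_le_ne_top hM (hadd ▸ le_self_add)
  have h0 : Module.length R (M ⧸ LinearMap.range j) = 0 := by
    rw [hadd] at h
    simpa using (ENat.add_le_add_iff_left hN).1 (h.trans (add_zero _).ge)
  rw [Module.length_eq_zero_iff, Submodule.Quotient.subsingleton_iff] at h0
  exact LinearMap.range_eq_top.1 h0

variable [IsLocalRing R]

lemma Module.length_pi_residue (ι : Type*) [Fintype ι] :
    Module.length R (ι → R ⧸ maximalIdeal R) = Fintype.card ι := by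
  have : IsSimpleModule R (R ⧸ maximalIdeal R) :=
    isSimpleModule_iff_isCoatom.2 (Ideal.isMaximal_def.1 inferInstance)
  rw [Module.length_pi_of_fintype]
  simp [Module.length_eq_one]

lemma exists_smul_eq_of_surjective_of_le_one [Module.Finite R M] {n : ℕ}
    {f : M →ₗ[R] Fin n → R ⧸ maximalIdeal R} (hf : Function.Surjective f)
    (hker : LinearMap.ker f = maximalIdeal R • ⊤) (hn : n ≤ 1) :
    ∃ y : M, ∀ x, ∃ r : R, r • y = x := by
  obtain ⟨y, hy⟩ := hf 1
  refine ⟨y, fun x => Submodule.mem_span_singleton.1 ?_⟩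
  have hle : (⊤ : Submodule R M) ≤ Submodule.span R {y} := by
    refine Submodule.le_of_le_smul_of_le_jacobson_bot Module.Finite.fg_top
      (maximalIdeal_le_jacobson ⊥) fun x _ => ?_
    have : Subsingleton (Fin n) := Fin.subsingleton_iff_le_one.2 hn
    obtain ⟨r, hr⟩ : ∃ r : R, f (x - r • y) = 0 := by
      rcases isEmpty_or_nonempty (Fin n) with h | ⟨⟨i⟩⟩
      · exact ⟨0, Subsingleton.elim _ _⟩
      · obtain ⟨r, hr⟩ := Ideal.Quotient.mk_surjective (f x i)
        refine ⟨r, funext fun k => ?_⟩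
        rw [Subsingleton.elim k i, map_sub, map_smul, hy, Pi.sub_apply, ← hr, Pi.smul_apply,
          Pi.one_apply, Algebra.smul_def, mul_one]
        exact sub_self _
    rw [← LinearMap.mem_ker, hker] at hr
    rw [← add_sub_cancel (r • y) x]
    exact add_mem (Submodule.mem_sup_left
      (Submodule.smul_mem _ _ (Submodule.mem_span_singleton_self y))) (Submodule.mem_sup_right hr)
  exact hle trivial

end Length

section Translate

open IsLocalRing

variable {R : Type*} [CommRing R] [IsLocalRing R] {V : Type*} [CommRing V] [Algebra R V]

/-- Every functional with values in `R/m` is a translate of a nondegenerate one. -/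
theorem exists_eq_translate_of_nondegenerate [Module.Finite R V] {φ : V →ₗ[R] R ⧸ maximalIdeal R}
    (hφ : ∀ x, (∀ v, φ (x * v) = 0) → x ∈ (maximalIdeal R).map (algebraMap R V))
    (ψ : V →ₗ[R] R ⧸ maximalIdeal R) : ∃ w, ∀ v, ψ v = φ (w * v) := by
  obtain ⟨n, f, hf, hker⟩ := exists_surjective_ker_eq_smul_top (R := R) V
  have hmem (x : V) : f x = 0 ↔ x ∈ (maximalIdeal R).map (algebraMap R V) := by
    rw [← LinearMap.mem_ker, hker, Ideal.smul_top_eq_map]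
    rfl
  let _ := Ideal.Quotient.field (maximalIdeal R)
  choose y hy using fun j => hf (Pi.single j 1)
  have hsmul (r : R) (x : R ⧸ maximalIdeal R) : r • x = Ideal.Quotient.mk _ r * x :=
    Algebra.smul_def r x
  have hspan (v : V) : ∃ r : Fin n → R, (∀ j, Ideal.Quotient.mk _ (r j) = f v j) ∧
      v - ∑ j, r j • y j ∈ (maximalIdeal R).map (algebraMap R V) := by
    choose r hr using fun j => Ideal.Quotient.mk_surjective (f v j)
    refine ⟨r, hr, (hmem _).1 ?_⟩
    ext i
    simp [hy, Finset.sum_apply, hsmul, Pi.single_apply, hr]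
  have hext {χ : V →ₗ[R] R ⧸ maximalIdeal R} (h : ∀ j, χ (y j) = 0) (v : V) : χ v = 0 := by
    obtain ⟨r, -, hr⟩ := hspan v
    have := map_eq_zero_of_mem_map_maximalIdeal χ hr
    simpa [h] using this
  let M : Matrix (Fin n) (Fin n) (R ⧸ maximalIdeal R) := Matrix.of fun i j => φ (y j * y i)
  have hM : Function.Injective M.mulVec := by
    refine (injective_iff_map_eq_zero M.mulVecLin).2 fun c hc => ?_
    obtain ⟨x, rfl⟩ := hf c
    obtain ⟨r, hr, hx⟩ := hspan x
    refine (hmem x).2 (hφ x fun v => ?_)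
    refine hext (χ := φ ∘ₗ LinearMap.mulLeft R x) (fun i => ?_) v
    have h1 := map_eq_zero_of_mem_map_maximalIdeal φ (Ideal.mul_mem_right (y i) _ hx)
    have h2 := congrFun hc i
    simp only [sub_mul, Finset.sum_mul, smul_mul_assoc, map_sub, map_sum, map_smul, sub_eq_zero,
      hsmul, hr] at h1
    simp only [Matrix.mulVecLin_apply, Matrix.mulVec, dotProduct, M, Matrix.of_apply,
      Pi.zero_apply] at h2
    simp only [LinearMap.comp_apply, LinearMap.mulLeft_apply, h1, ← h2, mul_comm]
  obtain ⟨c, hc⟩ := Matrix.mulVec_surjective_iff_isUnit.2 (Matrix.mulVec_injective_iff_isUnit.1 hM)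
    fun i => ψ (y i)
  choose r hr using fun j => Ideal.Quotient.mk_surjective (c j)
  refine ⟨∑ j, r j • y j, fun v => sub_eq_zero.1 ?_⟩
  refine hext (χ := ψ - φ ∘ₗ LinearMap.mulLeft R (∑ j, r j • y j)) (fun i => ?_) v
  have h2 := congrFun hc i
  simp only [Matrix.mulVec, dotProduct, M, Matrix.of_apply] at h2
  simp only [LinearMap.sub_apply, LinearMap.comp_apply, LinearMap.mulLeft_apply, Finset.sum_mul,
    smul_mul_assoc, map_sum, map_smul, hsmul, hr, ← h2, sub_eq_zero]
  exact Finset.sum_congr rfl fun j _ => mul_comm _ _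

end Translate

section ResidueDual

open IsLocalRing

/-- The situation in which `K` is the kernel of a perfect functional `φ` on `V / m V`, where the
maximal ideal `m` of `R` is the principal ideal `a V` of the overring `V`. -/
structure IsResidueDual {R : Type*} [CommRing R] [IsLocalRing R] {Q : Type*} [CommRing Q]
    [Algebra R Q] (V : Subalgebra R Q) (K : Submodule R Q) (a : Q)
    (φ : V →ₗ[R] R ⧸ maximalIdeal R) : Prop where
  isUnit : IsUnit a
  exists_algebraMap_eq : ∀ v ∈ V, ∃ r ∈ maximalIdeal R, algebraMap R Q r = a * v
  exists_eq_mul : ∀ r ∈ maximalIdeal R, ∃ v ∈ V, algebraMap R Q r = a * v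
  mem_iff : ∀ x, x ∈ K ↔ ∃ v : V, φ v = 0 ∧ (v : Q) = x
  nondegenerate : ∀ x : V, (∀ v, φ (x * v) = 0) → ∃ v ∈ V, (x : Q) = a * v
  exists_translate : ∀ ψ : V →ₗ[R] R ⧸ maximalIdeal R, ∃ w, ∀ v, ψ v = φ (w * v)

namespace IsResidueDual

variable {R : Type*} [CommRing R] [IsLocalRing R] {Q : Type*} [CommRing Q]
    [Algebra R Q] {V : Subalgebra R Q} {K : Submodule R Q} {a : Q}
    {φ : V →ₗ[R] R ⧸ maximalIdeal R} (h : IsResidueDual V K a φ)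

include h

lemma smul_eq_mul_mem {r : R} (hr : r ∈ maximalIdeal R) {x : Q} (hx : x ∈ V) :
    ∃ v ∈ V, r • x = a * v := by
  obtain ⟨v, hv, e⟩ := h.exists_eq_mul r hr
  exact ⟨v * x, mul_mem hv hx, by rw [Algebra.smul_def, e, mul_assoc]⟩

lemma mul_mem_algebra {v : Q} (hv : v ∈ V) : a * v ∈ V := by
  obtain ⟨r, -, e⟩ := h.exists_algebraMap_eq v hv
  exact e ▸ V.algebraMap_mem r

lemma mul_mem {v : Q} (hv : v ∈ V) : a * v ∈ K := by
  obtain ⟨r, hr, e⟩ := h.exists_algebraMap_eq v hv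
  refine (h.mem_iff _).2 ⟨r • 1, ?_, ?_⟩
  · rw [map_smul, Algebra.smul_def]
    exact (congrArg (· * _) (Ideal.Quotient.eq_zero_iff_mem.2 hr)).trans (zero_mul _)
  · rw [← e, Algebra.algebraMap_eq_smul_one]
    rfl

lemma mem_algebra {x : Q} (hx : x ∈ K) : x ∈ V := by
  obtain ⟨v, -, rfl⟩ := (h.mem_iff _).1 hx
  exact v.2

lemma map_eq_zero {v : V} (hv : (v : Q) ∈ K) : φ v = 0 := by
  obtain ⟨v', h', e⟩ := (h.mem_iff _).1 hv
  rwa [Subtype.ext e] at h'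

lemma exists_eq_of_mul_mem {q : Q} (hq : ∀ v ∈ V, v * q ∈ K) : ∃ v ∈ V, q = a * v := by
  have hqV : q ∈ V := h.mem_algebra (by simpa using hq 1 (one_mem V))
  refine h.nondegenerate ⟨q, hqV⟩ fun v => h.map_eq_zero ?_
  rw [mul_comm]
  exact hq v v.2

lemma mem_of_mul_mem_colonSub [Module.Finite R V] {I : Submodule R Q} (hI : ∀ v ∈ V, a * v ∈ I)
    (hIV : ∀ x ∈ I, x ∈ V) {x : Q} (hx : x ∈ V) (hx' : ∀ w ∈ colonSub K I, w * x ∈ K) :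
    x ∈ I := by
  let N : Submodule R V := I.comap V.val.toLinearMap
  obtain ⟨n, f, hf, hker⟩ := exists_surjective_ker_eq_smul_top (R := R) (V ⧸ N)
  have hker : LinearMap.ker f = ⊥ := by
    rw [hker, eq_bot_iff, Submodule.smul_le]
    intro r hr y _
    obtain ⟨y, rfl⟩ := Submodule.mkQ_surjective _ y
    obtain ⟨v, hv, e⟩ := h.smul_eq_mul_mem hr y.2
    rw [Submodule.mem_bot, ← map_smul]
    refine (Submodule.Quotient.mk_eq_zero _).2 ?_
    change r • (y : Q) ∈ I
    exact e ▸ hI v hv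
  have hmem (y : V) : (y : Q) ∈ I ↔ f (N.mkQ y) = 0 := by
    rw [← LinearMap.mem_ker, hker, Submodule.mem_bot]
    exact (Submodule.Quotient.mk_eq_zero N).symm
  refine (hmem ⟨x, hx⟩).2 (funext fun i => ?_)
  obtain ⟨w, hw⟩ := h.exists_translate (LinearMap.proj i ∘ₗ f ∘ₗ N.mkQ)
  have hw' : (w : Q) ∈ colonSub K I := fun y hy => by
    refine (h.mem_iff _).2 ⟨w * ⟨y, hIV y hy⟩, ?_, rfl⟩
    rw [← hw]
    change f (N.mkQ ⟨y, hIV y hy⟩) i = 0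
    rw [(hmem _).1 hy]
    rfl
  change (LinearMap.proj i ∘ₗ f ∘ₗ N.mkQ) ⟨x, hx⟩ = 0
  rw [hw]
  exact h.map_eq_zero (hx' w hw')

end IsResidueDual

end ResidueDual

section LengthQuotient

variable {R : Type*} [CommRing R] {M N P : Type*} [AddCommGroup M] [Module R M] [AddCommGroup N]
  [Module R N] [AddCommGroup P] [Module R P]

lemma Module.length_le_of_ker_le {f : M →ₗ[R] N} (hf : Function.Surjective f) {g : M →ₗ[R] P}
    (hg : LinearMap.ker g ≤ LinearMap.ker f) : Module.length R N ≤ Module.length R P := by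
  refine (Module.length_le_of_surjective ((LinearMap.ker g).liftQ f hg) fun y => ?_).trans
    (Module.length_le_of_injective ((LinearMap.ker g).liftQ g le_rfl) ?_)
  · obtain ⟨x, rfl⟩ := hf y
    exact ⟨Submodule.Quotient.mk x, rfl⟩
  · exact LinearMap.ker_eq_bot.1 (Submodule.ker_liftQ_eq_bot _ _ _ le_rfl)

/-- The projection of a submodule `B` onto its image modulo `A`. -/
def Submodule.toMapMkQ (A B : Submodule R M) : B →ₗ[R] B.map A.mkQ :=
  A.mkQ.restrict fun _ hx => Submodule.mem_map_of_mem hx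

variable {A B C : Submodule R M}

lemma Submodule.toMapMkQ_surjective : Function.Surjective (Submodule.toMapMkQ A B) := by
  rintro ⟨_, x, hx, rfl⟩
  exact ⟨⟨x, hx⟩, rfl⟩

lemma Submodule.toMapMkQ_eq_zero_iff {x : B} : Submodule.toMapMkQ A B x = 0 ↔ (x : M) ∈ A := by
  rw [← Submodule.Quotient.mk_eq_zero A]
  exact Subtype.ext_iff

lemma Submodule.length_map_mkQ_le (f : B →ₗ[R] P) (hf : ∀ x, f x = 0 → (x : M) ∈ A) :
    Module.length R (B.map A.mkQ) ≤ Module.length R P :=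
  Module.length_le_of_ker_le toMapMkQ_surjective fun x hx => toMapMkQ_eq_zero_iff.2 (hf x hx)

lemma Submodule.length_le_length_map_mkQ (f : B →ₗ[R] P) (hf : Function.Surjective f)
    (hA : ∀ x : B, (x : M) ∈ A → f x = 0) :
    Module.length R P ≤ Module.length R (B.map A.mkQ) :=
  Module.length_le_of_ker_le hf fun x hx => hA x (toMapMkQ_eq_zero_iff.1 hx)

lemma Submodule.length_map_mkQ_le_add (hAB : A ≤ B) (hBC : B ≤ C) (f : C →ₗ[R] P)
    (hf : ∀ x, f x = 0 → (x : M) ∈ B) : Module.length R (C.map A.mkQ) ≤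
      Module.length R (B.map A.mkQ) + Module.length R P := by
  refine (Module.length_le_add_of_exact (j := Submodule.inclusion (Submodule.map_mono hBC))
    (g := ((Submodule.factor hAB).restrict (p := C.map A.mkQ) (q := C.map B.mkQ) ?_)) ?_).trans
      (add_le_add_right (length_map_mkQ_le f hf) _)
  · rintro _ ⟨x, hx, rfl⟩
    exact ⟨x, hx, rfl⟩
  · rintro ⟨_, x, hx, rfl⟩
    have h1 : ((Submodule.factor hAB).restrict (p := C.map A.mkQ) (q := C.map B.mkQ) (by
        rintro _ ⟨x, hx, rfl⟩
        exact ⟨x, hx, rfl⟩)) ⟨A.mkQ x, x, hx, rfl⟩ = 0 ↔ x ∈ B :=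
      Subtype.ext_iff.trans (Submodule.Quotient.mk_eq_zero B)
    refine h1.trans ⟨fun h => ⟨⟨_, x, h, rfl⟩, rfl⟩, ?_⟩
    rintro ⟨⟨_, y, hy, rfl⟩, h⟩
    have h := (Submodule.Quotient.eq A).1 (Subtype.ext_iff.1 h)
    simpa using B.sub_mem hy (hAB h)

lemma Submodule.le_of_length_map_mkQ_le (hAB : A ≤ B) (hBC : B ≤ C)
    (h : Module.length R (C.map A.mkQ) ≤ Module.length R (B.map A.mkQ))
    (hC : Module.length R (C.map A.mkQ) ≠ ⊤) : C ≤ B := fun x hx => by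
  obtain ⟨⟨_, y, hy, rfl⟩, e⟩ := LinearMap.surjective_of_length_le
    (Submodule.inclusion_injective (Submodule.map_mono hBC)) h hC ⟨A.mkQ x, x, hx, rfl⟩
  have e := (Submodule.Quotient.eq A).1 (Subtype.ext_iff.1 e)
  simpa using B.sub_mem hy (hAB e)

end LengthQuotient

section Duality

open IsLocalRing

/-- The product of two submodules, mapped to matrices over the residue field along maps of the
factors, when the multiplication map of the factors is injective. -/
lemma exists_surjective_of_mulMap_injective {R : Type*} [CommRing R] {Q : Type*} [CommRing Q]
    [Algebra R Q] (𝔪 : Ideal R) {I J : Submodule R Q} (hIJ : Function.Injective (I.mulMap J))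
    {s t : ℕ} {f : I →ₗ[R] Fin s → R ⧸ 𝔪} (hf : Function.Surjective f)
    {g : J →ₗ[R] Fin t → R ⧸ 𝔪} (hg : Function.Surjective g) :
    ∃ F : ↥(I * J) →ₗ[R] Fin s × Fin t → R ⧸ 𝔪, Function.Surjective F ∧
      ∀ x : ↥(I * J), (x : Q) ∈ 𝔪 • (I * J) → F x = 0 := by
  let B : I →ₗ[R] J →ₗ[R] Fin s × Fin t → R ⧸ 𝔪 :=
    LinearMap.mk₂ R (fun x y p => f x p.1 * g y p.2)
      (fun _ _ _ => funext fun _ => by simp [add_mul])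
      (fun _ _ _ => funext fun _ => by simp)
      (fun _ _ _ => funext fun _ => by simp [mul_add])
      (fun _ _ _ => funext fun _ => by simp)
  let e : I ⊗[R] J ≃ₗ[R] ↥(I * J) := LinearEquiv.ofBijective (I.mulMap' J)
    ⟨fun x y hxy => hIJ (congrArg Subtype.val hxy), I.mulMap'_surjective J⟩
  refine ⟨TensorProduct.lift B ∘ₗ e.symm.toLinearMap, ?_, fun x hx => ?_⟩
  · rw [LinearMap.coe_comp]
    refine Function.Surjective.comp (fun z => ?_) e.symm.surjective
    choose x hx using fun i => hf (Pi.single i 1)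
    choose y hy using fun j => hg (Pi.single j 1)
    choose r hr using fun p => Ideal.Quotient.mk_surjective (z p)
    refine ⟨∑ p, r p • (x p.1 ⊗ₜ[R] y p.2), funext fun q => ?_⟩
    simp only [map_sum, map_smul, TensorProduct.lift.tmul, Finset.sum_apply, Pi.smul_apply, B,
      LinearMap.mk₂_apply, hx, hy]
    rw [Finset.sum_eq_single q]
    · rw [Pi.single_eq_same, Pi.single_eq_same, mul_one, ← hr q, Algebra.smul_def, mul_one]
      rfl
    · rintro p - hpq
      by_cases h1 : p.1 = q.1
      · have h2 : q.2 ≠ p.2 := fun h => hpq (Prod.ext h1 h.symm)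
        rw [Pi.single_eq_of_ne h2, mul_zero, smul_zero]
      · rw [Pi.single_eq_of_ne (Ne.symm h1), zero_mul, smul_zero]
    · simp
  · have hx : x ∈ 𝔪 • (⊤ : Submodule R ↥(I * J)) := by
      obtain ⟨y, hy, e⟩ : (x : Q) ∈ (𝔪 • (⊤ : Submodule R ↥(I * J))).map (I * J).subtype := by
        rwa [Submodule.map_smul'', Submodule.map_subtype_top]
      rwa [← Subtype.ext e]
    refine Submodule.smul_induction_on hx (fun r hr y _ => ?_) fun x y hx hy => ?_
    · rw [map_smul]
      funext p
      rw [Pi.smul_apply, Algebra.smul_def]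
      exact (congrArg (· * _) (Ideal.Quotient.eq_zero_iff_mem.2 hr)).trans (zero_mul _)
    · rw [map_add, hx, hy, add_zero]

namespace IsResidueDual

variable {R : Type*} [CommRing R] [IsLocalRing R] {Q : Type*} [CommRing Q]
    [Algebra R Q] {V : Subalgebra R Q} {K : Submodule R Q} {a : Q}
    {φ : V →ₗ[R] R ⧸ maximalIdeal R} {I : Submodule R Q}

omit [IsLocalRing R] in
lemma le_of_mul_eq (hIV : I * Subalgebra.toSubmodule V = Subalgebra.toSubmodule V) {x : Q}
    (hx : x ∈ I) : x ∈ V := by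
  have := Submodule.mul_mem_mul hx ((Subalgebra.mem_toSubmodule V).2 (one_mem V))
  rwa [hIV, mul_one] at this

variable (h : IsResidueDual V K a φ)

include h

lemma mem_smul_iff (hIV : I * Subalgebra.toSubmodule V = Subalgebra.toSubmodule V) {x : Q} :
    x ∈ maximalIdeal R • I ↔ ∃ v ∈ V, x = a * v := by
  constructor
  · intro hx
    refine Submodule.smul_induction_on hx (fun r hr y hy =>
      h.smul_eq_mul_mem hr (le_of_mul_eq hIV hy)) ?_
    rintro _ _ ⟨v, hv, rfl⟩ ⟨w, hw, rfl⟩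
    exact ⟨v + w, add_mem hv hw, (mul_add _ _ _).symm⟩
  · rintro ⟨v, hv, rfl⟩
    have hv' : v ∈ I * Subalgebra.toSubmodule V := hIV.ge hv
    refine Submodule.mul_induction_on hv' (fun i hi w hw => ?_) fun x y hx hy => ?_
    · obtain ⟨r, hr, e⟩ := h.exists_algebraMap_eq w hw
      rw [show a * (i * w) = r • i by rw [Algebra.smul_def, e]; ring]
      exact Submodule.smul_mem_smul hr hi
    · rw [mul_add]
      exact add_mem hx hy

lemma mul_mem_of_mul_eq (hIV : I * Subalgebra.toSubmodule V = Subalgebra.toSubmodule V) {v : Q}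
    (hv : v ∈ V) : a * v ∈ I :=
  Submodule.smul_le_right ((h.mem_smul_iff hIV).2 ⟨v, hv, rfl⟩)

lemma mem_of_mem_colonSub (hIV : I * Subalgebra.toSubmodule V = Subalgebra.toSubmodule V) {x : Q}
    (hx : x ∈ colonSub K I) : x ∈ V := by
  have h1 : (1 : Q) ∈ I * Subalgebra.toSubmodule V := hIV.ge (one_mem V)
  suffices ∀ y ∈ I * Subalgebra.toSubmodule V, x * y ∈ V by simpa using this 1 h1
  intro y hy
  refine Submodule.mul_induction_on hy (fun i hi w hw => ?_) fun y z hy hz => ?_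
  · rw [← mul_assoc]
    exact V.mul_mem (h.mem_algebra (hx i hi)) hw
  · rw [mul_add]
    exact add_mem hy hz

lemma mul_mem_colonSub (hIV : I * Subalgebra.toSubmodule V = Subalgebra.toSubmodule V) {v : Q}
    (hv : v ∈ V) : a * v ∈ colonSub K I := fun i hi => by
  rw [mul_assoc]
  exact h.mul_mem (V.mul_mem hv (le_of_mul_eq hIV hi))

omit [IsLocalRing R] h in
/-- The ideal `a V`, as a submodule. -/
lemma mem_map_mulLeft_iff {x : Q} :
    x ∈ (Subalgebra.toSubmodule V).map (LinearMap.mulLeft R a) ↔ ∃ v ∈ V, x = a * v := by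
  simp [eq_comm]

lemma length_map_mkQ_le {N : Submodule R Q} (hN : ∀ x ∈ N, x ∈ V) {n : ℕ}
    {f : N →ₗ[R] Fin n → R ⧸ maximalIdeal R} (hf : LinearMap.ker f = maximalIdeal R • ⊤) :
    Module.length R (N.map ((Subalgebra.toSubmodule V).map (LinearMap.mulLeft R a)).mkQ) ≤ n := by
  refine (Submodule.length_map_mkQ_le f fun x hx => ?_).trans (by
    rw [Module.length_pi_residue, Fintype.card_fin])
  rw [← LinearMap.mem_ker, hf] at hx
  have := Submodule.mem_map_of_mem (f := N.subtype) hx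
  rw [Submodule.map_smul'', Submodule.map_subtype_top] at this
  refine Submodule.smul_le.2 (fun r hr y hy => ?_) this
  exact mem_map_mulLeft_iff.2 (h.smul_eq_mul_mem hr (hN y hy))

lemma length_map_mkQ_le_add (hIV : I * Subalgebra.toSubmodule V = Subalgebra.toSubmodule V)
    {s : ℕ} {f : I →ₗ[R] Fin s → R ⧸ maximalIdeal R} (hf : Function.Surjective f)
    (hf' : LinearMap.ker f = maximalIdeal R • ⊤) :
    Module.length R ((Subalgebra.toSubmodule V).map
      ((Subalgebra.toSubmodule V).map (LinearMap.mulLeft R a)).mkQ) ≤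
    Module.length R ((colonSub K I).map
      ((Subalgebra.toSubmodule V).map (LinearMap.mulLeft R a)).mkQ) + s := by
  choose y hy using fun i => hf (Pi.single i 1)
  let θ : Subalgebra.toSubmodule V →ₗ[R] Fin s → R ⧸ maximalIdeal R := LinearMap.pi fun i =>
    φ ∘ₗ LinearMap.mulRight R (⟨y i, le_of_mul_eq hIV (y i).2⟩ : V)
  have hθ (x : Subalgebra.toSubmodule V) (hx : θ x = 0) : (x : Q) ∈ colonSub K I := fun i hi => by
    choose r hr using fun j => Ideal.Quotient.mk_surjective (f ⟨i, hi⟩ j)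
    have h0 : ⟨i, hi⟩ - ∑ j, r j • y j ∈ LinearMap.ker f := by
      rw [LinearMap.mem_ker]
      ext k
      simp [hy, Finset.sum_apply, Algebra.smul_def, Pi.single_apply, hr]
    rw [hf'] at h0
    have h0 := Submodule.mem_map_of_mem (f := I.subtype) h0
    rw [Submodule.map_smul'', Submodule.map_subtype_top] at h0
    obtain ⟨v, hv, e⟩ := (h.mem_smul_iff hIV).1 h0
    have e' : (x : Q) * i = (∑ j, r j • ((x : Q) * y j)) + a * (x * v) := by
      have : i = (∑ j, r j • (y j : Q)) + a * v := by
        rw [← e]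
        simp
      conv_lhs => rw [this]
      simp only [mul_add, Finset.mul_sum, mul_smul_comm]
      ring
    rw [e']
    refine add_mem (sum_mem fun j _ => K.smul_mem _ ?_) (h.mul_mem (V.mul_mem x.2 hv))
    exact (h.mem_iff _).2 ⟨_, congrFun hx j, rfl⟩
  refine (Submodule.length_map_mkQ_le_add ?_ (fun x => h.mem_of_mem_colonSub hIV) θ hθ).trans
    (by rw [Module.length_pi_residue, Fintype.card_fin])
  intro x hx
  obtain ⟨v, hv, rfl⟩ := mem_map_mulLeft_iff.1 hx
  exact h.mul_mem_colonSub hIV hv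

lemma mul_mem_smul_mul (hIV : I * Subalgebra.toSubmodule V = Subalgebra.toSubmodule V)
    {J : Submodule R Q} {x : Q} (hx : x ∈ J * Subalgebra.toSubmodule V) :
    a * x ∈ maximalIdeal R • (I * J) := by
  refine Submodule.mul_induction_on hx (fun j hj w hw => ?_) fun x y hx hy => ?_
  · rw [mul_left_comm, mul_comm j, ← smul_mul_assoc]
    exact Submodule.mul_mem_mul ((h.mem_smul_iff hIV).2 ⟨w, hw, rfl⟩) hj
  · rw [mul_add]
    exact add_mem hx hy

/-- The part of `V` that `c` carries into `I J` has at least the length of `I J` modulo its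
maximal submodules. -/
lemma mul_le_length_map_mkQ (hIV : I * Subalgebra.toSubmodule V = Subalgebra.toSubmodule V)
    {J : Submodule R Q} (hIJ : Function.Injective (I.mulMap J)) {c : Q}
    (hc : ∀ x, x ∈ J * Subalgebra.toSubmodule V ↔ ∃ v ∈ V, c * v = x) {s t : ℕ}
    {f : I →ₗ[R] Fin s → R ⧸ maximalIdeal R} (hf : Function.Surjective f)
    {g : J →ₗ[R] Fin t → R ⧸ maximalIdeal R} (hg : Function.Surjective g) :
    ((s * t : ℕ) : ℕ∞) ≤ Module.length R
      ((Subalgebra.toSubmodule V ⊓ (I * J).comap (LinearMap.mulLeft R c)).map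
        ((Subalgebra.toSubmodule V).map (LinearMap.mulLeft R a)).mkQ) := by
  obtain ⟨F, hF, hF0⟩ := exists_surjective_of_mulMap_injective _ hIJ hf hg
  let μ : ↥(Subalgebra.toSubmodule V ⊓ (I * J).comap (LinearMap.mulLeft R c)) →ₗ[R] ↥(I * J) :=
    (LinearMap.mulLeft R c).restrict fun x hx => hx.2
  have hμ : Function.Surjective μ := fun y => by
    have hy : (y : Q) ∈ J * Subalgebra.toSubmodule V := by
      rw [mul_comm J]
      exact (mul_le_mul' (fun x hx => le_of_mul_eq hIV hx) le_rfl :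
        I * J ≤ Subalgebra.toSubmodule V * J) y.2
    obtain ⟨v, hv, e⟩ := (hc _).1 hy
    exact ⟨⟨v, hv, by simp [e]⟩, Subtype.ext e⟩
  refine le_trans (by rw [Module.length_pi_residue]; simp) (Submodule.length_le_length_map_mkQ
    (F ∘ₗ μ) (hF.comp hμ) fun x hx => ?_)
  obtain ⟨v, hv, e⟩ := mem_map_mulLeft_iff.1 hx
  refine hF0 _ ?_
  change c * (x : Q) ∈ _
  rw [e, mul_left_comm]
  exact h.mul_mem_smul_mul hIV ((hc _).2 ⟨v, hv, rfl⟩)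

/-- One of `I` and `K : I` is cyclic if their multiplication map is injective. -/
theorem le_one_or_le_one [Module.Finite R V]
    (hprinc : ∀ N : Submodule R Q, N.FG → (∃ u ∈ N, IsUnit u) → (∀ v ∈ V, ∀ x ∈ N, v * x ∈ N) →
      ∃ b, IsUnit b ∧ ∀ x, x ∈ N ↔ ∃ v ∈ V, b * v = x)
    (hIV : I * Subalgebra.toSubmodule V = Subalgebra.toSubmodule V)
    (hI : Function.Injective (I.mulMap (colonSub K I))) (hJ : (colonSub K I).FG)
    {s t : ℕ} {f : I →ₗ[R] Fin s → R ⧸ maximalIdeal R} (hf : Function.Surjective f)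
    (hf' : LinearMap.ker f = maximalIdeal R • ⊤)
    {g : ↥(colonSub K I) →ₗ[R] Fin t → R ⧸ maximalIdeal R} (hg : Function.Surjective g)
    (hg' : LinearMap.ker g = maximalIdeal R • ⊤) : s ≤ 1 ∨ t ≤ 1 := by
  have hlenI := h.length_map_mkQ_le (fun x => le_of_mul_eq hIV) hf'
  have hlenJ := h.length_map_mkQ_le (fun x => h.mem_of_mem_colonSub hIV) hg'
  have hlenV := (h.length_map_mkQ_le_add hIV hf hf').trans (add_le_add_left hlenJ _)
  obtain ⟨c, hc, hcJ⟩ := hprinc (colonSub K I * Subalgebra.toSubmodule V)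
    (hJ.mul (Module.Finite.iff_fg.1 ‹Module.Finite R V›))
    ⟨a * 1 * 1, Submodule.mul_mem_mul (h.mul_mem_colonSub hIV (one_mem V))
      ((Subalgebra.mem_toSubmodule V).2 (one_mem V)), by simpa using h.isUnit⟩ fun v hv x hx => by
      refine Submodule.mul_induction_on hx (fun j hj w hw => ?_) fun x y hx hy => ?_
      · rw [mul_left_comm]
        exact Submodule.mul_mem_mul hj (V.mul_mem hv hw)
      · rw [mul_add]
        exact add_mem hx hy
  have hlenL := h.mul_le_length_map_mkQ hIV hI hcJ hf hg
  set L := Subalgebra.toSubmodule V ⊓ (I * colonSub K I).comap (LinearMap.mulLeft R c)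
  have hAL : (Subalgebra.toSubmodule V).map (LinearMap.mulLeft R a) ≤ L := fun x hx => by
    obtain ⟨v, hv, rfl⟩ := mem_map_mulLeft_iff.1 hx
    refine ⟨h.mul_mem_algebra hv, ?_⟩
    change c * (a * v) ∈ I * colonSub K I
    rw [mul_left_comm]
    exact Submodule.smul_le_right (h.mul_mem_smul_mul hIV ((hcJ _).2 ⟨v, hv, rfl⟩))
  by_contra! hst
  have h1 : t + s ≤ s * t := by nlinarith
  have hVL : Subalgebra.toSubmodule V ≤ L := Submodule.le_of_length_map_mkQ_le hAL inf_le_left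
    (hlenV.trans (le_trans (by exact_mod_cast h1) hlenL))
    (ne_top_of_le_ne_top (by exact_mod_cast ENat.natCast_ne_top (t + s)) hlenV)
  have hVI : L ≤ I := fun x hx => by
    refine h.mem_of_mul_mem_colonSub (fun v hv => h.mul_mem_of_mul_eq hIV hv)
      (fun x hx => le_of_mul_eq hIV hx) hx.1 fun w hw => ?_
    obtain ⟨v, hv, e⟩ := (hcJ _).1 (Submodule.mul_mem_mul hw hx.1)
    rw [← e]
    refine Submodule.mul_le.2 (fun i hi j hj => ?_) (hVL hv).2
    rw [mul_comm]
    exact hj i hi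
  have h2 : ((s * t : ℕ) : ℕ∞) ≤ s := hlenL.trans <|
    (Module.length_le_of_injective _ (Submodule.inclusion_injective (Submodule.map_mono hVI))).trans
      hlenI
  have h2 : s * t ≤ s := by exact_mod_cast h2
  nlinarith

theorem nonempty_equiv_or_nonempty_equiv [Module.Finite R V] [IsNoetherianRing R]
    (hinj : Function.Injective (algebraMap R Q))
    (hprinc : ∀ N : Submodule R Q, N.FG → (∃ u ∈ N, IsUnit u) → (∀ v ∈ V, ∀ x ∈ N, v * x ∈ N) →
      ∃ b, IsUnit b ∧ ∀ x, x ∈ N ↔ ∃ v ∈ V, b * v = x)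
    (hu : ∃ u ∈ I, IsUnit u)
    (hIV : I * Subalgebra.toSubmodule V = Subalgebra.toSubmodule V)
    (hI : Function.Injective (I.mulMap (colonSub K I))) :
    Nonempty (I ≃ₗ[R] R) ∨ Nonempty (I ≃ₗ[R] K) := by
  have hV : IsNoetherian R (Subalgebra.toSubmodule V) :=
    isNoetherian_of_isNoetherianRing_of_finite R V
  have hIfin : Module.Finite R I :=
    Module.Finite.of_fg (isNoetherian_submodule.1 hV I fun x hx => le_of_mul_eq hIV hx)
  have hJfg : (colonSub K I).FG :=
    isNoetherian_submodule.1 hV _ fun x hx => h.mem_of_mem_colonSub hIV hx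
  have hJfin : Module.Finite R (colonSub K I) := Module.Finite.of_fg hJfg
  obtain ⟨s, f, hf, hf'⟩ := exists_surjective_ker_eq_smul_top (R := R) I
  obtain ⟨t, g, hg, hg'⟩ := exists_surjective_ker_eq_smul_top (R := R) (colonSub K I)
  have hunit {N : Submodule R Q} {y : N} (hy : ∀ x, ∃ r : R, r • y = x)
      (hN : ∃ u ∈ N, IsUnit u) : IsUnit (y : Q) := by
    obtain ⟨u, hu, hu'⟩ := hN
    obtain ⟨r, hr⟩ := hy ⟨u, hu⟩
    have hr : algebraMap R Q r * y = u := by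
      rw [← Algebra.smul_def]
      exact congrArg Subtype.val hr
    exact (IsUnit.mul_iff.1 (hr ▸ hu')).2
  rcases h.le_one_or_le_one hprinc hIV hI hJfg hf hf' hg hg' with hs | ht
  · obtain ⟨y, hy⟩ := exists_smul_eq_of_surjective_of_le_one hf hf' hs
    have hy' := hunit hy hu
    refine Or.inl ⟨(LinearEquiv.ofBijective (LinearMap.toSpanSingleton R I y) ⟨?_, hy⟩).symm⟩
    refine fun r r' e => hinj (hy'.mul_right_cancel ?_)
    rw [← Algebra.smul_def, ← Algebra.smul_def]
    exact congrArg Subtype.val e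
  · obtain ⟨y, hy⟩ := exists_smul_eq_of_surjective_of_le_one hg hg' ht
    have haJ {v : Q} (hv : v ∈ V) := h.mul_mem_colonSub hIV hv
    have hy' := hunit hy ⟨a, by simpa using haJ (one_mem V), h.isUnit⟩
    refine Or.inr ⟨LinearEquiv.ofBijective ((LinearMap.mulLeft R (y : Q)).restrict
      fun x hx => y.2 x hx) ⟨fun x x' e => Subtype.ext (hy'.mul_left_cancel
        (congrArg Subtype.val e)), ?_⟩⟩
    rintro ⟨k, hk⟩
    obtain ⟨x, rfl⟩ := hy'.dvd (a := k)
    have hx (w : Q) (hw : w ∈ colonSub K I) : w * x ∈ K := by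
      obtain ⟨r, hr⟩ := hy ⟨w, hw⟩
      have hr : r • (y : Q) = w := congrArg Subtype.val hr
      rw [← hr, smul_mul_assoc]
      exact K.smul_mem r hk
    have hxV : x ∈ V := by
      obtain ⟨v, hv, e⟩ := h.exists_eq_of_mul_mem (q := a * x) fun v hv => by
        rw [← mul_assoc, mul_comm v]
        exact hx _ (haJ hv)
      rwa [h.isUnit.mul_left_cancel e]
    exact ⟨⟨x, h.mem_of_mul_mem_colonSub (fun v hv => h.mul_mem_of_mul_eq hIV hv)
      (fun x hx => le_of_mul_eq hIV hx) hxV hx⟩, rfl⟩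

end IsResidueDual

end Duality

section ResidueDualCanonical

open IsLocalRing

universe w

namespace IsResidueDual

variable {R : Type w} [CommRing R] [IsLocalRing R] {Q : Type w} [CommRing Q]
    [Algebra R Q] {V : Subalgebra R Q} {K : Submodule R Q} {a : Q}
    {φ : V →ₗ[R] R ⧸ maximalIdeal R} (h : IsResidueDual V K a φ)

include h

lemma surjective (hinj : Function.Injective (algebraMap R Q)) : Function.Surjective φ := by
  have h1 : ∃ v, φ v ≠ 0 := by
    by_contra! h0
    obtain ⟨v, hv, e⟩ := h.nondegenerate 1 fun v => h0 _
    obtain ⟨r, hr, e'⟩ := h.exists_algebraMap_eq v hv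
    have : r = 1 := hinj (by rw [e', ← e, map_one]; rfl)
    exact (maximalIdeal.isMaximal R).ne_top ((Ideal.eq_top_iff_one _).2 (this ▸ hr))
  obtain ⟨v, hv⟩ := h1
  let _ := Ideal.Quotient.field (maximalIdeal R)
  intro z
  obtain ⟨c, hc⟩ := Ideal.Quotient.mk_surjective (z * (φ v)⁻¹)
  refine ⟨c • v, ?_⟩
  rw [map_smul, Algebra.smul_def]
  change Ideal.Quotient.mk _ c * φ v = z
  rw [hc, inv_mul_cancel_right₀ hv]

/-- A complement of `R` in `V`: generators of `V` that are independent modulo `m`. -/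
lemma exists_generators [Module.Finite R V] :
    ∃ (p : ℕ) (f : V →ₗ[R] Fin p → R ⧸ maximalIdeal R) (y : Fin p → V),
      f 1 = 0 ∧ (∀ j, f (y j) = Pi.single j 1) ∧
      ∀ x : V, ∃ r : Option (Fin p) → R, (∀ j, Ideal.Quotient.mk _ (r (some j)) = f x j) ∧
        ∑ i, r i • i.elim 1 y = x := by
  let N : Submodule R V := LinearMap.range (Algebra.linearMap R V)
  obtain ⟨p, f, hf, hker⟩ := exists_surjective_ker_eq_smul_top (R := R) (V ⧸ N)
  have hker : LinearMap.ker f = ⊥ := by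
    rw [hker, eq_bot_iff, Submodule.smul_le]
    intro r hr y _
    obtain ⟨y, rfl⟩ := Submodule.mkQ_surjective _ y
    obtain ⟨v, hv, e⟩ := h.smul_eq_mul_mem hr y.2
    obtain ⟨s, -, e'⟩ := h.exists_algebraMap_eq v hv
    rw [Submodule.mem_bot, ← map_smul]
    exact (Submodule.Quotient.mk_eq_zero _).2 ⟨s, Subtype.ext (e'.trans e.symm)⟩
  have hmem (y : V) : (f ∘ₗ N.mkQ) y = 0 ↔ y ∈ N := by
    rw [LinearMap.comp_apply, ← LinearMap.mem_ker, hker, Submodule.mem_bot]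
    exact Submodule.Quotient.mk_eq_zero N
  choose y hy using fun j => (hf.comp N.mkQ_surjective) (Pi.single j 1)
  refine ⟨p, f ∘ₗ N.mkQ, y, (hmem 1).2 ⟨1, (algebraMap R V).map_one⟩, hy, fun x => ?_⟩
  choose r hr using fun j => Ideal.Quotient.mk_surjective ((f ∘ₗ N.mkQ) x j)
  obtain ⟨s, hs⟩ := (hmem (x - ∑ j, r j • y j)).1 <| by
    ext k
    have hy : ∀ j, (f ∘ₗ N.mkQ) (y j) = Pi.single j 1 := hy
    rw [map_sub, map_sum, Pi.sub_apply, Finset.sum_apply, Pi.zero_apply, sub_eq_zero, ← hr]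
    simp only [map_smul, hy, Pi.smul_apply, Pi.single_apply]
    simp [Algebra.smul_def]
  refine ⟨fun i => i.elim s r, hr, ?_⟩
  rw [Fintype.sum_option]
  simp only [Option.elim]
  rw [← Algebra.algebraMap_eq_smul_one]
  exact add_eq_of_eq_sub hs

theorem isCanonicalModuleAt [Module.Finite R V] [IsNoetherianRing R]
    (hinj : Function.Injective (algebraMap R Q)) :
    IsCanonicalModuleAt R (maximalIdeal R) K := by
  obtain ⟨p, f, y, hf1, hfy, hspan⟩ := h.exists_generators
  have hval (r : Option (Fin p) → R) : ((∑ i, r i • i.elim 1 y : V) : Q) =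
      ∑ i, r i • ((i.elim 1 y : V) : Q) := by
    simp
  choose c hcm hc using fun i : Option (Fin p) => h.exists_algebraMap_eq _ (i.elim 1 y : V).2
  choose β _ hβ using fun (j : Fin p) (i : Option (Fin p)) =>
    h.exists_algebraMap_eq _ (y j * i.elim 1 y : V).2
  have hKV : K = (LinearMap.ker φ).map (Subalgebra.toSubmodule V).subtype := by
    ext x
    exact (h.mem_iff x).trans Iff.rfl
  have hV : IsNoetherian R (Subalgebra.toSubmodule V) :=
    isNoetherian_of_isNoetherianRing_of_finite R V
  have : Module.Finite R K :=
    Module.Finite.of_fg (isNoetherian_submodule.1 hV K fun x hx => h.mem_algebra hx)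
  refine isCanonicalModuleAt_of_functional (V := Subalgebra.toSubmodule V) hinj h.isUnit
    (v := fun i => ((i.elim 1 y : V) : Q)) (c := c) (β := β) hc hβ rfl (fun r => ⟨fun hr => ?_, ?_⟩)
    (fun x hx => ?_) φ (h.surjective hinj) hKV (fun q => ⟨fun hq i => ?_, fun hq => ?_⟩)
    fun q hq => ?_
  · obtain ⟨v, hv, e⟩ := h.exists_eq_mul r hr
    obtain ⟨z, -, hz⟩ := hspan ⟨v, hv⟩
    refine ⟨z, hinj ?_⟩
    have hz := (hval z).symm.trans (congrArg Subtype.val hz)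
    rw [e, show v = _ from hz.symm, map_sum, Finset.mul_sum]
    refine Finset.sum_congr rfl fun i _ => ?_
    rw [map_mul, hc, Algebra.smul_def]
    ring
  · rintro ⟨z, rfl⟩
    exact sum_mem fun k _ => Ideal.mul_mem_right _ _ (hcm k)
  · have hx : ∑ i, x i • (i.elim 1 y : V) = 0 := Subtype.ext ((hval x).trans hx)
    have hsome (j : Fin p) : x (some j) ∈ maximalIdeal R := by
      have := congrFun (congrArg f hx) j
      rw [Fintype.sum_option, map_add, map_sum] at this
      simp only [map_smul, Option.elim, hf1, hfy] at this
      rw [← Ideal.Quotient.eq_zero_iff_mem]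
      simpa [Finset.sum_apply, Algebra.smul_def, Pi.single_apply] using this
    rintro (_ | j)
    · have hx := congrArg Subtype.val hx
      rw [hval, Fintype.sum_option] at hx
      choose s hs e using fun j => (h.smul_eq_mul_mem (hsome j) (y j).2)
      obtain ⟨r, hr, e'⟩ := h.exists_algebraMap_eq (∑ j, s j) (sum_mem fun j _ => hs j)
      have : x none = - r := by
        refine hinj ?_
        rw [map_neg, e', Finset.mul_sum, ← sub_eq_zero, sub_neg_eq_add,
          Algebra.algebraMap_eq_smul_one]
        simp only [← e]
        exact hx
      rw [this]
      exact neg_mem hr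
    · exact hsome j
  · rw [mul_assoc]
    exact h.mul_mem (V.mul_mem (i.elim 1 y : V).2 hq)
  · obtain ⟨v, hv, e⟩ := h.exists_eq_of_mul_mem (q := a * q) fun x hx => by
      obtain ⟨z, -, hz⟩ := hspan ⟨x, hx⟩
      have hz := (hval z).symm.trans (congrArg Subtype.val hz)
      rw [show x = _ from hz.symm, Finset.sum_mul]
      refine sum_mem fun i _ => ?_
      rw [smul_mul_assoc]
      convert K.smul_mem (z i) (hq i) using 2
      ring
    rw [h.isUnit.mul_left_cancel e]
    exact hv
  · let ψ : V →ₗ[R] R ⧸ maximalIdeal R :=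
      -∑ j, LinearMap.mulLeft R (φ ⟨q j, hq j⟩) ∘ₗ LinearMap.proj j ∘ₗ f
    obtain ⟨w, hw⟩ := h.exists_translate ψ
    refine ⟨w, (h.mem_iff _).2 ⟨w, ?_, rfl⟩, fun j => ?_⟩
    · rw [← mul_one w, ← hw]
      simp [ψ, hf1]
    · refine (h.mem_iff _).2 ⟨y j * w + ⟨q j, hq j⟩, ?_, rfl⟩
      rw [map_add, mul_comm, ← hw]
      simp [ψ, hfy, Pi.single_apply]

end IsResidueDual

end ResidueDualCanonical

section IntegralClosureDual

open nonZeroDivisors IsLocalRing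

variable {R : Type*} [CommRing R] [IsLocalRing R] [IsNoetherianRing R] [Ring.KrullDimLE 1 R]
  {Q : Type*} [CommRing Q] [Algebra R Q] [IsFractionRing R Q]
  [Module.Finite R (integralClosure R Q)]

/-- Regular ideals of the integral closure are principal. -/
lemma exists_isUnit_mem_ideal_iff_dvd (hreg : ∃ x ∈ maximalIdeal R, x ∈ R⁰)
    (p : Ideal (integralClosure R Q)) {r : R} (hr : r ∈ R⁰) (hp : algebraMap R _ r ∈ p) :
    ∃ b : integralClosure R Q, IsUnit (b : Q) ∧ ∀ x, x ∈ p ↔ b ∣ x := by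
  have hV : IsNoetherian R (Subalgebra.toSubmodule (integralClosure R Q)) :=
    isNoetherian_of_isNoetherianRing_of_finite R (integralClosure R Q)
  obtain ⟨b, hb, h⟩ := exists_isUnit_mem_iff_of_mul_mem hreg
    ((p.restrictScalars R).map (integralClosure R Q).val.toLinearMap)
    (isNoetherian_submodule.1 hV _ (by rintro _ ⟨x, -, rfl⟩; exact x.2))
    ⟨_, ⟨_, hp, rfl⟩, IsLocalization.map_units Q ⟨r, hr⟩⟩
    (by
      rintro v hv _ ⟨x, hx, rfl⟩
      exact ⟨⟨v, hv⟩ * x, p.mul_mem_left _ hx, rfl⟩)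
  obtain ⟨b', -, hb'⟩ := (h b).2 ⟨1, one_mem _, mul_one b⟩
  change (b' : Q) = b at hb'
  refine ⟨b', hb' ▸ hb, fun x => ?_⟩
  have hx : x ∈ p ↔ (x : Q) ∈ (p.restrictScalars R).map (integralClosure R Q).val.toLinearMap :=
    ⟨fun hx => ⟨x, hx, rfl⟩, fun ⟨y, hy, e⟩ => Subtype.ext (e : (y : Q) = x) ▸ hy⟩
  rw [hx, h]
  constructor
  · rintro ⟨v, hv, e⟩
    exact ⟨⟨v, hv⟩, Subtype.ext (by rw [← e, ← hb']; rfl)⟩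
  · rintro ⟨v, rfl⟩
    exact ⟨v, v.2, by rw [← hb']; rfl⟩

theorem exists_isResidueDual_integralClosure (hreg : ∃ x ∈ maximalIdeal R, x ∈ R⁰)
    (hmR : ∀ x ∈ maximalIdeal R, ∀ y ∈ integralClosure R Q,
      algebraMap R Q x * y ∈ Set.range (algebraMap R Q)) :
    ∃ (K : Submodule R Q) (a : Q) (φ : integralClosure R Q →ₗ[R] R ⧸ maximalIdeal R),
      IsResidueDual (integralClosure R Q) K a φ := by
  obtain ⟨r₀, hr₀, hr₀'⟩ := id hreg
  have hV : IsNoetherian R (integralClosure R Q) :=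
    isNoetherian_of_isNoetherianRing_of_finite R (integralClosure R Q)
  have : IsNoetherianRing (integralClosure R Q) := isNoetherian_of_tower R hV
  set A := (maximalIdeal R).map (algebraMap R (integralClosure R Q)) with hA
  have hr₀A : algebraMap R _ r₀ ∈ A := Ideal.mem_map_of_mem _ hr₀
  have hAp (p : Ideal (integralClosure R Q)) (hp : p.IsMaximal) : A ≤ p :=
    Ideal.map_le_iff_le_comap.2 fun r hr => algebraMap_mem_of_isMaximal p hr
  obtain ⟨a, ha, haA⟩ := exists_isUnit_mem_ideal_iff_dvd hreg A hr₀' hr₀A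
  have hcancel {d x y : integralClosure R Q} (hd : IsUnit (d : Q)) (e : d * x = d * y) : x = y :=
    Subtype.ext (hd.mul_left_cancel (congrArg Subtype.val e))
  obtain ⟨φ, hφ⟩ := exists_nondegenerate_functional (R := R) (V := integralClosure R Q)
    (finite_setOf_isMaximal_integralClosure hreg)
    (fun p hp hle => isMaximal_of_regular p hp ⟨_, hle hr₀A,
      mem_nonZeroDivisors_of_injective (f := (integralClosure R Q).subtype)
        Subtype.val_injective (IsLocalization.map_units Q ⟨r₀, hr₀'⟩).mem_nonZeroDivisors⟩)
    fun p hp => by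
      obtain ⟨g, hg, hgp⟩ := exists_isUnit_mem_ideal_iff_dvd hreg p hr₀' (hAp p hp hr₀A)
      obtain ⟨s, rfl⟩ := (hgp a).1 (hAp p hp ((haA a).2 dvd_rfl))
      have hs : IsUnit (s : Q) := (IsUnit.mul_iff.1 ha).2
      refine ⟨s, fun y => ?_, fun y hy => ?_⟩
      · rw [← hA, haA, hgp]
        constructor
        · rintro ⟨z, rfl⟩
          exact ⟨z, by ring⟩
        · rintro ⟨z, hz⟩
          exact ⟨z, hcancel hs (by rw [hz]; ring)⟩
      · obtain ⟨z, hz⟩ := (haA _).1 (hy g ((hgp g).2 dvd_rfl))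
        exact ⟨z, hcancel hg (by rw [mul_comm g y, hz, mul_assoc])⟩
  refine ⟨(LinearMap.ker φ).map (integralClosure R Q).val.toLinearMap, a, φ, ha, fun v hv => ?_,
    fun r hr => ?_, fun x => ?_, fun x hx => ?_, exists_eq_translate_of_nondegenerate hφ⟩
  · have key : ∀ x ∈ A, ∃ r, algebraMap R (integralClosure R Q) r = x := by
      intro x hx
      have hx : x ∈ (maximalIdeal R • ⊤ : Submodule R (integralClosure R Q)) := by
        rw [Ideal.smul_top_eq_map]
        exact hx
      have hle : (maximalIdeal R • ⊤ : Submodule R (integralClosure R Q)) ≤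
          LinearMap.range (Algebra.linearMap R _) := Submodule.smul_le.2 fun r hr y _ => by
        obtain ⟨s, hs⟩ := hmR r hr y y.2
        exact ⟨s, Subtype.ext (hs.trans (Algebra.smul_def r (y : Q)).symm)⟩
      exact hle hx
    have hav : a * ⟨v, hv⟩ ∈ A := (haA _).2 (dvd_mul_right _ _)
    obtain ⟨r, hr⟩ := key _ hav
    refine ⟨r, by_contra fun hrm => ?_, congrArg Subtype.val hr⟩
    have hunit : IsUnit r := not_not.1 fun h => hrm ((mem_maximalIdeal r).2 h)
    have : Nontrivial Q := ⟨⟨0, 1, fun h => one_ne_zero (α := R)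
      (IsFractionRing.injective R Q (by simpa using h.symm))⟩⟩
    obtain ⟨p, hp⟩ := Ideal.exists_maximal (integralClosure R Q)
    exact hp.ne_top (Ideal.eq_top_of_isUnit_mem _ (hAp p hp (hr ▸ hav)) (hunit.map _))
  · obtain ⟨v, hv⟩ := (haA _).1 (Ideal.mem_map_of_mem _ hr)
    exact ⟨v, v.2, congrArg Subtype.val hv⟩
  · rw [Submodule.mem_map]
    rfl
  · obtain ⟨v, hv⟩ := (haA x).1 (hφ x hx)
    exact ⟨v, v.2, congrArg Subtype.val hv⟩

end IntegralClosureDual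

section Torsion

open nonZeroDivisors

variable {R : Type*} [CommRing R] {Q : Type*} [CommRing Q] [Algebra R Q] [IsFractionRing R Q]

lemma isUnit_of_mem_nonZeroDivisors_fractionRing (R : Type*) [CommRing R] {Q : Type*} [CommRing Q]
    [Algebra R Q] [IsFractionRing R Q] {x : Q} (hx : x ∈ Q⁰) : IsUnit x := by
  obtain ⟨⟨r, s⟩, h⟩ := IsLocalization.surj R⁰ x
  have hr : r ∈ R⁰ := mem_nonZeroDivisors_of_injective (f := algebraMap R Q)
    (IsFractionRing.injective R Q)
    (h ▸ mul_mem hx (IsLocalization.map_units Q s).mem_nonZeroDivisors)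
  exact (IsUnit.mul_iff.1 (h ▸ IsLocalization.map_units Q ⟨r, hr⟩)).1

lemma exists_smul_eq_smul_of_isUnit {u : Q} (hu : IsUnit u) (x : Q) :
    ∃ s ∈ R⁰, ∃ r : R, s • x = r • u := by
  obtain ⟨y, rfl⟩ := hu.dvd (a := x)
  obtain ⟨⟨r, s⟩, h⟩ := IsLocalization.surj R⁰ y
  refine ⟨s, s.2, r, ?_⟩
  rw [Algebra.smul_def, Algebra.smul_def, ← h]
  ring

/-- Multiplication identifies `K : I` with `Hom(I, K)` when `I` is regular. -/
def colonSubEquivHom (K I : Submodule R Q) (hI : ∃ u ∈ I, IsUnit u) :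
    colonSub K I ≃ₗ[R] (I →ₗ[R] K) :=
  LinearEquiv.ofBijective
    (LinearMap.mk₂ R (fun (j : colonSub K I) (x : I) => (⟨j * x, j.2 x x.2⟩ : K))
      (fun _ _ _ => Subtype.ext (add_mul _ _ _)) (fun _ _ _ => Subtype.ext (smul_mul_assoc _ _ _))
      (fun _ _ _ => Subtype.ext (mul_add _ _ _)) (fun _ _ _ => Subtype.ext (mul_smul_comm _ _ _)))
    (by
      obtain ⟨u, hu, hu'⟩ := hI
      refine ⟨fun j j' e => Subtype.ext (hu'.mul_right_cancel
        (congrArg Subtype.val (LinearMap.congr_fun e ⟨u, hu⟩))), fun g => ?_⟩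
      obtain ⟨q, hq⟩ := hu'.dvd (a := (g ⟨u, hu⟩ : Q))
      have key (x : I) : q * x = g x := by
        obtain ⟨s, hs, r, e⟩ := exists_smul_eq_smul_of_isUnit (R := R) hu' (x : Q)
        have e' : s • x = r • (⟨u, hu⟩ : I) := Subtype.ext e
        have e' : s • (g x : Q) = r • (g ⟨u, hu⟩ : Q) :=
          congrArg Subtype.val ((g.map_smul s x).symm.trans
            ((congrArg g e').trans (g.map_smul r _)))
        refine (IsLocalization.map_units Q ⟨s, hs⟩).mul_left_cancel ?_
        rw [← Algebra.smul_def, ← Algebra.smul_def, e', hq, ← mul_smul_comm, e, mul_smul_comm,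
          mul_comm]
      exact ⟨⟨q, fun x hx => key ⟨x, hx⟩ ▸ (g ⟨x, hx⟩).2⟩, LinearMap.ext fun x =>
        Subtype.ext (key x)⟩)

lemma mulMap_injective_of_torsion_eq_bot {I J : Submodule R Q} (hI : ∃ u ∈ I, IsUnit u)
    (ht : Submodule.torsion R (I ⊗[R] J) = ⊥) : Function.Injective (I.mulMap J) := by
  obtain ⟨u, hu, hu'⟩ := hI
  have key (t : I ⊗[R] J) : ∃ s ∈ R⁰, ∃ j : J, s • t = (⟨u, hu⟩ : I) ⊗ₜ[R] j := by
    induction t with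
    | zero => exact ⟨1, one_mem _, 0, by simp⟩
    | tmul x j =>
      obtain ⟨s, hs, r, e⟩ := exists_smul_eq_smul_of_isUnit (R := R) hu' (x : Q)
      have e' : s • x = r • (⟨u, hu⟩ : I) := Subtype.ext e
      exact ⟨s, hs, r • j, by rw [TensorProduct.smul_tmul', e', TensorProduct.smul_tmul]⟩
    | add t t' ih ih' =>
      obtain ⟨s, hs, j, e⟩ := ih
      obtain ⟨s', hs', j', e'⟩ := ih'
      refine ⟨s * s', mul_mem hs hs', s' • j + s • j', ?_⟩
      rw [smul_add, mul_smul, mul_smul, e', smul_comm, e, TensorProduct.tmul_add,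
        TensorProduct.tmul_smul, TensorProduct.tmul_smul]
  refine (injective_iff_map_eq_zero _).2 fun t h0 => ?_
  obtain ⟨s, hs, j, e⟩ := key t
  have hj : j = 0 := by
    have := congrArg (I.mulMap J) e
    rw [map_smul, h0, smul_zero, Submodule.mulMap_tmul] at this
    exact Subtype.ext ((hu'.mul_right_eq_zero).1 this.symm)
  rw [← Submodule.mem_bot R, ← ht, Submodule.mem_torsion_iff]
  exact ⟨⟨s, hs⟩, e.trans (by rw [hj, TensorProduct.tmul_zero])⟩

lemma torsion_eq_bot_of_equiv {M N : Type*} [AddCommMonoid M] [Module R M] [AddCommMonoid N]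
    [Module R N] (e : M ≃ₗ[R] N) (h : Submodule.torsion R N = ⊥) : Submodule.torsion R M = ⊥ := by
  refine eq_bot_iff.2 fun x hx => ?_
  obtain ⟨s, hs⟩ := (Submodule.mem_torsion_iff x).1 hx
  have : e x ∈ Submodule.torsion R N := (Submodule.mem_torsion_iff _).2
    ⟨s, by rw [← e.map_zero, ← hs]; exact (e.map_smul (s : R) x).symm⟩
  rw [h, Submodule.mem_bot, e.map_eq_zero_iff] at this
  exact this

end Torsion

namespace IsResidueDual

open IsLocalRing

variable {R : Type*} [CommRing R] [IsLocalRing R] [IsNoetherianRing R] {Q : Type*} [CommRing Q]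
  [Algebra R Q] [IsFractionRing R Q] {V : Subalgebra R Q} [Module.Finite R V] {K : Submodule R Q}
  {a : Q} {φ : V →ₗ[R] R ⧸ maximalIdeal R}

theorem nonempty_equiv_of_torsion_eq_bot (h : IsResidueDual V K a φ)
    (hprinc : ∀ N : Submodule R Q, N.FG → (∃ u ∈ N, IsUnit u) → (∀ v ∈ V, ∀ x ∈ N, v * x ∈ N) →
      ∃ b, IsUnit b ∧ ∀ x, x ∈ N ↔ ∃ v ∈ V, b * v = x)
    {I : Submodule R Q} (hI : I.FG) (hu : ∃ u ∈ I, IsUnit u)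
    (ht : Submodule.torsion R (I ⊗[R] (I →ₗ[R] K)) = ⊥) :
    Nonempty (I ≃ₗ[R] R) ∨ Nonempty (I ≃ₗ[R] K) := by
  obtain ⟨u, hu, hu'⟩ := hu
  obtain ⟨b, hb, hbN⟩ := hprinc (I * Subalgebra.toSubmodule V)
    (hI.mul (Module.Finite.iff_fg.1 ‹Module.Finite R V›))
    ⟨u * 1, Submodule.mul_mem_mul hu ((Subalgebra.mem_toSubmodule V).2 (one_mem V)),
      by simpa using hu'⟩ fun v hv x hx => by
      refine Submodule.mul_induction_on hx (fun j hj w hw => ?_) fun x y hx hy => ?_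
      · rw [mul_left_comm]
        exact Submodule.mul_mem_mul hj (V.mul_mem hv hw)
      · rw [mul_add]
        exact add_mem hx hy
  let I' : Submodule R Q := I.comap (LinearMap.mulLeft R b)
  let e : I' ≃ₗ[R] I := LinearEquiv.ofBijective ((LinearMap.mulLeft R b).restrict fun x hx => hx)
    ⟨fun x y e => Subtype.ext (hb.mul_left_cancel (congrArg Subtype.val e)), fun ⟨x, hx⟩ => by
      obtain ⟨y, rfl⟩ := hb.dvd (a := x)
      exact ⟨⟨y, hx⟩, rfl⟩⟩
  have hu₁ : ∃ u ∈ I', IsUnit u := by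
    obtain ⟨y, rfl⟩ := hb.dvd (a := u)
    exact ⟨y, hu, (IsUnit.mul_iff.1 hu').2⟩
  have hIV : I' * Subalgebra.toSubmodule V = Subalgebra.toSubmodule V := by
    refine le_antisymm (Submodule.mul_le.2 fun x hx v hv => ?_) fun v hv => ?_
    · obtain ⟨w, hw, e⟩ := (hbN (b * x * v)).1 (Submodule.mul_mem_mul hx hv)
      rw [mul_assoc] at e
      exact hb.mul_left_cancel e ▸ hw
    · suffices ∀ y ∈ I * Subalgebra.toSubmodule V, ∀ w, y = b * w →
          w ∈ I' * Subalgebra.toSubmodule V from this _ ((hbN _).2 ⟨v, hv, rfl⟩) v rfl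
      intro y hy
      refine Submodule.mul_induction_on hy (fun i hi x hx w e => ?_) fun y z hy hz w e => ?_
      · obtain ⟨i, rfl⟩ := hb.dvd (a := i)
        rw [mul_assoc] at e
        exact hb.mul_left_cancel e ▸ Submodule.mul_mem_mul hi hx
      · obtain ⟨y, rfl⟩ := hb.dvd (a := y)
        obtain ⟨z, rfl⟩ := hb.dvd (a := z)
        rw [← mul_add] at e
        exact hb.mul_left_cancel e ▸ add_mem (hy y rfl) (hz z rfl)
  have ht' : Submodule.torsion R (I' ⊗[R] colonSub K I') = ⊥ :=
    torsion_eq_bot_of_equiv (TensorProduct.congr e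
      (colonSubEquivHom K I' hu₁ ≪≫ₗ LinearEquiv.arrowCongr e (LinearEquiv.refl R K))) ht
  exact (h.nonempty_equiv_or_nonempty_equiv (IsFractionRing.injective R Q) hprinc hu₁ hIV
    (mulMap_injective_of_torsion_eq_bot hu₁ ht')).imp
    (fun ⟨f⟩ => ⟨e.symm ≪≫ₗ f⟩) fun ⟨f⟩ => ⟨e.symm ≪≫ₗ f⟩

end IsResidueDual

/-- (Theorem 3.3) Let `R` be a one-dimensional Cohen–Macaulay local ring
whose integral closure `R̄` in `Q(R)` is finite over `R` and satisfies `m R̄ ⊆ R`.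
Then `R` has a canonical module `K` (a fractional ideal), and every faithful fractional
ideal `I` with `I ⊗_R Hom_R(I, K)` torsionfree satisfies `I ≅ R` or `I ≅ K`. -/
theorem stmt8 (R : Type u) [CommRing R] [IsLocalRing R]
    (hCM : IsOneDimCMLocal R)
    (hfin : (Subalgebra.toSubmodule (integralClosure R (FractionRing R))).FG)
    (hmR : ∀ x ∈ IsLocalRing.maximalIdeal R, ∀ y ∈ integralClosure R (FractionRing R),
      algebraMap R (FractionRing R) x * y ∈ Set.range (algebraMap R (FractionRing R))) :
    ∃ K : Submodule R (FractionRing R),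
      IsCanonicalModuleAt R (IsLocalRing.maximalIdeal R) ↥K ∧
      ∀ I : Submodule R (FractionRing R), I.FG → (∃ x ∈ I, x ∈ nonZeroDivisors (FractionRing R)) →
        Module.annihilator R ↥I = ⊥ →
        Submodule.torsion R (↥I ⊗[R] (↥I →ₗ[R] ↥K)) = ⊥ →
        Nonempty (↥I ≃ₗ[R] R) ∨ Nonempty (↥I ≃ₗ[R] ↥K) := by
  obtain ⟨_, hdim, hreg⟩ := hCM
  have : Ring.KrullDimLE 1 R := Ring.krullDimLE_iff.2 hdim.le
  have : Module.Finite R (integralClosure R (FractionRing R)) := Module.Finite.iff_fg.2 hfin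
  obtain ⟨K, a, φ, h⟩ := exists_isResidueDual_integralClosure hreg hmR
  refine ⟨K, h.isCanonicalModuleAt (IsFractionRing.injective R (FractionRing R)),
    fun I hI ⟨u, hu, hu'⟩ _ ht => ?_⟩
  exact h.nonempty_equiv_of_torsion_eq_bot (exists_isUnit_mem_iff_of_mul_mem hreg) hI
    ⟨u, hu, isUnit_of_mem_nonZeroDivisors_fractionRing R hu'⟩ ht

end
end

section
/- Let S be a regular local ring with maximal ideal n and n = dim S > 0, and let x_1, …, x_n be a regular system of parameters of S. For each 1 ≤ i ≤ n set p_i = (x_j : 1 ≤ j ≤ n, j ≠ i), and let R = S / ⋂_{i=1}^n p_i. Then R is a one-dimensional Cohen–Macaulay local ring with a canonical module K_R, and for every faithful ideal I of R: if I ⊗_R Hom_R(I, K_R) is torsionfree, then I ≅ R or I ≅ K_R as an R-module. -/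
open CategoryTheory TensorProduct

noncomputable section

section Resolution

variable {R : Type u} [CommRing R]

/-- The projective resolution given by an exact sequence of projective modules. -/
def resolutionOfExact (F : ℕ → ModuleCat.{u} R) (hF : ∀ i, Projective (F i))
    (d : ∀ i, F (i + 1) ⟶ F i) (hd : ∀ i, d (i + 1) ≫ d i = 0)
    (hex : ∀ i, (ShortComplex.mk _ _ (hd i)).Exact)
    {Z : ModuleCat.{u} R} (π : F 0 ⟶ Z) (h0 : d 0 ≫ π = 0)
    (he : (ShortComplex.mk _ _ h0).Exact) (hπ : Epi π) : ProjectiveResolution Z where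
  complex := ChainComplex.of F d hd
  projective := hF
  π := (ChainComplex.toSingle₀Equiv _ _).symm ⟨π, (congrArg (· ≫ π) (ChainComplex.of_d F d 0)).trans h0⟩
  quasiIso := ⟨fun n => by
    cases n with
    | zero =>
      rw [ChainComplex.quasiIsoAt₀_iff, ShortComplex.quasiIso_iff_of_zeros']
      · refine (ShortComplex.exact_and_epi_g_iff_of_iso ?_).2 ⟨he, hπ⟩
        exact ShortComplex.isoMk (Iso.refl _) (Iso.refl _) (Iso.refl _)
          ((Category.id_comp _).trans
            ((ChainComplex.of_d F d 0).symm.trans (Category.comp_id _).symm))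
          ((Category.id_comp _).trans (Category.comp_id _).symm)
      all_goals rfl
    | succ n =>
      rw [quasiIsoAt_iff_exactAt' _ _ (ChainComplex.exactAt_succ_single_obj _ _),
        HomologicalComplex.exactAt_iff' _ (n + 1 + 1) (n + 1) n (by simp) (by simp)]
      refine (ShortComplex.exact_iff_of_iso ?_).2 (hex n)
      exact ShortComplex.isoMk (Iso.refl _) (Iso.refl _) (Iso.refl _)
          ((Category.id_comp _).trans
            ((ChainComplex.of_d F d (n + 1)).symm.trans (Category.comp_id _).symm))
          ((Category.id_comp _).trans
            ((ChainComplex.of_d F d n).symm.trans (Category.comp_id _).symm))⟩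

theorem resolutionOfExact_d (F : ℕ → ModuleCat.{u} R) (hF : ∀ i, Projective (F i))
    (d : ∀ i, F (i + 1) ⟶ F i) (hd : ∀ i, d (i + 1) ≫ d i = 0)
    (hex : ∀ i, (ShortComplex.mk _ _ (hd i)).Exact)
    {Z : ModuleCat.{u} R} (π : F 0 ⟶ Z) (h0 : d 0 ≫ π = 0)
    (he : (ShortComplex.mk _ _ h0).Exact) (hπ : Epi π) (i : ℕ) :
    (resolutionOfExact F hF d hd hex π h0 he hπ).complex.d (i + 1) i = d i :=
  ChainComplex.of_d F d i

variable {Z : ModuleCat.{u} R} (P : ProjectiveResolution Z) (Y : ModuleCat.{u} R)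

theorem extMod_succ_subsingleton (i : ℕ)
    (h : ∀ f : P.complex.X (i + 1) ⟶ Y, P.complex.d (i + 2) (i + 1) ≫ f = 0 →
      ∃ g, P.complex.d (i + 1) i ≫ g = f) :
    Subsingleton (extMod R Z Y (i + 1)) := by
  refine ModuleCat.subsingleton_of_isZero ?_
  refine Limits.IsZero.of_iso ?_ (P.isoExt (i + 1) Y)
  rw [← HomologicalComplex.exactAt_iff_isZero_homology,
    HomologicalComplex.exactAt_iff' _ i (i + 1) (i + 2) (by simp) (by simp),
    ShortComplex.moduleCat_exact_iff]
  intro f hf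
  exact h f hf

theorem extMod_zero_subsingleton
    (h : ∀ f : P.complex.X 0 ⟶ Y, P.complex.d 1 0 ≫ f = 0 → f = 0) :
    Subsingleton (extMod R Z Y 0) := by
  refine ModuleCat.subsingleton_of_isZero ?_
  refine Limits.IsZero.of_iso ?_ (P.isoExt 0 Y)
  rw [← HomologicalComplex.exactAt_iff_isZero_homology,
    HomologicalComplex.exactAt_iff' _ 0 0 1 (by simp) (by simp),
    ShortComplex.moduleCat_exact_iff]
  intro f hf
  refine ⟨0, ?_⟩
  rw [map_zero]
  exact (h f hf).symm

theorem extMod_one_iso {N L : Type u} [AddCommGroup N] [Module R N] [AddCommGroup L] [Module R L]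
    (ψ : N →ₗ[R] (P.complex.X 1 ⟶ Y)) (θ : N →ₗ[R] L) (hθ : Function.Surjective θ)
    (h : ∀ f : P.complex.X 1 ⟶ Y, P.complex.d 2 1 ≫ f = 0 ↔ ∃ v, ψ v = f)
    (h' : ∀ v, θ v = 0 ↔ ∃ g, P.complex.d 1 0 ≫ g = ψ v) :
    Nonempty (extMod R Z Y 1 ≅ ModuleCat.of R L) := by
  let D := P.complex.linearYonedaObj R Y
  have e1 : extMod R Z Y 1 ≅ (D.sc' 0 1 2).homology :=
    P.isoExt 1 Y ≪≫ ShortComplex.homologyMapIso (D.isoSc' 0 1 2 (by simp) (by simp))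
  refine ⟨e1 ≪≫ (D.sc' 0 1 2).moduleCatHomologyIso ≪≫ ?_⟩
  let ψ' : N →ₗ[R] LinearMap.ker (D.sc' 0 1 2).g.hom :=
    LinearMap.codRestrict _ ψ (fun v => (h _).2 ⟨v, rfl⟩)
  have hψ' : Function.Surjective ψ' := by
    rintro ⟨f, hf⟩
    obtain ⟨v, hv⟩ := (h f).1 hf
    exact ⟨v, Subtype.ext hv⟩
  let q := (LinearMap.range (D.sc' 0 1 2).moduleCatToCycles).mkQ ∘ₗ ψ'
  have hq : Function.Surjective q := (Submodule.mkQ_surjective _).comp hψ'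
  have hk : LinearMap.ker q = LinearMap.ker θ := by
    ext v
    rw [LinearMap.mem_ker, LinearMap.mem_ker, h']
    simp only [q, LinearMap.comp_apply, Submodule.mkQ_apply, Submodule.Quotient.mk_eq_zero,
      LinearMap.mem_range]
    exact exists_congr fun g => Subtype.ext_iff
  exact LinearEquiv.toModuleIso ((q.quotKerEquivOfSurjective hq).symm ≪≫ₗ
    Submodule.quotEquivOfEq _ _ hk ≪≫ₗ θ.quotKerEquivOfSurjective hθ)

end Resolution

section Axes

/-- `R` embeds in `∏ V i`, every `V i` being a quotient of `R` and a discrete valuation ring with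
uniformizer the image of `x i` and residue field `k`, and the other `x j` vanish in `V i`. -/
structure IsAxisRing {R k : Type*} [CommRing R] [Field k] [Algebra R k] {n : ℕ}
    {V : Fin n → Type*} [∀ i, CommRing (V i)] [∀ i, Algebra R (V i)]
    (x : Fin n → R) (ρ : ∀ i, V i →ₐ[R] k) : Prop where
  surj : ∀ i, Function.Surjective (algebraMap R (V i))
  inj : ∀ r, (∀ i, algebraMap R (V i) r = 0) → r = 0
  off : ∀ i j, j ≠ i → algebraMap R (V i) (x j) = 0
  cancel : ∀ i (v : V i), x i • v = 0 → v = 0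
  res_surj : Function.Surjective (algebraMap R k)
  res_ker : ∀ i (v : V i), ρ i v = 0 ↔ ∃ w, v = x i • w
  isUnit : ∀ i (v : V i), ρ i v ≠ 0 → IsUnit v
  val : ∀ i (v : V i), v ≠ 0 → ∃ (m : ℕ) (w : V i), v = x i ^ m • w ∧ ρ i w ≠ 0

variable {R k : Type*} [CommRing R] [Field k] [Algebra R k] {n : ℕ}
    {V : Fin n → Type*} [∀ i, CommRing (V i)] [∀ i, Algebra R (V i)]
    {x : Fin n → R} {ρ : ∀ i, V i →ₐ[R] k}

/-- The coordinatewise residue map. -/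
def axisRes (ρ : ∀ i, V i →ₐ[R] k) : (∀ i, V i) →ₗ[R] (Fin n → k) :=
  LinearMap.pi fun i => (ρ i).toLinearMap ∘ₗ LinearMap.proj i

/-- The module of all tuples with residue in `W`. -/
def axisMod (ρ : ∀ i, V i →ₐ[R] k) (W : Submodule k (Fin n → k)) : Submodule R (∀ i, V i) :=
  (W.restrictScalars R).comap (axisRes ρ)

/-- The hyperplane of vectors with coordinate sum zero. -/
def sumZero (k : Type*) [Field k] (n : ℕ) : Submodule k (Fin n → k) :=
  LinearMap.ker (∑ i, LinearMap.proj i : (Fin n → k) →ₗ[k] k)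

@[simp] theorem axisRes_apply (a : ∀ i, V i) (i : Fin n) : axisRes ρ a i = ρ i (a i) := rfl

theorem mem_axisMod {W : Submodule k (Fin n → k)} {a : ∀ i, V i} :
    a ∈ axisMod ρ W ↔ (fun i => ρ i (a i)) ∈ W := Iff.rfl

@[simp] theorem mem_sumZero {w : Fin n → k} : w ∈ sumZero k n ↔ ∑ i, w i = 0 := by
  simp [sumZero]

namespace IsAxisRing

variable (h : IsAxisRing x ρ)
include h

theorem smul_off {i j : Fin n} (hij : j ≠ i) (v : V i) : x j • v = 0 := by
  rw [Algebra.smul_def, h.off i j hij, zero_mul]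

theorem res_smul_x (i j : Fin n) (v : V i) : ρ i (x j • v) = 0 := by
  by_cases hij : j = i
  · subst hij
    exact (h.res_ker _ _).2 ⟨v, rfl⟩
  · rw [h.smul_off hij, map_zero]

theorem res_x (j : Fin n) (i : Fin n) : algebraMap R k (x j) = 0 := by
  have := h.res_smul_x i j 1
  rwa [map_smul, map_one, Algebra.smul_def, mul_one] at this

theorem ext {r s : R} (hrs : ∀ i, algebraMap R (V i) r = algebraMap R (V i) s) : r = s :=
  sub_eq_zero.1 (h.inj _ fun i => by rw [map_sub, hrs, sub_self])

theorem x_mul_x {i j : Fin n} (hij : i ≠ j) : x i * x j = 0 := by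
  refine h.inj _ fun l => ?_
  by_cases hl : i = l
  · rw [map_mul, h.off l j (by rintro rfl; exact hij hl), mul_zero]
  · rw [map_mul, h.off l i hl, zero_mul]

theorem res_surjective (i : Fin n) : Function.Surjective (ρ i) := fun c => by
  obtain ⟨r, rfl⟩ := h.res_surj c
  exact ⟨algebraMap R _ r, (ρ i).commutes r⟩

theorem axisRes_surjective : Function.Surjective (axisRes ρ) := fun w => by
  choose v hv using fun i => h.res_surjective i (w i)
  exact ⟨v, funext hv⟩

theorem smul_x_eq_single (j : Fin n) (a : ∀ i, V i) : x j • a = Pi.single j (x j • a j) := by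
  funext i
  by_cases hij : i = j
  · subst hij; simp
  · rw [Pi.single_eq_of_ne hij]
    exact h.smul_off (Ne.symm hij) _

/-- An element of the maximal ideal vanishing on the axis `o` is a combination of the other
parameters. -/
theorem exists_eq_sum (o : Option (Fin n)) (r : R) (hr : algebraMap R k r = 0)
    (ho : ∀ j, o = some j → algebraMap R (V j) r = 0) :
    ∃ s : {l // o ≠ some l} → R, r = ∑ l, s l * x l.1 := by
  have key : ∀ i, ∃ s : R, algebraMap R (V i) r = algebraMap R (V i) (x i * s) := fun i => by
    obtain ⟨w, hw⟩ := (h.res_ker i (algebraMap R (V i) r)).1 (by rw [(ρ i).commutes, hr])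
    obtain ⟨s, rfl⟩ := h.surj i w
    exact ⟨s, by rw [hw, map_mul, Algebra.smul_def]⟩
  choose s hs using key
  refine ⟨fun l => s l.1, h.ext fun i => ?_⟩
  rw [map_sum]
  by_cases hi : o = some i
  · rw [ho i hi, Finset.sum_eq_zero]
    rintro ⟨l, hl⟩ -
    rw [map_mul, h.off i l (by rintro rfl; exact hl hi), mul_zero]
  · rw [Finset.sum_eq_single ⟨i, hi⟩]
    · rw [hs, mul_comm]
    · rintro ⟨l, hl⟩ - hne
      rw [map_mul, h.off i l (by rintro rfl; exact hne rfl), mul_zero]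
    · simp

/-- A tuple with all residues equal comes from `R`. -/
theorem exists_algebraMap_eq (a : ∀ i, V i) (c : k) (ha : ∀ i, ρ i (a i) = c) :
    ∃ r : R, ∀ i, algebraMap R (V i) r = a i := by
  obtain ⟨r, rfl⟩ := h.res_surj c
  have key : ∀ i, ∃ s : R, a i - algebraMap R (V i) r = algebraMap R (V i) (x i * s) := fun i => by
    obtain ⟨w, hw⟩ := (h.res_ker i (a i - algebraMap R (V i) r)).1
      (by rw [map_sub, (ρ i).commutes, ha, sub_self])
    obtain ⟨s, rfl⟩ := h.surj i w
    exact ⟨s, by rw [hw, map_mul, Algebra.smul_def]⟩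
  choose s hs using key
  refine ⟨r + ∑ l, x l * s l, fun i => ?_⟩
  rw [map_add, map_sum, Finset.sum_eq_single i]
  · rw [← hs]; ring
  · intro l _ hl
    rw [map_mul, h.off i l hl, zero_mul]
  · simp

theorem single_mem (j : Fin n) (v : V j) (W : Submodule k (Fin n → k)) :
    Pi.single j (x j • v) ∈ axisMod ρ W := by
  rw [mem_axisMod]
  convert! W.zero_mem using 1
  funext i
  by_cases hij : i = j
  · subst hij
    simpa using h.res_smul_x i i v
  · rw [Pi.single_eq_of_ne hij, map_zero]; rfl

theorem smul_mem (j : Fin n) (a : ∀ i, V i) (W : Submodule k (Fin n → k)) :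
    x j • a ∈ axisMod ρ W := by
  rw [h.smul_x_eq_single]
  exact h.single_mem _ _ _

/-- Elements of the canonical module supported on one axis. -/
theorem exists_eq_single {f : ∀ i, V i} (hf : f ∈ axisMod ρ (sumZero k n)) (j : Fin n)
    (hj : ∀ l, l ≠ j → x l • f = 0) : ∃ v : V j, f = Pi.single j (x j • v) := by
  have h0 : ∀ l, l ≠ j → f l = 0 := fun l hl => h.cancel l _ (congrFun (hj l hl) l)
  rw [mem_axisMod, mem_sumZero, Finset.sum_eq_single j (fun l _ hl => by rw [h0 l hl, map_zero])
    (by simp)] at hf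
  obtain ⟨v, hv⟩ := (h.res_ker j _).1 hf
  refine ⟨v, funext fun l => ?_⟩
  by_cases hl : l = j
  · subst hl; simpa using hv
  · rw [h0 l hl, Pi.single_eq_of_ne hl]

theorem eq_zero_of_smul {f : ∀ i, V i} (hf : ∀ l, x l • f = 0) : f = 0 :=
  funext fun l => h.cancel l _ (congrFun (hf l) l)

theorem exists_mem_extend (j : Fin n) (v : ∀ i, V i) :
    ∃ g ∈ axisMod ρ (sumZero k n), ∀ l, l ≠ j → g l = v l := by
  obtain ⟨w, hw⟩ := h.res_surjective j (-∑ l ∈ Finset.univ.erase j, ρ l (v l))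
  refine ⟨Function.update v j w, ?_, fun l hl => Function.update_of_ne hl _ _⟩
  rw [mem_axisMod, mem_sumZero, ← Finset.add_sum_erase _ _ (Finset.mem_univ j),
    Function.update_self, hw, neg_add_eq_zero]
  refine Finset.sum_congr rfl fun l hl => ?_
  rw [Function.update_of_ne (Finset.ne_of_mem_erase hl)]

end IsAxisRing

section Words

variable {A : Type} (f : A → Option (Fin n))

/-- Words obtained by appending to `a : A` a letter different from its last letter `f a`. -/
abbrev WordExt : Type := Σ a : A, {j : Fin n // f a ≠ some j}

/-- The last letter of an extended word. -/
abbrev WordExt.last (b : WordExt f) : Option (Fin n) := some b.2.1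

variable (x) in
/-- The differential `e_{wj} ↦ x_j e_w`. -/
def wordD : (WordExt f →₀ R) →ₗ[R] (A →₀ R) :=
  Finsupp.linearCombination R fun b => Finsupp.single b.1 (x b.2.1)

@[simp] theorem wordD_single (b : WordExt f) (r : R) :
    wordD x f (Finsupp.single b r) = Finsupp.single b.1 (r * x b.2.1) := by
  simp [wordD]

theorem comp_wordD_single {M : Type*} [AddCommGroup M] [Module R M] (φ : (A →₀ R) →ₗ[R] M)
    (b : WordExt f) :
    (φ ∘ₗ wordD x f) (Finsupp.single b 1) = x b.2.1 • φ (Finsupp.single b.1 1) := by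
  rw [LinearMap.comp_apply, wordD_single, one_mul, ← map_smul, Finsupp.smul_single, smul_eq_mul,
    mul_one]

namespace IsAxisRing

variable (h : IsAxisRing x ρ)
include h

theorem wordD_comp : wordD x f ∘ₗ wordD x (WordExt.last f) = 0 := by
  refine Finsupp.lhom_ext fun b r => ?_
  have : x b.2.1 * x b.1.2.1 = 0 := h.x_mul_x fun hb => b.2.2 (by rw [hb])
  rw [LinearMap.comp_apply, wordD_single, wordD_single, mul_assoc, this, mul_zero,
    Finsupp.single_zero, LinearMap.zero_apply]

theorem mem_range_wordD (u : A →₀ R) (h0 : ∀ a, algebraMap R k (u a) = 0)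
    (h1 : ∀ a j, f a = some j → algebraMap R (V j) (u a) = 0) : ∃ c, wordD x f c = u := by
  choose s hs using fun a => h.exists_eq_sum (f a) (u a) (h0 a) (h1 a)
  refine ⟨∑ a ∈ u.support, ∑ l, Finsupp.single ⟨a, l⟩ (s a l), ?_⟩
  simp only [map_sum, wordD_single, ← Finsupp.single_finsetSum, ← hs]
  exact u.sum_single

theorem wordD_apply_axis (c : WordExt f →₀ R) (b : WordExt f) :
    algebraMap R (V b.2.1) (wordD x f c b.1) = x b.2.1 • algebraMap R (V b.2.1) (c b) := by
  classical
  induction c using Finsupp.induction_linear with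
  | zero => simp
  | add c d hc hd => simp only [map_add, Finsupp.add_apply, hc, hd, smul_add]
  | single b' r =>
    rw [wordD_single]
    by_cases hb : b' = b
    · subst hb
      simp [Algebra.smul_def, mul_comm]
    · rw [Finsupp.single_eq_of_ne (Ne.symm hb), map_zero, smul_zero]
      obtain ⟨a, j⟩ := b
      obtain ⟨a', j'⟩ := b'
      by_cases ha : a' = a
      · subst ha
        have : j'.1 ≠ j.1 := fun h' => hb (by rw [Subtype.ext h'])
        simp [h.off _ _ this]
      · rw [Finsupp.single_eq_of_ne (Ne.symm ha), map_zero]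

theorem wordD_exact (c : WordExt f →₀ R) (hc : wordD x f c = 0) :
    ∃ e, wordD x (WordExt.last f) e = c := by
  have key : ∀ b, algebraMap R (V b.2.1) (c b) = 0 := fun b => by
    refine h.cancel _ _ ?_
    rw [← h.wordD_apply_axis f c b, hc, Finsupp.zero_apply, map_zero]
  refine h.mem_range_wordD _ c (fun b => ?_) (fun b j hj => ?_)
  · rw [← (ρ b.2.1).commutes, key, map_zero]
  · obtain rfl := Option.some_injective _ hj
    exact key b

theorem exists_axis_of_cocycle (φ : (WordExt f →₀ R) →ₗ[R] axisMod ρ (sumZero k n))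
    (hφ : φ ∘ₗ wordD x (WordExt.last f) = 0) (b : WordExt f) :
    ∃ v : V b.2.1, (φ (Finsupp.single b 1)).1 = Pi.single b.2.1 (x b.2.1 • v) := by
  refine h.exists_eq_single (φ _).2 _ fun l hl => ?_
  have := LinearMap.congr_fun hφ
    (Finsupp.single ⟨b, ⟨l, fun hb => hl (Option.some_injective _ hb).symm⟩⟩ 1)
  rw [comp_wordD_single] at this
  exact congrArg Subtype.val this

theorem exists_comp_wordD_eq (last : A → Fin n) (hf : ∀ a, f a = some (last a))
    (φ : (WordExt f →₀ R) →ₗ[R] axisMod ρ (sumZero k n))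
    (hφ : φ ∘ₗ wordD x (WordExt.last f) = 0) :
    ∃ g : (A →₀ R) →ₗ[R] axisMod ρ (sumZero k n), g ∘ₗ wordD x f = φ := by
  classical
  choose v hv using h.exists_axis_of_cocycle f φ hφ
  choose g hg hg' using fun a => h.exists_mem_extend (last a)
    (fun l => if hl : f a ≠ some l then v ⟨a, l, hl⟩ else 0)
  refine ⟨Finsupp.linearCombination R fun a => ⟨g a, hg a⟩, Finsupp.lhom_ext fun b r => ?_⟩
  rw [← mul_one r, ← smul_eq_mul, ← Finsupp.smul_single, map_smul, map_smul]
  congr 1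
  refine Subtype.ext ?_
  rw [hv, LinearMap.comp_apply, wordD_single, Finsupp.linearCombination_single, one_mul]
  refine (h.smul_x_eq_single _ _).trans ?_
  change Pi.single _ (x b.2.1 • g b.1 b.2.1) = _
  rw [hg' b.1 b.2.1 (fun hb => b.2.2 ((hf _).trans (congrArg some hb.symm))), dif_pos b.2.2]

end IsAxisRing

end Words

end Axes

section Canonical

/-- Words of length `i` in `Fin n` without equal adjacent letters, with their last letters. -/
def words (n : ℕ) : ℕ → Σ A : Type, (A → Option (Fin n))
  | 0 => ⟨Unit, fun _ => none⟩
  | i + 1 => ⟨WordExt (words n i).2, WordExt.last (words n i).2⟩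

namespace IsAxisRing

variable {R : Type u} {k : Type*} [CommRing R] [Field k] [Algebra R k] {n : ℕ}
    {V : Fin n → Type u} [∀ i, CommRing (V i)] [∀ i, Algebra R (V i)]
    {x : Fin n → R} {ρ : ∀ i, V i →ₐ[R] k} (h : IsAxisRing x ρ)
    {m : Ideal R} (hm : ∀ r, r ∈ m ↔ algebraMap R k r = 0)

variable (R n) in
/-- The free module on the words of length `i`. -/
abbrev wordsMod (i : ℕ) : ModuleCat.{u} R := ModuleCat.of R ((words n i).1 →₀ R)

variable (x) in
/-- The differential between the free modules on words. -/
def wordsD (i : ℕ) : wordsMod R n (i + 1) ⟶ wordsMod R n i :=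
  ModuleCat.ofHom (wordD x (words n i).2)

variable (m n) in
/-- The augmentation onto the residue field. -/
def wordsAug : wordsMod R n 0 ⟶ ModuleCat.of R (R ⧸ m) :=
  ModuleCat.ofHom (Finsupp.linearCombination R fun _ => (1 : R ⧸ m))

omit [Field k] [Algebra R k] in
theorem wordsAug_single (r : R) :
    (wordsAug n m).hom (Finsupp.single () r) = Ideal.Quotient.mk m r := by
  refine (Finsupp.linearCombination_single _ _ _).trans ?_
  rw [Algebra.smul_def, mul_one]
  rfl

/-- The free resolution of the residue field. -/
def resolution : ProjectiveResolution (ModuleCat.of R (R ⧸ m)) :=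
  resolutionOfExact (wordsMod R n) (fun i => inferInstance) (wordsD x)
    (fun i => ModuleCat.hom_ext (h.wordD_comp (words n i).2))
    (fun i => by
      rw [ShortComplex.moduleCat_exact_iff]
      exact fun c hc => h.wordD_exact (words n i).2 c hc)
    (wordsAug n m)
    (by
      refine ModuleCat.hom_ext (Finsupp.lhom_ext fun b r => ?_)
      refine (congrArg (wordsAug n m).hom (wordD_single (words n 0).2 b r)).trans ?_
      refine (wordsAug_single _).trans ?_
      exact Ideal.Quotient.eq_zero_iff_mem.2
        (Ideal.mul_mem_left _ _ ((hm _).2 (h.res_x _ b.2.1))))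
    (by
      rw [ShortComplex.moduleCat_exact_iff]
      intro u hu
      refine h.mem_range_wordD (words n 0).2 u (fun a => ?_) (fun a j hj => by cases hj)
      rw [← hm, ← Ideal.Quotient.eq_zero_iff_mem, ← hu, ← wordsAug_single (n := n)]
      exact congrArg (wordsAug n m).hom (Finsupp.unique_single (α := Unit) u).symm)
    (by
      rw [ModuleCat.epi_iff_surjective]
      intro y
      obtain ⟨r, rfl⟩ := Ideal.Quotient.mk_surjective y
      exact ⟨Finsupp.single () r, wordsAug_single r⟩)

theorem resolution_d (i : ℕ) : (h.resolution hm).complex.d (i + 1) i =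
    ModuleCat.ofHom (wordD x (words n i).2) :=
  resolutionOfExact_d ..

omit [Field k] [Algebra R k] in
theorem comp_eq_zero_iff {A B Y : ModuleCat.{u} R} {d : A ⟶ B} {d' : A →ₗ[R] B}
    (hd : d = ModuleCat.ofHom d') (φ : B ⟶ Y) : d ≫ φ = 0 ↔ φ.hom ∘ₗ d' = 0 := by
  subst hd
  exact ModuleCat.hom_ext_iff

/-- The cocycle `e_j ↦ x_j v_j` given by a tuple `v`. -/
def tupleCocycle : (∀ i, V i) →ₗ[R] ((words n 1).1 →₀ R) →ₗ[R] axisMod ρ (sumZero k n) :=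
  (Finsupp.llift (axisMod ρ (sumZero k n)) R R (words n 1).1).toLinearMap ∘ₗ
    LinearMap.pi fun b : (words n 1).1 =>
      LinearMap.codRestrict (axisMod ρ (sumZero k n)) (x b.2.1 • LinearMap.id)
        (fun v => h.smul_mem b.2.1 v _)

theorem tupleCocycle_single (v : ∀ i, V i) (b : (words n 1).1) :
    (h.tupleCocycle v (Finsupp.single b 1)).1 = x b.2.1 • v := by
  simp [tupleCocycle]

include h hm in
theorem isCanonicalModuleAt (hn : 0 < n) (hfin : Module.Finite R (axisMod ρ (sumZero k n))) :
    IsCanonicalModuleAt R m (axisMod ρ (sumZero k n)) := by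
  let Y := ModuleCat.of R (axisMod ρ (sumZero k n))
  let P := h.resolution hm
  have hd := h.resolution_d hm
  refine ⟨hfin, fun i hi => ?_, ?_⟩
  · match i with
    | 0 =>
      refine extMod_zero_subsingleton P Y fun f hf => ?_
      rw [comp_eq_zero_iff (hd 0)] at hf
      refine ModuleCat.hom_ext (Finsupp.lhom_ext' fun a => LinearMap.ext_ring (Subtype.ext ?_))
      refine h.eq_zero_of_smul fun l => ?_
      have := LinearMap.congr_fun hf
        (Finsupp.single (⟨a, l, fun hb => by cases hb⟩ : WordExt (words n 0).2) 1)
      exact congrArg Subtype.val ((comp_wordD_single (words n 0).2 f.hom _).symm.trans this)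
    | 1 => exact absurd rfl hi
    | i + 2 =>
      refine extMod_succ_subsingleton P Y (i + 1) fun f hf => ?_
      rw [comp_eq_zero_iff (hd (i + 2))] at hf
      obtain ⟨g, hg⟩ := h.exists_comp_wordD_eq (words n (i + 1)).2 (fun a => a.2.1)
        (fun a => rfl) f.hom hf
      refine ⟨ModuleCat.ofHom g, ?_⟩
      rw [hd]
      exact ModuleCat.hom_ext hg
  · let e : (R ⧸ m) ≃ₗ[R] k := Submodule.quotEquivOfEq _ _ (by ext r; exact hm r) ≪≫ₗ
      (Algebra.linearMap R k).quotKerEquivOfSurjective h.res_surj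
    let θ : (∀ i, V i) →ₗ[R] (R ⧸ m) := e.symm.toLinearMap ∘ₗ
      (∑ i, LinearMap.proj i : (Fin n → k) →ₗ[R] k) ∘ₗ axisRes ρ
    have hθ0 : ∀ v, θ v = 0 ↔ v ∈ axisMod ρ (sumZero k n) := fun v => by
      rw [LinearMap.comp_apply, LinearEquiv.coe_coe, LinearEquiv.map_eq_zero_iff, mem_axisMod,
        mem_sumZero]
      simp
    refine extMod_one_iso P Y
      ((ModuleCat.homLinearEquiv (S := R)).symm.toLinearMap ∘ₗ h.tupleCocycle) θ ?_ ?_ ?_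
    · intro y
      obtain ⟨v, hv⟩ := h.axisRes_surjective (Pi.single ⟨0, hn⟩ (e y))
      refine ⟨v, ?_⟩
      rw [LinearMap.comp_apply, LinearMap.comp_apply, hv]
      simp
    · intro f
      rw [comp_eq_zero_iff (hd 1)]
      constructor
      · intro hf
        choose v hv using h.exists_axis_of_cocycle (words n 0).2 f.hom hf
        refine ⟨fun i => v ⟨(), i, fun hb => by cases hb⟩, ModuleCat.hom_ext ?_⟩
        refine Finsupp.lhom_ext' fun b => LinearMap.ext_ring (Subtype.ext ?_)
        refine (h.tupleCocycle_single _ b).trans ?_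
        rw [h.smul_x_eq_single]
        exact (hv b).symm
      · rintro ⟨v, rfl⟩
        refine Finsupp.lhom_ext' fun b => LinearMap.ext_ring (Subtype.ext ?_)
        have : x b.2.1 * x b.1.2.1 = 0 := h.x_mul_x fun hb => b.2.2 (congrArg some hb.symm)
        refine (congrArg Subtype.val (comp_wordD_single (words n 1).2 (h.tupleCocycle v) b)).trans ?_
        rw [Submodule.coe_smul, tupleCocycle_single, smul_smul, this, zero_smul]
        rfl
    · intro v
      rw [hθ0, hd]
      constructor
      · intro hv
        let g : ((words n 0).1 →₀ R) →ₗ[R] axisMod ρ (sumZero k n) :=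
          Finsupp.linearCombination R fun _ => ⟨v, hv⟩
        refine ⟨ModuleCat.ofHom g, ModuleCat.hom_ext ?_⟩
        refine Finsupp.lhom_ext' fun b => LinearMap.ext_ring (Subtype.ext ?_)
        refine Eq.trans ?_ (h.tupleCocycle_single _ b).symm
        refine (congrArg Subtype.val (comp_wordD_single (words n 0).2 g b)).trans ?_
        rw [Finsupp.linearCombination_single, one_smul]
        rfl
      · rintro ⟨g, hg⟩
        have hv : (g.hom (Finsupp.single () 1)).1 = v := by
          rw [← sub_eq_zero]
          refine h.eq_zero_of_smul fun l => ?_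
          have h1 := congrArg Subtype.val (LinearMap.congr_fun (congrArg ModuleCat.Hom.hom hg)
            (Finsupp.single (⟨(), l, fun hb => by cases hb⟩ : WordExt (words n 0).2) 1))
          rw [smul_sub, sub_eq_zero]
          exact ((congrArg Subtype.val (comp_wordD_single (words n 0).2 g.hom _)).symm.trans
            h1).trans (h.tupleCocycle_single _ _)
        rw [← hv]
        exact (g.hom _).2

end IsAxisRing
end Canonical

section Perp

variable {k : Type*} [Field k] {n : ℕ}

/-- The orthogonal complement with respect to the dot product. -/
def perp (W : Submodule k (Fin n → k)) : Submodule k (Fin n → k) :=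
  W.dualAnnihilator.comap (dotProductEquiv k (Fin n)).toLinearMap

theorem mem_perp {W : Submodule k (Fin n → k)} {w' : Fin n → k} :
    w' ∈ perp W ↔ ∀ w ∈ W, ∑ i, w i * w' i = 0 := by
  simp only [perp, Submodule.mem_comap, Submodule.mem_dualAnnihilator, LinearEquiv.coe_coe,
    dotProductEquiv_apply_apply, dotProduct, mul_comm]

theorem finrank_add_finrank_perp (W : Submodule k (Fin n → k)) :
    Module.finrank k W + Module.finrank k (perp W) = n := by
  have h1 := Subspace.finrank_add_finrank_dualAnnihilator_eq W
  have h2 : Module.finrank k (perp W) = Module.finrank k W.dualAnnihilator :=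
    (LinearEquiv.ofSubmodule' (dotProductEquiv k (Fin n)) W.dualAnnihilator).finrank_eq
  rw [h2, h1, Module.finrank_fin_fun]

theorem perp_perp (W : Submodule k (Fin n → k)) : perp (perp W) = W := by
  refine (Submodule.eq_of_le_of_finrank_eq (fun w hw => mem_perp.2 fun w' hw' => ?_) ?_).symm
  · simpa only [mul_comm] using mem_perp.1 hw' w hw
  · have h1 := finrank_add_finrank_perp W
    have h2 := finrank_add_finrank_perp (perp W)
    omega

theorem exists_eq_smul_of_finrank_eq_one {W : Submodule k (Fin n → k)}
    (hW : Module.finrank k W = 1) :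
    ∃ w ∈ W, ∀ v, v ∈ W ↔ ∃ c : k, c • w = v := by
  obtain ⟨w, -, hw⟩ := finrank_eq_one_iff'.1 hW
  refine ⟨w, w.2, fun v => ⟨fun hv => ?_, ?_⟩⟩
  · obtain ⟨c, hc⟩ := hw ⟨v, hv⟩
    exact ⟨c, congrArg Subtype.val hc⟩
  · rintro ⟨c, rfl⟩
    exact W.smul_mem c w.2

end Perp

section AxisModules

variable {R k : Type*} [CommRing R] [Field k] [Algebra R k] {n : ℕ}
    {V : Fin n → Type*} [∀ i, CommRing (V i)] [∀ i, Algebra R (V i)]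
    {x : Fin n → R} {ρ : ∀ i, V i →ₐ[R] k}

variable (ρ) in
/-- The product map on the tensor product of two modules of tuples. -/
def axisMul (W W' : Submodule k (Fin n → k)) :
    axisMod ρ W ⊗[R] axisMod ρ W' →ₗ[R] (∀ i, V i) :=
  TensorProduct.lift ((LinearMap.mul R (∀ i, V i)).compl₁₂ (axisMod ρ W).subtype
    (axisMod ρ W').subtype)

@[simp] theorem axisMul_tmul {W W' : Submodule k (Fin n → k)} (a : axisMod ρ W)
    (b : axisMod ρ W') : axisMul ρ W W' (a ⊗ₜ b) = a.1 * b.1 := rfl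

/-- The coordinatewise product map on the tensor product of two spaces of vectors. -/
def vecMul (W W' : Submodule k (Fin n → k)) : W ⊗[k] W' →ₗ[k] (Fin n → k) :=
  TensorProduct.lift ((LinearMap.mul k (Fin n → k)).compl₁₂ W.subtype W'.subtype)

@[simp] theorem vecMul_tmul {W W' : Submodule k (Fin n → k)} (w : W) (w' : W') :
    vecMul W W' (w ⊗ₜ w') = w.1 * w'.1 := rfl

/-- The residue map of a module of tuples. -/
def axisModRes (W : Submodule k (Fin n → k)) : axisMod ρ W →ₗ[R] W :=
  (axisRes ρ ∘ₗ (axisMod ρ W).subtype).codRestrict (W.restrictScalars R) fun a => a.2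

@[simp] theorem coe_axisModRes (W : Submodule k (Fin n → k)) (a : axisMod ρ W) (i : Fin n) :
    (axisModRes W a).1 i = ρ i (a.1 i) := rfl

variable (ρ) in
/-- The residue map on tensor products. -/
def axisTensorRes (W W' : Submodule k (Fin n → k)) :
    axisMod ρ W ⊗[R] axisMod ρ W' →ₗ[R] W ⊗[k] W' :=
  TensorProduct.lift (LinearMap.mk₂ R (fun a b => axisModRes W a ⊗ₜ[k] axisModRes W' b)
    (fun a b c => by rw [map_add, TensorProduct.add_tmul])
    (fun r a b => by rw [map_smul, TensorProduct.smul_tmul'])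
    (fun a b c => by rw [map_add, TensorProduct.tmul_add])
    (fun r a b => by rw [map_smul, TensorProduct.tmul_smul]))

@[simp] theorem axisTensorRes_tmul {W W' : Submodule k (Fin n → k)} (a : axisMod ρ W)
    (b : axisMod ρ W') :
    axisTensorRes ρ W W' (a ⊗ₜ b) = axisModRes W a ⊗ₜ axisModRes W' b := rfl

theorem vecMul_axisTensorRes {W W' : Submodule k (Fin n → k)}
    (t : axisMod ρ W ⊗[R] axisMod ρ W') (i : Fin n) :
    vecMul W W' (axisTensorRes ρ W W' t) i = ρ i (axisMul ρ W W' t i) := by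
  induction t using TensorProduct.induction_on with
  | zero => simp
  | tmul a b => simp
  | add s t hs ht => simp only [map_add, Pi.add_apply, hs, ht]

namespace IsAxisRing

variable (h : IsAxisRing x ρ)
include h

theorem cancel_pow {i : Fin n} (m : ℕ) {v : V i} (hv : x i ^ m • v = 0) : v = 0 := by
  induction m with
  | zero => simpa using hv
  | succ m ih =>
    rw [pow_succ', mul_smul] at hv
    exact ih (h.cancel i _ hv)

theorem cancel_eq {i : Fin n} {v w : V i} (hvw : x i • v = x i • w) : v = w :=
  sub_eq_zero.1 (h.cancel i _ (by rw [smul_sub, hvw, sub_self]))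

theorem x_ne_zero (i : Fin n) : x i ≠ 0 := fun h0 => by
  have := h.cancel i 1 (by rw [h0, zero_smul])
  simpa using congrArg (ρ i) this

theorem exists_sum_single {a : ∀ i, V i} (ha : ∀ i, ρ i (a i) = 0) :
    ∃ v : ∀ i, V i, a = ∑ i, Pi.single i (x i • v i) := by
  choose v hv using fun i => (h.res_ker i (a i)).1 (ha i)
  exact ⟨v, by simp_rw [← hv, Finset.univ_sum_single]⟩

/-- A module of tuples containing `∏ x i V i` is determined by its residues. -/
theorem exists_eq_axisMod (M : Submodule R (∀ i, V i))
    (hM : ∀ j (v : V j), Pi.single j (x j • v) ∈ M) :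
    ∃ W : Submodule k (Fin n → k), M = axisMod ρ W := by
  let W : Submodule k (Fin n → k) :=
    { carrier := {w | ∃ a ∈ M, axisRes ρ a = w}
      zero_mem' := ⟨0, M.zero_mem, map_zero _⟩
      add_mem' := by
        rintro _ _ ⟨a, ha, rfl⟩ ⟨b, hb, rfl⟩
        exact ⟨a + b, M.add_mem ha hb, map_add _ _ _⟩
      smul_mem' := by
        rintro c _ ⟨a, ha, rfl⟩
        obtain ⟨r, rfl⟩ := h.res_surj c
        exact ⟨r • a, M.smul_mem r ha, by rw [map_smul, algebraMap_smul]⟩ }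
  refine ⟨W, le_antisymm (fun a ha => ⟨a, ha, rfl⟩) ?_⟩
  rintro a ⟨b, hb, hab⟩
  obtain ⟨v, hv⟩ := h.exists_sum_single (a := a - b) fun i => by
    have := congrFun hab i
    rw [axisRes_apply] at this
    rw [Pi.sub_apply, map_sub, this]
    exact sub_self _
  rw [← sub_add_cancel a b, hv]
  exact M.add_mem (M.sum_mem fun i _ => hM _ _) hb

/-- Faithful ideals are isomorphic to modules of tuples with prescribed residues. -/
theorem exists_equiv_axisMod (I : Ideal R) (hI : Module.annihilator R I = ⊥) :
    ∃ W : Submodule k (Fin n → k), (∀ i, ∃ w ∈ W, w i ≠ 0) ∧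
      Nonempty (I ≃ₗ[R] axisMod ρ W) := by
  classical
  have hne : ∀ i, ∃ m, ∃ a ∈ I, ∃ w : V i,
      algebraMap R (V i) a = x i ^ m • w ∧ ρ i w ≠ 0 := fun i => by
    by_contra! hcon
    refine h.x_ne_zero i ?_
    rw [← Submodule.mem_bot R, ← hI, Module.mem_annihilator]
    refine fun a => Subtype.ext (h.inj _ fun j => ?_)
    rw [Submodule.coe_smul, smul_eq_mul, map_mul]
    by_cases hj : i = j
    · subst hj
      by_cases ha : algebraMap R (V i) a = 0
      · rw [ha, mul_zero]
      · obtain ⟨m, w, hw, hw'⟩ := h.val i _ ha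
        exact absurd (hcon m a a.2 w hw) hw'
    · rw [h.off j i hj, zero_mul]
  have hdiv : ∀ (a : I) i, ∃ w : V i, algebraMap R (V i) a = x i ^ Nat.find (hne i) • w :=
    fun a i => by
      by_cases ha : algebraMap R (V i) a = 0
      · exact ⟨0, by rw [ha, smul_zero]⟩
      · obtain ⟨m, w, hw, hw'⟩ := h.val i _ ha
        refine ⟨x i ^ (m - Nat.find (hne i)) • w, ?_⟩
        rw [smul_smul, ← pow_add, Nat.add_sub_cancel' (Nat.find_min' _ ⟨a, a.2, w, hw, hw'⟩), hw]
  choose g hg using hdiv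
  have huniq : ∀ (a : I) i (w : V i),
      algebraMap R (V i) a = x i ^ Nat.find (hne i) • w → g a i = w := fun a i w hw =>
    sub_eq_zero.1 (h.cancel_pow _ (by rw [smul_sub, ← hg, hw, sub_self]))
  let G : I →ₗ[R] (∀ i, V i) :=
    { toFun := g
      map_add' := fun a b => funext fun i => huniq _ _ _ (by
        rw [Pi.add_apply, smul_add, ← hg, ← hg, Submodule.coe_add, map_add])
      map_smul' := fun r a => funext fun i => huniq _ _ _ (by
        rw [Pi.smul_apply, smul_comm, RingHom.id_apply, ← hg, Submodule.coe_smul, smul_eq_mul,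
          map_mul, Algebra.smul_def]) }
  have hG : Function.Injective G := fun a b hab => Subtype.ext (h.ext fun i => by
    rw [hg, hg]
    exact congrArg _ (congrFun hab i))
  have hunit : ∀ i, ∃ a, ρ i (G a i) ≠ 0 := fun i => by
    obtain ⟨a, ha, w, hw, hw'⟩ := Nat.find_spec (hne i)
    refine ⟨⟨a, ha⟩, ?_⟩
    change ρ i (g _ i) ≠ 0
    rwa [huniq ⟨a, ha⟩ i w hw]
  obtain ⟨W, hW⟩ := h.exists_eq_axisMod (LinearMap.range G) fun j v => by
    obtain ⟨a, ha⟩ := hunit j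
    obtain ⟨u, hu⟩ := (h.isUnit j _ ha).exists_right_inv
    obtain ⟨r, hr⟩ := h.surj j (u * v)
    refine ⟨(x j * r) • a, ?_⟩
    rw [map_smul, mul_smul, h.smul_x_eq_single, Pi.smul_apply, Algebra.smul_def r, hr, mul_comm,
      ← mul_assoc, hu, one_mul]
  refine ⟨W, fun i => ?_, ⟨(LinearEquiv.ofInjective G hG).trans (LinearEquiv.ofEq _ _ hW)⟩⟩
  obtain ⟨a, ha⟩ := hunit i
  exact ⟨axisRes ρ (G a), mem_axisMod.1 (hW ▸ LinearMap.mem_range_self G a), ha⟩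

/-- The homomorphisms into the canonical module. -/
theorem exists_dual_equiv (W : Submodule k (Fin n → k)) :
    Nonempty (axisMod ρ (perp W) ≃ₗ[R] (axisMod ρ W →ₗ[R] axisMod ρ (sumZero k n))) := by
  have hmem : ∀ (b : axisMod ρ (perp W)) (a : axisMod ρ W),
      b.1 * a.1 ∈ axisMod ρ (sumZero k n) := fun b a => by
    rw [mem_axisMod, mem_sumZero]
    simpa only [Pi.mul_apply, map_mul, mul_comm, axisRes_apply] using mem_perp.1 b.2 _ a.2
  let Φ : axisMod ρ (perp W) →ₗ[R] (axisMod ρ W →ₗ[R] axisMod ρ (sumZero k n)) :=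
    LinearMap.mk₂ R (fun b a => ⟨b.1 * a.1, hmem b a⟩)
      (fun b c a => Subtype.ext (add_mul _ _ _))
      (fun r b a => Subtype.ext (smul_mul_assoc _ _ _))
      (fun b a c => Subtype.ext (mul_add _ _ _))
      (fun r b a => Subtype.ext (mul_smul_comm _ _ _))
  refine ⟨LinearEquiv.ofBijective Φ ⟨?_, fun f => ?_⟩⟩
  · refine (injective_iff_map_eq_zero Φ).2 fun b hb => Subtype.ext (funext fun i => ?_)
    have := congrFun (congrArg Subtype.val (LinearMap.congr_fun hb
      ⟨Pi.single i (x i • 1), h.single_mem i 1 W⟩)) i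
    have h' : b.1 i * (Pi.single i (x i • 1) : ∀ i, V i) i = 0 := this
    rw [Pi.single_eq_same, mul_smul_comm, mul_one] at h'
    exact h.cancel i _ h'
  · have key : ∀ i, ∃ v : V i, (f ⟨Pi.single i (x i • 1), h.single_mem i 1 W⟩).1 =
        Pi.single i (x i • v) := fun i => by
      refine h.exists_eq_single (f _).2 i fun l hl => ?_
      rw [← Submodule.coe_smul, ← map_smul]
      have : x l • (⟨Pi.single i (x i • 1), h.single_mem i 1 W⟩ : axisMod ρ W) = 0 :=
        Subtype.ext (by
          rw [Submodule.coe_smul, ← Pi.single_smul, h.smul_off hl, Pi.single_zero]; rfl)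
      rw [this, map_zero]; rfl
    choose v hv using key
    have hf : ∀ a i, (f a).1 i = v i * a.1 i := fun a i => by
      obtain ⟨r, hr⟩ := h.surj i (a.1 i)
      have : x i • a = r • (⟨Pi.single i (x i • 1), h.single_mem i 1 W⟩ : axisMod ρ W) :=
        Subtype.ext (by
          rw [Submodule.coe_smul, Submodule.coe_smul, h.smul_x_eq_single, ← Pi.single_smul,
            smul_comm, Algebra.smul_def r, mul_one, hr])
      have h2 := congrFun (congrArg Subtype.val (congrArg f this)) i
      rw [map_smul, map_smul, Submodule.coe_smul, Submodule.coe_smul, hv, ← Pi.single_smul,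
        Pi.single_eq_same, smul_comm] at h2
      rw [show (f a).1 i = r • v i from h.cancel_eq h2, Algebra.smul_def, hr, mul_comm]
    refine ⟨⟨v, mem_perp.2 fun w hw => ?_⟩, LinearMap.ext fun a => Subtype.ext (funext fun i =>
      (hf a i).symm)⟩
    obtain ⟨a, ha⟩ := h.axisRes_surjective w
    have ha' : a ∈ axisMod ρ W := by
      change axisRes ρ a ∈ W
      rwa [ha]
    have h3 := mem_sumZero.1 (mem_axisMod.1 (f ⟨a, ha'⟩).2)
    simp only [hf, map_mul] at h3
    simpa only [← ha, mul_comm, axisRes_apply] using h3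

end IsAxisRing

end AxisModules

section AxisTensor

variable {R k : Type*} [CommRing R] [Field k] [Algebra R k] {n : ℕ}
    {V : Fin n → Type*} [∀ i, CommRing (V i)] [∀ i, Algebra R (V i)]
    {x : Fin n → R} {ρ : ∀ i, V i →ₐ[R] k}

namespace IsAxisRing

variable (h : IsAxisRing x ρ)
include h

theorem sum_sq_mem_nonZeroDivisors : ∑ i, x i ^ 2 ∈ nonZeroDivisors R := by
  refine mem_nonZeroDivisors_iff_right.2 fun r hr => h.inj r fun i => ?_
  have hs : algebraMap R (V i) (∑ j, x j ^ 2) = algebraMap R (V i) (x i ^ 2) := by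
    rw [map_sum]
    refine Finset.sum_eq_single i (fun j _ hj => ?_) (by simp)
    rw [map_pow, h.off i j hj, zero_pow two_ne_zero]
  refine h.cancel_pow 2 ?_
  rw [Algebra.smul_def, ← hs, ← map_mul, mul_comm, hr, map_zero]

theorem exists_sq_smul {W W' : Submodule k (Fin n → k)} (i : Fin n)
    (t : axisMod ρ W ⊗[R] axisMod ρ W') :
    ∃ r : R, algebraMap R (V i) r = axisMul ρ W W' t i ∧ x i ^ 2 • t =
      r • ((⟨Pi.single i (x i • 1), h.single_mem i 1 W⟩ : axisMod ρ W) ⊗ₜ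
        (⟨Pi.single i (x i • 1), h.single_mem i 1 W'⟩ : axisMod ρ W')) := by
  have key : ∀ (U : Submodule k (Fin n → k)) (a : axisMod ρ U) (r : R),
      algebraMap R (V i) r = a.1 i →
      x i • a = r • (⟨Pi.single i (x i • 1), h.single_mem i 1 U⟩ : axisMod ρ U) :=
    fun U a r hr => Subtype.ext (by
      rw [Submodule.coe_smul, Submodule.coe_smul, h.smul_x_eq_single, ← Pi.single_smul,
        smul_comm, Algebra.smul_def r, mul_one, hr])
  induction t using TensorProduct.induction_on with
  | zero => exact ⟨0, by simp, by simp⟩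
  | tmul a b =>
    obtain ⟨r, hr⟩ := h.surj i (a.1 i)
    obtain ⟨s, hs⟩ := h.surj i (b.1 i)
    refine ⟨r * s, by rw [map_mul, hr, hs]; rfl, ?_⟩
    rw [pow_two, mul_smul, ← TensorProduct.tmul_smul, TensorProduct.smul_tmul', key W a r hr,
      key W' b s hs, TensorProduct.tmul_smul, ← TensorProduct.smul_tmul', smul_smul, mul_comm s]
  | add t t' ht ht' =>
    obtain ⟨r, hr, hr'⟩ := ht
    obtain ⟨s, hs, hs'⟩ := ht'
    exact ⟨r + s, by rw [map_add, hr, hs, map_add]; rfl, by rw [smul_add, hr', hs', add_smul]⟩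

/-- Tensors with vanishing product are torsion. -/
theorem sum_sq_smul_eq_zero {W W' : Submodule k (Fin n → k)}
    {t : axisMod ρ W ⊗[R] axisMod ρ W'} (ht : axisMul ρ W W' t = 0) :
    (∑ i, x i ^ 2) • t = 0 := by
  rw [Finset.sum_smul]
  refine Finset.sum_eq_zero fun i _ => ?_
  obtain ⟨r, hr, hr'⟩ := h.exists_sq_smul i t
  have : r • (⟨Pi.single i (x i • 1), h.single_mem i 1 W⟩ : axisMod ρ W) = 0 :=
    Subtype.ext (by
      rw [Submodule.coe_smul, ← Pi.single_smul, Algebra.smul_def, hr, ht, Pi.zero_apply, zero_mul,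
        Pi.single_zero]; rfl)
  rw [hr', TensorProduct.smul_tmul', this, TensorProduct.zero_tmul]

/-- A tensor product of modules of tuples that embeds by the product map does so modulo the
parameters. -/
theorem vecMul_injective {W W' : Submodule k (Fin n → k)} (hW : ∀ i, ∃ w ∈ W, w i ≠ 0)
    (hW' : ∀ i, ∃ w ∈ W', w i ≠ 0) (hinj : ∀ t, axisMul ρ W W' t = 0 → t = 0) :
    Function.Injective (vecMul W W') := by
  have hlift : ∀ (U : Submodule k (Fin n → k)) (w : Fin n → k), w ∈ U →
      ∃ a : axisMod ρ U, axisRes ρ a.1 = w := fun U w hw => by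
    obtain ⟨a, rfl⟩ := h.axisRes_surjective w
    exact ⟨⟨a, hw⟩, rfl⟩
  have hsurj : ∀ θ, ∃ t, axisTensorRes ρ W W' t = θ := fun θ => by
    induction θ using TensorProduct.induction_on with
    | zero => exact ⟨0, map_zero _⟩
    | tmul w w' =>
      obtain ⟨a, ha⟩ := hlift W w w.2
      obtain ⟨b, hb⟩ := hlift W' w' w'.2
      refine ⟨a ⊗ₜ b, ?_⟩
      rw [axisTensorRes_tmul, show axisModRes W a = w from Subtype.ext ha,
        show axisModRes W' b = w' from Subtype.ext hb]
    | add θ θ' hθ hθ' =>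
      obtain ⟨t, rfl⟩ := hθ
      obtain ⟨t', rfl⟩ := hθ'
      exact ⟨t + t', map_add _ _ _⟩
  have hunit : ∀ (U : Submodule k (Fin n → k)), (∀ i, ∃ w ∈ U, w i ≠ 0) → ∀ i,
      ∃ a : axisMod ρ U, IsUnit (a.1 i) := fun U hU i => by
    obtain ⟨w, hw, hwi⟩ := hU i
    obtain ⟨a, rfl⟩ := hlift U w hw
    exact ⟨a, h.isUnit i _ hwi⟩
  choose c hc using hunit W hW
  choose d hd using hunit W' hW'
  refine (injective_iff_map_eq_zero _).2 fun θ hθ => ?_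
  obtain ⟨t, rfl⟩ := hsurj θ
  obtain ⟨v, hv⟩ := h.exists_sum_single (a := axisMul ρ W W' t) fun i => by
    rw [← vecMul_axisTensorRes, hθ, Pi.zero_apply]
  have hs : ∀ i, ∃ s : R, s • (c i * d i : ∀ i, V i) i = v i := fun i => by
    obtain ⟨u, hu⟩ := ((hc i).mul (hd i)).exists_right_inv
    obtain ⟨s, hs⟩ := h.surj i (v i * u)
    refine ⟨s, ?_⟩
    rw [Algebra.smul_def, hs, Pi.mul_apply, mul_assoc, mul_comm u, hu, mul_one]
  choose s hs using hs
  have h0 : t - ∑ i, x i • s i • (c i ⊗ₜ d i) = 0 := hinj _ (by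
    rw [map_sub, hv, map_sum, sub_eq_zero]
    refine Finset.sum_congr rfl fun i _ => ?_
    rw [map_smul, map_smul, axisMul_tmul, h.smul_x_eq_single, Pi.smul_apply, hs])
  rw [sub_eq_zero.1 h0, map_sum]
  refine Finset.sum_eq_zero fun i _ => ?_
  rw [map_smul, ← algebraMap_smul k (x i), h.res_x i i, zero_smul]

/-- Modules of tuples whose residue space is a line are free. -/
theorem equiv_of_finrank_eq_one {W : Submodule k (Fin n → k)} (hW : ∀ i, ∃ w ∈ W, w i ≠ 0)
    (h1 : Module.finrank k W = 1) : Nonempty (axisMod ρ W ≃ₗ[R] R) := by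
  obtain ⟨w, hw, hspan⟩ := exists_eq_smul_of_finrank_eq_one h1
  have hwi : ∀ i, w i ≠ 0 := fun i hi => by
    obtain ⟨v, hv, hvi⟩ := hW i
    obtain ⟨c, rfl⟩ := (hspan v).1 hv
    exact hvi (by rw [Pi.smul_apply, hi, smul_zero])
  obtain ⟨t, rfl⟩ := h.axisRes_surjective w
  choose u hu using fun i => (h.isUnit i (t i) (hwi i)).exists_right_inv
  have ht : t ∈ axisMod ρ W := hw
  refine ⟨(LinearEquiv.ofBijective (LinearMap.toSpanSingleton R (axisMod ρ W) ⟨t, ht⟩)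
    ⟨(injective_iff_map_eq_zero _).2 fun r hr => h.inj r fun i => ?_, fun a => ?_⟩).symm⟩
  · have := congrFun (congrArg Subtype.val hr) i
    have h' : r • t i = 0 := this
    rw [Algebra.smul_def] at h'
    rw [← mul_one (algebraMap R (V i) r), ← hu, ← mul_assoc, h', zero_mul]
  · obtain ⟨c, hc⟩ := (hspan _).1 a.2
    obtain ⟨r, hr⟩ := h.exists_algebraMap_eq (a.1 * u) c fun i => by
      have h2 := congrFun hc i
      rw [Pi.smul_apply, axisRes_apply, axisRes_apply] at h2
      rw [Pi.mul_apply, map_mul, ← h2, smul_eq_mul, mul_assoc, ← map_mul, hu, map_one, mul_one]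
    refine ⟨r, Subtype.ext (funext fun i => ?_)⟩
    change r • t i = a.1 i
    rw [Algebra.smul_def, hr, Pi.mul_apply, mul_assoc, mul_comm (u i), hu, mul_one]

/-- Modules of tuples whose residue space is the complement of a line without vanishing
coordinates are isomorphic to the canonical module. -/
theorem equiv_of_finrank_perp_eq_one {W : Submodule k (Fin n → k)}
    (hW : ∀ i, ∃ w ∈ perp W, w i ≠ 0) (h1 : Module.finrank k (perp W) = 1) :
    Nonempty (axisMod ρ W ≃ₗ[R] axisMod ρ (sumZero k n)) := by
  obtain ⟨w, hw, hspan⟩ := exists_eq_smul_of_finrank_eq_one h1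
  have hwi : ∀ i, w i ≠ 0 := fun i hi => by
    obtain ⟨v, hv, hvi⟩ := hW i
    obtain ⟨c, rfl⟩ := (hspan v).1 hv
    exact hvi (by rw [Pi.smul_apply, hi, smul_zero])
  have hmem : ∀ v, v ∈ W ↔ ∑ i, w i * v i = 0 := fun v => by
    rw [← perp_perp W, mem_perp]
    refine ⟨fun hv => hv w hw, fun hv v' hv' => ?_⟩
    obtain ⟨c, rfl⟩ := (hspan v').1 hv'
    simp only [Pi.smul_apply, smul_eq_mul, mul_assoc, ← Finset.mul_sum, hv, mul_zero]
  obtain ⟨t, rfl⟩ := h.axisRes_surjective w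
  choose u hu using fun i => (h.isUnit i (t i) (hwi i)).exists_right_inv
  have key : ∀ a, a ∈ axisMod ρ W ↔ t * a ∈ axisMod ρ (sumZero k n) := fun a => by
    rw [mem_axisMod, mem_axisMod, hmem, mem_sumZero]
    simp only [axisRes_apply, Pi.mul_apply, map_mul]
  refine ⟨LinearEquiv.ofBijective ((LinearMap.mulLeft R t).restrict fun a ha => (key a).1 ha)
    ⟨(injective_iff_map_eq_zero _).2 fun a ha => Subtype.ext (funext fun i => ?_), fun b => ?_⟩⟩
  · have h' : t i * a.1 i = 0 := congrFun (congrArg Subtype.val ha) i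
    change a.1 i = 0
    rw [← one_mul (a.1 i), ← hu, mul_right_comm, h', zero_mul]
  · have h' : t * (u * b.1) = b.1 := funext fun i => by
      rw [Pi.mul_apply, Pi.mul_apply, ← mul_assoc, hu, one_mul]
    exact ⟨⟨u * b.1, (key _).2 (h'.symm ▸ b.2)⟩, Subtype.ext h'⟩

/-- If all residues in `perp W` vanish at a coordinate, the product map is not injective. -/
theorem exists_axisMul_eq_zero {W W' : Submodule k (Fin n → k)} (i j : Fin n) (hij : j ≠ i)
    (hi : ∀ w ∈ W', w i = 0) (hW : Pi.single i 1 ∈ W) :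
    ∃ t, axisMul ρ W W' t = 0 ∧ t ≠ 0 := by
  obtain ⟨φ, b, hb, hφ⟩ : ∃ (φ : axisMod ρ W' →ₗ[R] k) (b : axisMod ρ W'),
      b.1 i = 0 ∧ φ b ≠ 0 := by
    by_cases h0 : W' = ⊥
    · have hx : ∀ b : axisMod ρ W', ∃ v, b.1 j = x j • v := fun b => by
        have hb : axisRes ρ b.1 ∈ (⊥ : Submodule k (Fin n → k)) := h0.le b.2
        exact (h.res_ker j _).1 (congrFun ((Submodule.mem_bot k).1 hb) j)
      choose g hg using hx
      refine ⟨(ρ j).toLinearMap ∘ₗ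
        { toFun := g
          map_add' := fun a b => h.cancel_eq (by
            rw [smul_add, ← hg, ← hg, ← hg]; rfl)
          map_smul' := fun r a => h.cancel_eq (by
            rw [RingHom.id_apply, smul_comm, ← hg, ← hg]; rfl) },
        ⟨Pi.single j (x j • 1), h.single_mem j 1 W'⟩, Pi.single_eq_of_ne hij.symm _, ?_⟩
      have : g ⟨Pi.single j (x j • 1), h.single_mem j 1 W'⟩ = 1 := h.cancel_eq (by
        rw [← hg]; exact Pi.single_eq_same _ _)
      change ρ j (g _) ≠ 0
      rw [this, map_one]
      exact one_ne_zero
    · obtain ⟨w, hw, hw0⟩ := Submodule.exists_mem_ne_zero_of_ne_bot h0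
      obtain ⟨l, hl⟩ := Function.ne_iff.1 hw0
      have hli : l ≠ i := by
        rintro rfl
        exact hl (hi w hw)
      obtain ⟨b, rfl⟩ := h.axisRes_surjective w
      have hb : axisRes ρ (Function.update b i 0) = axisRes ρ b := funext fun m => by
        by_cases hm : m = i
        · subst hm
          rw [hi _ hw, axisRes_apply, Function.update_self, map_zero]
        · rw [axisRes_apply, Function.update_of_ne hm, axisRes_apply]
      refine ⟨(ρ l).toLinearMap ∘ₗ LinearMap.proj l ∘ₗ (axisMod ρ W').subtype,
        ⟨Function.update b i 0, ?_⟩, Function.update_self .., ?_⟩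
      · change axisRes ρ _ ∈ W'
        rwa [hb]
      · change ρ l (Function.update b i 0 l) ≠ 0
        rwa [Function.update_of_ne hli]
  have he : Pi.single i 1 ∈ axisMod ρ W := by
    rw [mem_axisMod]
    convert! hW using 1
    funext l
    by_cases hl : l = i
    · subst hl; simp
    · simp [Pi.single_eq_of_ne hl]
  refine ⟨⟨Pi.single i 1, he⟩ ⊗ₜ b, ?_, fun ht => hφ ?_⟩
  · rw [axisMul_tmul, ← Pi.single_mul_left, hb, mul_zero, Pi.single_zero]
  · let β : axisMod ρ W ⊗[R] axisMod ρ W' →ₗ[R] k :=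
      TensorProduct.lift ((LinearMap.mul R k).compl₁₂
        ((ρ i).toLinearMap ∘ₗ LinearMap.proj i ∘ₗ (axisMod ρ W).subtype) φ)
    have : β (⟨Pi.single i 1, he⟩ ⊗ₜ b) = φ b := by
      change ρ i ((Pi.single i 1 : ∀ i, V i) i) * φ b = φ b
      rw [Pi.single_eq_same, map_one, one_mul]
    rw [← this, ht, map_zero]

/-- A faithful ideal `I` with `I ⊗ Hom(I, K)` torsionfree is isomorphic to `R` or `K`. -/
theorem equiv_or_equiv_of_torsion_eq_bot (hn : 0 < n) (I : Ideal R)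
    (hI : Module.annihilator R I = ⊥)
    (ht : Submodule.torsion R (I ⊗[R] (I →ₗ[R] axisMod ρ (sumZero k n))) = ⊥) :
    Nonempty (I ≃ₗ[R] R) ∨ Nonempty (I ≃ₗ[R] axisMod ρ (sumZero k n)) := by
  obtain ⟨W, hW, ⟨e⟩⟩ := h.exists_equiv_axisMod I hI
  obtain ⟨f⟩ := h.exists_dual_equiv W
  have hinj : ∀ t, axisMul ρ W (perp W) t = 0 → t = 0 := fun t ht0 => by
    let E := TensorProduct.congr e ((e.arrowCongr (LinearEquiv.refl R _)).trans f.symm)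
    rw [← E.symm.map_eq_zero_iff, ← Submodule.mem_bot R, ← ht, Submodule.mem_torsion_iff]
    refine ⟨⟨_, h.sum_sq_mem_nonZeroDivisors⟩, ?_⟩
    rw [Submonoid.mk_smul, ← map_smul, h.sum_sq_smul_eq_zero ht0, map_zero]
  have hfr := finrank_add_finrank_perp W
  by_cases h1 : Module.finrank k W = 1
  · obtain ⟨g⟩ := h.equiv_of_finrank_eq_one hW h1
    exact Or.inl ⟨e.trans g⟩
  have hr : Module.finrank k W ≠ 0 := fun h0 => by
    obtain ⟨w, hw, hw0⟩ := hW ⟨0, hn⟩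
    rw [Submodule.finrank_eq_zero.1 h0, Submodule.mem_bot] at hw
    exact hw0 (congrFun hw _)
  by_cases hW' : ∀ i, ∃ w ∈ perp W, w i ≠ 0
  · by_cases h2 : Module.finrank k (perp W) = 1
    · obtain ⟨g⟩ := h.equiv_of_finrank_perp_eq_one hW' h2
      exact Or.inr ⟨e.trans g⟩
    exfalso
    have hs : Module.finrank k (perp W) ≠ 0 := fun h0 => by
      obtain ⟨w, hw, hw0⟩ := hW' ⟨0, hn⟩
      rw [Submodule.finrank_eq_zero.1 h0, Submodule.mem_bot] at hw
      exact hw0 (congrFun hw _)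
    have hv := h.vecMul_injective hW hW' hinj
    have hle : LinearMap.range (vecMul W (perp W)) ≤ sumZero k n := by
      rintro _ ⟨θ, rfl⟩
      induction θ using TensorProduct.induction_on with
      | zero => rw [map_zero]; exact Submodule.zero_mem _
      | tmul w w' =>
        rw [vecMul_tmul, mem_sumZero]
        exact mem_perp.1 w'.2 w w.2
      | add θ θ' hθ hθ' => rw [map_add]; exact Submodule.add_mem _ hθ hθ'
    have hlt : sumZero k n < ⊤ := by
      refine lt_top_iff_ne_top.2 fun htop => ?_
      have : Pi.single ⟨0, hn⟩ 1 ∈ sumZero k n := htop ▸ Submodule.mem_top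
      rw [mem_sumZero, Finset.sum_pi_single'] at this
      simp at this
    have h3 := Submodule.finrank_lt_finrank_of_lt (lt_of_le_of_lt hle hlt)
    rw [LinearMap.finrank_range_of_inj hv, Module.finrank_tensorProduct, finrank_top,
      Module.finrank_fin_fun] at h3
    obtain ⟨r, hr'⟩ := Nat.exists_eq_add_of_le (show 2 ≤ Module.finrank k W by omega)
    obtain ⟨s, hs'⟩ := Nat.exists_eq_add_of_le (show 2 ≤ Module.finrank k (perp W) by omega)
    rw [hr', hs'] at h3 hfr
    nlinarith [Nat.zero_le (r * s)]
  · exfalso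
    push Not at hW'
    obtain ⟨i, hi⟩ := hW'
    have hiW : Pi.single i 1 ∈ W := by
      rw [← perp_perp W, mem_perp]
      intro w hw
      rw [Finset.sum_eq_single i (fun l _ hl => by rw [Pi.single_eq_of_ne hl, mul_zero]) (by simp),
        hi w hw, zero_mul]
    have hn2 : 1 < n := by omega
    obtain ⟨j, hj⟩ : ∃ j : Fin n, j ≠ i := by
      have : Nontrivial (Fin n) := Fin.nontrivial_iff_two_le.2 hn2
      exact exists_ne i
    obtain ⟨t, ht0, ht1⟩ := h.exists_axisMul_eq_zero i j hj hi hiW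
    exact ht1 (hinj t ht0)

end IsAxisRing

end AxisTensor

section Uniformizer

open IsLocalRing

variable {A : Type*} [CommRing A] [IsLocalRing A] [IsNoetherianRing A] {t : A}

theorem exists_eq_pow_mul_of_span_eq_maximalIdeal (ht : Ideal.span {t} = maximalIdeal A) {v : A}
    (hv : v ≠ 0) : ∃ (m : ℕ) (w : A), v = t ^ m * w ∧ IsUnit w := by
  classical
  have hex : ∃ m, v ∉ maximalIdeal A ^ m := by
    by_contra! hcon
    refine hv ((Submodule.mem_bot A).1 ?_)
    rw [← Ideal.iInf_pow_eq_bot_of_isLocalRing (maximalIdeal A) Ideal.IsPrime.ne_top',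
      Submodule.mem_iInf]
    exact hcon
  obtain ⟨m, hm⟩ : ∃ m, Nat.find hex = m + 1 := Nat.exists_eq_succ_of_ne_zero fun h0 => by
    have := Nat.find_spec hex
    rw [h0, pow_zero, Ideal.one_eq_top] at this
    exact this trivial
  have h1 := Nat.find_spec hex
  have h2 : v ∈ maximalIdeal A ^ m := not_not.1 (Nat.find_min hex (by omega))
  rw [hm] at h1
  rw [← ht, Ideal.span_singleton_pow] at h1 h2
  obtain ⟨w, rfl⟩ := Ideal.mem_span_singleton'.1 h2
  refine ⟨m, w, mul_comm _ _, ?_⟩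
  by_contra hw
  have hw' : w ∈ maximalIdeal A := hw
  rw [← ht] at hw'
  obtain ⟨c, rfl⟩ := Ideal.mem_span_singleton'.1 hw'
  exact h1 (Ideal.mem_span_singleton'.2 ⟨c, by ring⟩)

theorem eq_zero_of_uniformizer_mul_eq_zero (ht : Ideal.span {t} = maximalIdeal A)
    (hnil : ¬ IsNilpotent t) {v : A} (hv : t * v = 0) : v = 0 := by
  by_contra hv0
  obtain ⟨m, w, rfl, hw⟩ := exists_eq_pow_mul_of_span_eq_maximalIdeal ht hv0
  rw [← mul_assoc, ← pow_succ', hw.mul_left_eq_zero] at hv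
  exact hnil ⟨_, hv⟩

theorem ringKrullDim_le_zero_of_isNilpotent (hnil : IsNilpotent (maximalIdeal A)) :
    ringKrullDim A ≤ 0 := by
  have : Ring.KrullDimLE 0 A := isArtinianRing_iff_krullDimLE_zero.1
    ((isArtinianRing_iff_isNilpotent_maximalIdeal A).2 hnil)
  exact Order.KrullDimLE.krullDim_le

theorem not_isNilpotent_of_one_le_ringKrullDim (ht : Ideal.span {t} = maximalIdeal A)
    (hdim : 1 ≤ ringKrullDim A) : ¬ IsNilpotent t := by
  rintro ⟨m, hm⟩
  have h0 := hdim.trans (ringKrullDim_le_zero_of_isNilpotent (A := A) ⟨m, by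
    rw [← ht, Ideal.span_singleton_pow, hm, Ideal.span_singleton_zero, Ideal.zero_eq_bot]⟩)
  exact absurd h0 (by decide)

end Uniformizer

section Quotients

open IsLocalRing

variable {S : Type u} [CommRing S] {n : ℕ} {x : Fin n → S} {p : Fin n → Ideal S}

/-- The algebra structure on the coordinate rings of the axes. -/
abbrev axisAlgebra (p : Fin n → Ideal S) (i : Fin n) : Algebra (S ⧸ ⨅ i, p i) (S ⧸ p i) :=
  (Ideal.Quotient.factor (iInf_le p i)).toAlgebra

attribute [local instance] axisAlgebra

/-- The residue map of the coordinate ring of an axis. -/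
def axisResidue [IsLocalRing (S ⧸ ⨅ i, p i)]
    (hp : ∀ i, ∀ s ∈ p i, residue (S ⧸ ⨅ i, p i) (Ideal.Quotient.mk _ s) = 0) (i : Fin n) :
    (S ⧸ p i) →ₐ[S ⧸ ⨅ i, p i] ResidueField (S ⧸ ⨅ i, p i) :=
  { Ideal.Quotient.lift (p i) ((residue (S ⧸ ⨅ i, p i)).comp (Ideal.Quotient.mk _)) (hp i) with
    commutes' := fun r => by
      obtain ⟨s, rfl⟩ := Ideal.Quotient.mk_surjective r
      rfl }

variable [IsLocalRing S]

theorem residue_mk_eq_zero_iff {I : Ideal S} [IsLocalRing (S ⧸ I)] (s : S) :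
    residue (S ⧸ I) (Ideal.Quotient.mk I s) = 0 ↔ s ∈ maximalIdeal S := by
  have : (RingHom.ker ((residue (S ⧸ I)).comp (Ideal.Quotient.mk I))).IsMaximal :=
    RingHom.ker_isMaximal_of_surjective _
      (residue_surjective.comp Ideal.Quotient.mk_surjective)
  rw [← eq_maximalIdeal this]
  rfl

theorem exists_sub_mem_of_mem_maximalIdeal (hx : Ideal.span (Set.range x) = maximalIdeal S)
    (hp : ∀ i, p i = Ideal.span {y | ∃ j, j ≠ i ∧ y = x j}) (i : Fin n) {s : S}
    (hs : s ∈ maximalIdeal S) : ∃ c, s - c * x i ∈ p i := by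
  rw [← hx] at hs
  obtain ⟨c, rfl⟩ := (Submodule.mem_span_range_iff_exists_fun S).1 hs
  refine ⟨c i, ?_⟩
  rw [← Finset.add_sum_erase _ _ (Finset.mem_univ i), smul_eq_mul, add_sub_cancel_left, hp]
  exact Ideal.sum_mem _ fun j hj => Ideal.mul_mem_left _ _
    (Ideal.subset_span ⟨j, Finset.ne_of_mem_erase hj, rfl⟩)

theorem le_maximalIdeal_of_axis (hx : Ideal.span (Set.range x) = maximalIdeal S)
    (hp : ∀ i, p i = Ideal.span {y | ∃ j, j ≠ i ∧ y = x j}) (i : Fin n) :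
    p i ≤ maximalIdeal S := by
  rw [hp, ← hx]
  refine Ideal.span_mono ?_
  rintro _ ⟨j, -, rfl⟩
  exact ⟨j, rfl⟩

theorem one_le_ringKrullDim_axis [IsNoetherianRing S] (hdim : ringKrullDim S = n)
    (hx : Ideal.span (Set.range x) = maximalIdeal S)
    (hp : ∀ i, p i = Ideal.span {y | ∃ j, j ≠ i ∧ y = x j}) (i : Fin n) :
    1 ≤ ringKrullDim (S ⧸ p i) := by
  classical
  let s : Finset S := (Finset.univ.erase i).image x
  have hs : p i = Ideal.span (s : Set S) := by
    rw [hp]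
    congr 1
    ext y
    simp [s, eq_comm]
  have hle := ringKrullDim_le_ringKrullDim_quotient_add_card s (by
    rw [ringJacobson_eq_maximalIdeal]
    exact (Ideal.subset_span.trans (hs ▸ le_maximalIdeal_of_axis hx hp i : _)))
  have hcard : s.card + 1 ≤ n := by
    have h1 : s.card ≤ n - 1 := Finset.card_image_le.trans (by simp)
    have := i.pos
    omega
  rw [← hs, hdim] at hle
  have h2 : ((s.card + 1 : ℕ) : WithBot ℕ∞) ≤ ringKrullDim (S ⧸ p i) + s.card :=
    le_trans (by exact_mod_cast hcard) hle
  induction hd : ringKrullDim (S ⧸ p i) using WithBot.recBotCoe with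
  | bot => rw [hd] at h2; simp at h2
  | coe d =>
    rw [hd] at h2
    have h3 : ((s.card + 1 : ℕ) : ℕ∞) ≤ d + s.card := by exact_mod_cast h2
    rw [Nat.cast_add, add_comm] at h3
    have h4 := (ENat.add_le_add_iff_right (ENat.natCast_ne_top _)).1 h3
    exact_mod_cast h4

theorem isAxisRing_quotient [IsNoetherianRing S] [IsLocalRing (S ⧸ ⨅ i, p i)]
    (hdim : ringKrullDim S = n) (hx : Ideal.span (Set.range x) = maximalIdeal S)
    (hp : ∀ i, p i = Ideal.span {y | ∃ j, j ≠ i ∧ y = x j})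
    (hp' : ∀ i, ∀ s ∈ p i, residue (S ⧸ ⨅ i, p i) (Ideal.Quotient.mk _ s) = 0) :
    IsAxisRing (fun i => Ideal.Quotient.mk (⨅ i, p i) (x i)) (axisResidue hp') := by
  have hnt : ∀ i, Nontrivial (S ⧸ p i) := fun i => Ideal.Quotient.nontrivial_iff.2
    (ne_top_of_le_ne_top Ideal.IsPrime.ne_top' (le_maximalIdeal_of_axis hx hp i))
  have hloc : ∀ i, IsLocalRing (S ⧸ p i) := fun i =>
    IsLocalRing.of_surjective' (Ideal.Quotient.mk (p i)) Ideal.Quotient.mk_surjective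
  have hsmul : ∀ i (v : S ⧸ p i), Ideal.Quotient.mk (⨅ i, p i) (x i) • v =
      Ideal.Quotient.mk (p i) (x i) * v := fun _ _ => rfl
  have hpow : ∀ i (m : ℕ) (v : S ⧸ p i), Ideal.Quotient.mk (⨅ i, p i) (x i) ^ m • v =
      Ideal.Quotient.mk (p i) (x i) ^ m * v := fun i m v => by
    rw [Algebra.smul_def, map_pow]; rfl
  have hres : ∀ i (s : S), axisResidue hp' i (Ideal.Quotient.mk (p i) s) = 0 ↔
      s ∈ maximalIdeal S := fun i s => residue_mk_eq_zero_iff s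
  have hker : ∀ i (v : S ⧸ p i), axisResidue hp' i v = 0 ↔
      ∃ w, v = Ideal.Quotient.mk (p i) (x i) * w := fun i v => by
    constructor
    · intro hv
      obtain ⟨s, rfl⟩ := Ideal.Quotient.mk_surjective v
      obtain ⟨c, hc⟩ := exists_sub_mem_of_mem_maximalIdeal hx hp i ((hres i s).1 hv)
      exact ⟨Ideal.Quotient.mk (p i) c, by
        rw [← map_mul, mul_comm]
        exact Ideal.Quotient.eq.2 hc⟩
    · rintro ⟨w, rfl⟩
      rw [map_mul, (hres i _).2 (hx ▸ Ideal.subset_span ⟨i, rfl⟩), zero_mul]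
  have hunit : ∀ i (v : S ⧸ p i), axisResidue hp' i v ≠ 0 ↔ IsUnit v := fun i v => by
    refine ⟨fun hv => ?_, fun hv => (hv.map _).ne_zero⟩
    obtain ⟨s, rfl⟩ := Ideal.Quotient.mk_surjective v
    have : IsUnit s := by
      by_contra hs
      exact hv ((hres i s).2 hs)
    exact this.map _
  have hspan : ∀ i, Ideal.span {Ideal.Quotient.mk (p i) (x i)} = maximalIdeal (S ⧸ p i) :=
    fun i => Ideal.ext fun v => by
      rw [Ideal.mem_span_singleton, mem_maximalIdeal, mem_nonunits_iff, ← hunit, not_not, hker]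
      rfl
  exact
    { surj := fun i => Ideal.Quotient.factor_surjective _
      inj := fun r hr => by
        obtain ⟨s, rfl⟩ := Ideal.Quotient.mk_surjective r
        exact Ideal.Quotient.eq_zero_iff_mem.2 (Submodule.mem_iInf _ |>.2 fun i =>
          Ideal.Quotient.eq_zero_iff_mem.1 (hr i))
      off := fun i j hij => by
        refine Ideal.Quotient.eq_zero_iff_mem.2 ?_
        rw [hp]
        exact Ideal.subset_span ⟨j, hij, rfl⟩
      cancel := fun i v hv => eq_zero_of_uniformizer_mul_eq_zero (hspan i)
        (not_isNilpotent_of_one_le_ringKrullDim (hspan i)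
          (one_le_ringKrullDim_axis hdim hx hp i)) hv
      res_surj := residue_surjective
      res_ker := hker
      isUnit := fun i v hv => (hunit i v).1 hv
      val := fun i v hv => by
        obtain ⟨m, w, hw, hw'⟩ := exists_eq_pow_mul_of_span_eq_maximalIdeal (hspan i) hv
        exact ⟨m, w, hw.trans (hpow i m w).symm, (hunit i w).2 hw'⟩ }

end Quotients

section Dimension

variable {R k : Type*} [CommRing R] [Field k] [Algebra R k] {n : ℕ}
    {V : Fin n → Type*} [∀ i, CommRing (V i)] [∀ i, Algebra R (V i)]
    {x : Fin n → R} {ρ : ∀ i, V i →ₐ[R] k}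

open IsLocalRing

theorem IsAxisRing.ringKrullDim_le_one [IsLocalRing R] [IsNoetherianRing R]
    (h : IsAxisRing x ρ) (hm : ∀ r, r ∈ maximalIdeal R ↔ algebraMap R k r = 0) :
    ringKrullDim R ≤ 1 := by
  let z := ∑ i, x i
  have hz : z ∈ maximalIdeal R := (hm z).2 (by
    rw [map_sum]
    exact Finset.sum_eq_zero fun i _ => h.res_x i i)
  have hle := ringKrullDim_le_ringKrullDim_quotient_add_card ({z} : Finset R) (by
    rw [ringJacobson_eq_maximalIdeal]
    simpa using hz)
  rw [Finset.coe_singleton, Finset.card_singleton] at hle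
  have : Nontrivial (R ⧸ Ideal.span {z}) := Ideal.Quotient.nontrivial_iff.2
    (ne_top_of_le_ne_top Ideal.IsPrime.ne_top' ((Ideal.span_singleton_le_iff_mem _).2 hz))
  have : IsLocalRing (R ⧸ Ideal.span {z}) :=
    IsLocalRing.of_surjective' (Ideal.Quotient.mk _) Ideal.Quotient.mk_surjective
  have hnil : ringKrullDim (R ⧸ Ideal.span {z}) ≤ 0 := by
    refine ringKrullDim_le_zero_of_isNilpotent ?_
    rw [Ideal.FG.isNilpotent_iff_le_nilradical (IsNoetherian.noetherian _)]
    intro v hv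
    obtain ⟨r, rfl⟩ := Ideal.Quotient.mk_surjective v
    have hr : r ∈ maximalIdeal R := by
      rw [mem_maximalIdeal, mem_nonunits_iff]
      exact fun hu => hv (hu.map _)
    obtain ⟨s, rfl⟩ := h.exists_eq_sum none r ((hm r).1 hr) (fun _ hj => by cases hj)
    rw [map_sum]
    refine Ideal.sum_mem _ fun l _ => ?_
    rw [map_mul]
    refine Ideal.mul_mem_left _ _ ⟨2, ?_⟩
    rw [← map_pow]
    refine Ideal.Quotient.eq_zero_iff_mem.2 (Ideal.mem_span_singleton'.2 ⟨x l.1, ?_⟩)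
    rw [Finset.mul_sum, Finset.sum_eq_single l.1 (fun j _ hj => h.x_mul_x hj.symm) (by simp),
      pow_two]
  refine hle.trans ((add_le_add_left hnil _).trans ?_)
  simp

theorem IsAxisRing.finite_axisMod [IsNoetherianRing R] (h : IsAxisRing x ρ)
    (W : Submodule k (Fin n → k)) : Module.Finite R (axisMod ρ W) := by
  have : ∀ i, Module.Finite R (V i) := fun i =>
    Module.Finite.of_surjective (Algebra.linearMap R (V i)) (h.surj i)
  exact Module.IsNoetherian.finite R _

end Dimension

/-- Let `(S, n)` be a regular local ring of dimension `n > 0` with regular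
system of parameters `x₁, …, xₙ`, let `pᵢ = (xⱼ : j ≠ i)` and `R = S / ⋂ᵢ pᵢ`. Then `R` is
a one-dimensional Cohen–Macaulay local ring with a canonical module `K`, and every faithful
ideal `I` of `R` with `I ⊗_R Hom_R(I, K)` torsionfree satisfies `I ≅ R` or `I ≅ K`. -/
theorem stmt9 (S : Type u) [CommRing S] [IsLocalRing S] [IsNoetherianRing S]
    (n : ℕ) (hn : 0 < n) (hdim : ringKrullDim S = n)
    (x : Fin n → S) (hx : Ideal.span (Set.range x) = IsLocalRing.maximalIdeal S)
    (p : Fin n → Ideal S) (hp : ∀ i, p i = Ideal.span {y | ∃ j, j ≠ i ∧ y = x j}) :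
    IsLocalRing (S ⧸ (⨅ i, p i)) ∧ IsNoetherianRing (S ⧸ (⨅ i, p i)) ∧
    ringKrullDim (S ⧸ (⨅ i, p i)) = 1 ∧
    ∃ m : Ideal (S ⧸ (⨅ i, p i)), m.IsMaximal ∧
      (∃ z ∈ m, z ∈ nonZeroDivisors (S ⧸ (⨅ i, p i))) ∧
      ∃ K : ModuleCat.{u} (S ⧸ (⨅ i, p i)),
        IsCanonicalModuleAt (S ⧸ (⨅ i, p i)) m K ∧
        ∀ I : Ideal (S ⧸ (⨅ i, p i)),
          Module.annihilator (S ⧸ (⨅ i, p i)) ↥I = ⊥ →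
          Submodule.torsion (S ⧸ (⨅ i, p i)) (↥I ⊗[S ⧸ (⨅ i, p i)] (↥I →ₗ[S ⧸ (⨅ i, p i)] K)) = ⊥ →
          Nonempty (↥I ≃ₗ[S ⧸ (⨅ i, p i)] (S ⧸ (⨅ i, p i))) ∨
            Nonempty (↥I ≃ₗ[S ⧸ (⨅ i, p i)] K) := by
  have hle : ⨅ i, p i ≤ IsLocalRing.maximalIdeal S :=
    (iInf_le p ⟨0, hn⟩).trans (le_maximalIdeal_of_axis hx hp _)
  have hnt : Nontrivial (S ⧸ ⨅ i, p i) := Ideal.Quotient.nontrivial_iff.2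
    (ne_top_of_le_ne_top Ideal.IsPrime.ne_top' hle)
  have hloc : IsLocalRing (S ⧸ ⨅ i, p i) :=
    IsLocalRing.of_surjective' (Ideal.Quotient.mk _) Ideal.Quotient.mk_surjective
  let := axisAlgebra p
  have hp' : ∀ i, ∀ s ∈ p i,
      IsLocalRing.residue (S ⧸ ⨅ i, p i) (Ideal.Quotient.mk _ s) = 0 := fun i s hs =>
    (residue_mk_eq_zero_iff s).2 (le_maximalIdeal_of_axis hx hp i hs)
  have h := isAxisRing_quotient hdim hx hp hp'
  have hm : ∀ r, r ∈ IsLocalRing.maximalIdeal (S ⧸ ⨅ i, p i) ↔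
      algebraMap _ (IsLocalRing.ResidueField (S ⧸ ⨅ i, p i)) r = 0 := fun r =>
    (IsLocalRing.residue_eq_zero_iff r).symm
  refine ⟨hloc, inferInstance, le_antisymm (h.ringKrullDim_le_one hm)
    ((one_le_ringKrullDim_axis hdim hx hp ⟨0, hn⟩).trans
      (ringKrullDim_le_of_surjective _ (h.surj ⟨0, hn⟩))),
    IsLocalRing.maximalIdeal _, inferInstance, ⟨_, (hm _).2 ?_, h.sum_sq_mem_nonZeroDivisors⟩,
    ModuleCat.of _ (axisMod (axisResidue hp') (sumZero _ n)),
    h.isCanonicalModuleAt hm hn (h.finite_axisMod _),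
    fun I hI ht => h.equiv_or_equiv_of_torsion_eq_bot hn I hI ht⟩
  rw [map_sum]
  refine Finset.sum_eq_zero fun i _ => ?_
  rw [map_pow, h.res_x i i, zero_pow two_ne_zero]

end
end
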